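/- arXiv:2201.09994 — 4 statements merged into one kernel-verified Lean document; each statement's English description precedes it below -/
import Mathlib

section
/- Let S be a standard graded polynomial ring over a field k and M a finitely generated graded Cohen–Macaulay S-module of projective dimension p. Then the upper degree sequence of M, defined by d̄_i = max{ j : β_{i,j}(M) ≠ 0 }, is strictly increasing: d̄_{i-1} < d̄_i for all 1 ≤ i ≤ p. -/
/-- The free graded module with `b j` generators in degree `j` (i.e. `⊕_j A(-j)^{b j}`). -/
abbrev FreeMod (A : Type*) [CommRing A] (b : ℤ → ℕ) : Type _ :=
  ((j : ℤ) × Fin (b j)) →₀ A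

/-- A minimal graded free resolution of the module `M` over the (graded) commutative ring `A`,
where `hom m` is the set of homogeneous elements of degree `m` of `A`.  The data records the
graded Betti numbers `β i j` (the number of copies of `A(-j)` in homological degree `i`),
the differentials and the augmentation; the conditions say that the differentials are graded of
degree `0` (the entries of their matrices are homogeneous of the appropriate degree), that the
resolution is minimal (all entries have positive degree, equivalently lie in the irrelevant
maximal ideal), and that the complex is exact, resolving `M`. -/
structure MinGradedFreeRes (A : Type*) [CommRing A] (hom : ℕ → Set A)
    (M : Type*) [AddCommGroup M] [Module A M] where
  β : ℕ → ℤ → ℕ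
  finβ : ∀ i, (Function.support (β i)).Finite
  d : ∀ i, FreeMod A (β (i + 1)) →ₗ[A] FreeMod A (β i)
  aug : FreeMod A (β 0) →ₗ[A] M
  graded : ∀ (i : ℕ) (j : ℤ) (a : Fin (β (i + 1) j)) (j' : ℤ) (a' : Fin (β i j')),
      d i (Finsupp.single ⟨j, a⟩ 1) ⟨j', a'⟩ = 0 ∨
      ∃ m : ℕ, (m : ℤ) = j - j' ∧ d i (Finsupp.single ⟨j, a⟩ 1) ⟨j', a'⟩ ∈ hom m
  minimal : ∀ (i : ℕ) (j : ℤ) (a : Fin (β (i + 1) j)) (j' : ℤ) (a' : Fin (β i j')),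
      d i (Finsupp.single ⟨j, a⟩ 1) ⟨j', a'⟩ ≠ 0 → j' < j
  augSurj : Function.Surjective aug
  exact₀ : LinearMap.range (d 0) = LinearMap.ker aug
  exact : ∀ i, LinearMap.range (d (i + 1)) = LinearMap.ker (d i)

/-- The `i`-th total Betti number of a resolution. -/
noncomputable def MinGradedFreeRes.tB {A : Type*} [CommRing A] {hom : ℕ → Set A}
    {M : Type*} [AddCommGroup M] [Module A M]
    (res : MinGradedFreeRes A hom M) (i : ℕ) : ℕ :=
  ∑ j ∈ (res.finβ i).toFinset, res.β i j

/-- The height of an ideal: the infimum of the heights of the primes containing it. -/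
noncomputable def idealHeight {A : Type*} [CommRing A] (I : Ideal A) : ℕ∞ :=
  ⨅ (P : PrimeSpectrum A) (_ : I ≤ P.asIdeal), Order.height P

/-- The depth of a module over `k[x₁,…,xₙ]` with respect to the irrelevant maximal ideal:
the supremum of the lengths of regular sequences on `M` consisting of elements with zero
constant term. -/
noncomputable def gradedDepth (k : Type) [Field k] (n : ℕ) (M : Type) [AddCommGroup M]
    [Module (MvPolynomial (Fin n) k) M] : ℕ∞ :=
  sSup {r : ℕ∞ | ∃ rs : List (MvPolynomial (Fin n) k), (rs.length : ℕ∞) = r ∧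
    (∀ x ∈ rs, MvPolynomial.constantCoeff x = 0) ∧ RingTheory.Sequence.IsRegular M rs}

/-- The Krull dimension of a module: the dimension of `S / ann(M)`. -/
noncomputable def moduleDim (k : Type) [Field k] (n : ℕ) (M : Type) [AddCommGroup M]
    [Module (MvPolynomial (Fin n) k) M] : WithBot ℕ∞ :=
  ringKrullDim (MvPolynomial (Fin n) k ⧸ Module.annihilator (MvPolynomial (Fin n) k) M)

open CategoryTheory Abelian in
theorem ext_vanish_of_dim {R : Type} [CommRing R] [IsNoetherianRing R] [IsLocalRing R]
    (Y : ModuleCat.{0} R) [Module.Finite R Y] (e : ℕ) : ∀ (q : ℕ)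
    (_ : ∀ j ≤ e, Subsingleton (Ext (ModuleCat.of R (R ⧸ IsLocalRing.maximalIdeal R)) Y (q + j)))
    (L : Type) [AddCommGroup L] [Module R L] [Module.Finite R L]
    (_ : Module.supportDim R L ≤ e), Subsingleton (Ext (ModuleCat.of R L) Y q) := by
  induction e with
  | zero => ?_
  | succ e ih => ?_
  all_goals
    intro q hq L _ _ hfin
    induction hfin using IsNoetherianRing.induction_on_isQuotientEquivQuotientPrime R with
    | subsingleton N =>
      intro _
      have : Limits.IsZero (ModuleCat.of R N) := ModuleCat.isZero_of_subsingleton _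
      have := this.hasProjectiveDimensionLT_zero
      exact HasProjectiveDimensionLT.subsingleton (ModuleCat.of R N) 0 q (Nat.zero_le _) Y
    | exact N₁ N₂ N₃ f g hf hg hfg h₁ h₃ =>
      intro hd
      have i1 := h₁ ((Module.supportDim_le_of_injective f hf).trans hd)
      have i3 := h₃ ((Module.supportDim_le_of_surjective g hg).trans hd)
      let S : ShortComplex (ModuleCat.{0} R) :=
        ModuleCat.shortComplexOfCompEqZero f g hfg.linearMap_comp_eq_zero
      have hS : S.ShortExact :=
        { exact := ModuleCat.shortComplex_exact _ hfg
          mono_f := (ModuleCat.mono_iff_injective _).mpr hf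
          epi_g := (ModuleCat.epi_iff_surjective _).mpr hg }
      refine subsingleton_of_forall_eq 0 fun x => ?_
      obtain ⟨y, hy⟩ := Ext.contravariant_sequence_exact₂ hS Y x (i1.elim _ _)
      rw [← hy, i3.elim y 0]
      exact Ext.comp_zero _ _ _ _ _
    | quotient N p eq =>
      intro hd
      by_cases hp : p.1 = IsLocalRing.maximalIdeal R
      · have h0 := hq 0 (Nat.zero_le _)
        rw [← hp] at h0
        refine subsingleton_of_forall_eq 0 fun x => ?_
        have h1 : (Ext.mk₀ eq.toModuleIso.inv).comp x (zero_add q) = 0 := h0.elim _ _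
        have h2 := congrArg (fun z => (Ext.mk₀ eq.toModuleIso.hom).comp z (zero_add q)) h1
        have h3 : eq.toModuleIso.hom ≫ eq.toModuleIso.inv = 𝟙 (ModuleCat.of R N) :=
          eq.toModuleIso.hom_inv_id
        rw [← Ext.mk₀_id_comp x, ← h3, ← Ext.mk₀_comp_mk₀_assoc]
        exact h2.trans (Ext.comp_zero _ _ _ _ _)
      · have hlt : p.1 < IsLocalRing.maximalIdeal R :=
          lt_of_le_of_ne (IsLocalRing.le_maximalIdeal p.2.ne_top) hp
        obtain ⟨x, hxm, hxp⟩ := Set.exists_of_ssubset hlt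
        have hreg : IsSMulRegular N x := by
          intro a b hab
          apply eq.injective
          have h : x • eq a = x • eq b := by
            rw [← map_smul, ← map_smul]; exact congrArg eq hab
          obtain ⟨a', ha⟩ := Ideal.Quotient.mk_surjective (eq a)
          obtain ⟨b', hb⟩ := Ideal.Quotient.mk_surjective (eq b)
          rw [← ha, ← hb] at h ⊢
          rw [Algebra.smul_def, Algebra.smul_def] at h
          have h' : Ideal.Quotient.mk p.1 (x * a') = Ideal.Quotient.mk p.1 (x * b') := by
            simpa using h
          rw [Ideal.Quotient.eq] at h' ⊢
          rw [← mul_sub] at h'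
          exact (p.2.mem_or_mem h').resolve_left hxp
        have hdim := Module.supportDim_quotSMulTop_succ_eq_supportDim hreg hxm
        have key : Subsingleton (Ext (ModuleCat.of R (QuotSMulTop x N)) Y (q + 1)) := by
          rw [← hdim] at hd
          first
          | (apply ih (q + 1) _ (QuotSMulTop x N)
             · have h2 : Module.supportDim R (QuotSMulTop x N) + 1 ≤ (e : WithBot ℕ∞) + 1 := by
                 simpa using hd
               exact (ENat.WithBot.add_le_add_one_right_iff).mp h2
             · intro j hj
               have := hq (j + 1) (by omega)
               rwa [show q + 1 + j = q + (j + 1) by omega])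
          | (have hb : Module.supportDim R (QuotSMulTop x N) = ⊥ := by
               simpa [ENat.WithBot.add_one_le_zero_iff] using hd
             have := (Module.supportDim_eq_bot_iff_subsingleton R _).mp hb
             have : Limits.IsZero (ModuleCat.of R (QuotSMulTop x N)) :=
               ModuleCat.isZero_of_subsingleton _
             have := this.hasProjectiveDimensionLT_zero
             exact HasProjectiveDimensionLT.subsingleton _ 0 (q + 1) (Nat.zero_le _) Y)
        by_contra! ntr
        have hS := IsSMulRegular.smulShortComplex_shortExact (M := ModuleCat.of R N) hreg
        have : x ∈ (Module.annihilator R (Ext (ModuleCat.of R N) Y q)).jacobson :=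
          (IsLocalRing.maximalIdeal_le_jacobson _) hxm
        absurd Submodule.top_ne_pointwise_smul_of_mem_jacobson_annihilator this
        rw [eq_comm, eq_top_iff]
        intro y _
        obtain ⟨z, hz⟩ := Ext.contravariant_sequence_exact₁ hS Y (n₀ := q) y (n₁ := q + 1)
          (add_comm 1 q) (key.elim _ _)
        have aux : ∀ z : Ext (ModuleCat.of R N) Y q,
            (Ext.mk₀ (x • 𝟙 (ModuleCat.of R N))).comp z (zero_add q) = x • z := by
          intro z; simp [Ext.mk₀_smul]
        have hz' : x • z = y := (aux z).symm.trans hz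
        rw [← hz']
        exact Submodule.smul_mem_pointwise_smul _ _ ⊤ trivial

open CategoryTheory Abelian in
theorem local_pd_le {R : Type} [CommRing R] [IsNoetherianRing R] [IsLocalRing R]
    (xs : List R) (hxs : RingTheory.Sequence.IsRegular R xs)
    (hmax : Ideal.ofList xs = IsLocalRing.maximalIdeal R)
    (N : Type) [AddCommGroup N] [Module R N] [Module.Finite R N]
    (p : ℕ) (hp : ¬ HasProjectiveDimensionLT (ModuleCat.of R N) p) (rs : List R)
    (hrs : RingTheory.Sequence.IsWeaklyRegular N rs)
    (hm : ∀ r ∈ rs, r ∈ IsLocalRing.maximalIdeal R) : p + rs.length ≤ xs.length := by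
  have hmem : ∀ r ∈ xs, r ∈ IsLocalRing.maximalIdeal R := by
    intro r hr; rw [← hmax]; exact Ideal.subset_span hr
  have hk := ModuleCat.projectiveDimension_quotient_eq_add_length_of_isWeaklyRegular
    (ModuleCat.of R R) xs hxs.1 hmem
  have hN : Nontrivial N := by
    by_contra h
    rw [not_nontrivial_iff_subsingleton] at h
    have h1 : Limits.IsZero (ModuleCat.of R N) := ModuleCat.isZero_of_subsingleton _
    have := h1.hasProjectiveDimensionLT_zero
    exact hp (hasProjectiveDimensionLT_of_ge _ 0 p (Nat.zero_le _))
  have hL := ModuleCat.projectiveDimension_quotient_eq_add_length_of_isWeaklyRegular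
    (ModuleCat.of R N) rs hrs hm
  have hR : projectiveDimension (ModuleCat.of R R) ≤ (0 : ℕ) := by
    rw [projectiveDimension_le_iff]
    have : Projective (ModuleCat.of R R) := inferInstance
    infer_instance
  have hk2 : HasProjectiveDimensionLT (ModuleCat.of R (R ⧸ IsLocalRing.maximalIdeal R))
      (xs.length + 1) := by
    rw [← hmax]
    have he : Ideal.ofList xs • (⊤ : Submodule R R) = Ideal.ofList xs := by simp
    have : projectiveDimension (ModuleCat.of R (R ⧸ Ideal.ofList xs)) ≤ xs.length := by
      rw [← projectiveDimension_eq_of_iso (Submodule.quotEquivOfEq _ _ he).toModuleIso]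
      refine hk.trans_le ?_
      calc _ ≤ ((0:ℕ) : WithBot ℕ∞) + (xs.length : WithBot ℕ∞) := by gcongr
        _ = _ := by simp
    exact (projectiveDimension_le_iff _ _).mp this
  have hgl : HasProjectiveDimensionLT
      (ModuleCat.of R (N ⧸ Ideal.ofList rs • (⊤ : Submodule R N))) (xs.length + 1) := by
    apply ModuleCat.hasProjectiveDimensionLT_of_forall_finite
    intro Y _
    obtain ⟨e, he⟩ : ∃ e : ℕ, ringKrullDim R = e := by
      obtain ⟨e, he⟩ := ENat.ne_top_iff_exists.mp (Ideal.height_ne_top (IsLocalRing.maximalIdeal.isMaximal R).ne_top)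
      exact ⟨e, by rw [← IsLocalRing.maximalIdeal_height_eq_ringKrullDim, ← he]; rfl⟩
    refine ext_vanish_of_dim Y e _ ?_ _ ((Module.supportDim_le_ringKrullDim R _).trans he.le)
    intro j _
    exact HasProjectiveDimensionLT.subsingleton _ (xs.length + 1) _ (by omega) Y
  have h1 : projectiveDimension (ModuleCat.of R N) + rs.length ≤ (xs.length : WithBot ℕ∞) := by
    rw [← hL, projectiveDimension_le_iff]; exact hgl
  have h2 : (p : WithBot ℕ∞) ≤ projectiveDimension (ModuleCat.of R N) := by
    rw [projectiveDimension_ge_iff]; exact hp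
  have h3 : (p : WithBot ℕ∞) + rs.length ≤ (xs.length : WithBot ℕ∞) :=
    (by gcongr : (p : WithBot ℕ∞) + rs.length ≤ _).trans h1
  exact_mod_cast h3

open CategoryTheory Abelian in
theorem local_ext {R : Type} [CommRing R] [IsNoetherianRing R] [IsLocalRing R]
    (xs : List R) (hxs : RingTheory.Sequence.IsRegular R xs)
    (hmax : Ideal.ofList xs = IsLocalRing.maximalIdeal R)
    (N : Type) [AddCommGroup N] [Module R N] [Module.Finite R N]
    (d q : ℕ) (hd : Module.supportDim R N ≤ d) (hq : q + d < xs.length) :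
    Subsingleton (Ext (ModuleCat.of R N) (ModuleCat.of R R) q) := by
  refine ext_vanish_of_dim (ModuleCat.of R R) d q ?_ N hd
  intro j hj
  have hlt : IsLocalRing.maximalIdeal R • (⊤ : Submodule R R) < ⊤ := by
    simpa [lt_top_iff_ne_top] using (IsLocalRing.maximalIdeal.isMaximal R).ne_top
  refine ModuleCat.subsingleton_ext_of_exists_isRegular (IsLocalRing.maximalIdeal R)
    (ModuleCat.of R (R ⧸ IsLocalRing.maximalIdeal R)) ?_ (ModuleCat.of R R) hlt xs ?_ hxs (q + j)
    (by omega)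
  · rw [Module.support_eq_zeroLocus]
    simp [Ideal.annihilator_quotient]
  · intro r hr; rw [← hmax]; exact Ideal.subset_span hr
open CategoryTheory Abelian in
theorem cocycle_zero {R : Type} [CommRing R] (Y N F₀ F₁ : Type)
    [AddCommGroup Y] [Module R Y] [AddCommGroup N] [Module R N]
    [AddCommGroup F₀] [Module R F₀] [AddCommGroup F₁] [Module R F₁]
    (d : F₁ →ₗ[R] F₀) (aug : F₀ →ₗ[R] N) (hs : Function.Surjective aug)
    (h0 : Function.Exact d aug) (hE : Subsingleton (Ext (ModuleCat.of R N) (ModuleCat.of R Y) 0))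
    (φ : F₀ →ₗ[R] Y) (hφ : φ ∘ₗ d = 0) : φ = 0 := by
  have : Subsingleton (N →ₗ[R] Y) :=
    (Ext.addEquiv₀.trans (ModuleCat.homAddEquiv (M := ModuleCat.of R N) (N := ModuleCat.of R Y))).symm.subsingleton
  have hker : LinearMap.ker aug ≤ LinearMap.ker φ := by
    intro x hx
    obtain ⟨y, rfl⟩ := (h0 x).mp hx
    exact LinearMap.congr_fun hφ y
  obtain ⟨ψ, hψ⟩ : ∃ ψ : N →ₗ[R] Y, ψ ∘ₗ aug = φ := by
    refine ⟨(Submodule.liftQ _ φ hker) ∘ₗ (aug.quotKerEquivOfSurjective hs).symm.toLinearMap, ?_⟩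
    ext x
    simp only [LinearMap.comp_apply, LinearEquiv.coe_coe]
    have : (aug.quotKerEquivOfSurjective hs).symm (aug x) = Submodule.Quotient.mk x := by
      rw [LinearEquiv.symm_apply_eq]; rfl
    rw [this]; rfl
  rw [← hψ, Subsingleton.elim ψ 0, LinearMap.zero_comp]

open CategoryTheory Abelian in
theorem cocycle_succ {R : Type} [CommRing R] (Y : Type) [AddCommGroup Y] [Module R Y] (q : ℕ) :
    ∀ (N : Type) [AddCommGroup N] [Module R N]
    (F : ℕ → Type) [∀ i, AddCommGroup (F i)] [∀ i, Module R (F i)] [∀ i, Module.Free R (F i)]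
    (d : ∀ i, F (i + 1) →ₗ[R] F i) (aug : F 0 →ₗ[R] N) (_ : Function.Surjective aug)
    (_ : Function.Exact (d 0) aug) (_ : ∀ i, Function.Exact (d (i + 1)) (d i))
    (_ : Subsingleton (Ext (ModuleCat.of R N) (ModuleCat.of R Y) (q + 1)))
    (φ : F (q + 1) →ₗ[R] Y) (_ : φ ∘ₗ d (q + 1) = 0), ∃ ψ : F q →ₗ[R] Y, ψ ∘ₗ d q = φ := by
  induction q with
  | zero =>
    intro N _ _ F _ _ _ d aug hs h0 hex hE φ hφ
    have hS := LinearMap.shortExact_shortComplexKer hs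
    let d' : F 1 →ₗ[R] LinearMap.ker aug := (d 0).codRestrict _ (fun x => (h0 _).mpr ⟨x, rfl⟩)
    have hd' : Function.Surjective d' := by
      rintro ⟨y, hy⟩
      obtain ⟨x, hx⟩ := (h0 y).mp hy
      exact ⟨x, Subtype.ext hx⟩
    have hker : LinearMap.ker d' ≤ LinearMap.ker φ := by
      intro x hx
      have : d 0 x = 0 := congrArg Subtype.val hx
      obtain ⟨y, rfl⟩ := (hex 0 x).mp this
      exact LinearMap.congr_fun hφ y
    obtain ⟨χ, hχ⟩ : ∃ χ : LinearMap.ker aug →ₗ[R] Y, χ ∘ₗ d' = φ := by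
      refine ⟨(Submodule.liftQ _ φ hker) ∘ₗ (d'.quotKerEquivOfSurjective hd').symm.toLinearMap, ?_⟩
      ext x
      simp only [LinearMap.comp_apply, LinearEquiv.coe_coe]
      have : (d'.quotKerEquivOfSurjective hd').symm (d' x) = Submodule.Quotient.mk x := by
        rw [LinearEquiv.symm_apply_eq]; rfl
      rw [this]; rfl
    obtain ⟨x₂, hx₂⟩ := Ext.contravariant_sequence_exact₁ hS (ModuleCat.of R Y)
      (Ext.mk₀ (ModuleCat.ofHom χ)) (n₁ := 1) rfl (hE.elim _ _)
    obtain ⟨f, rfl⟩ := (Ext.mk₀_bijective _ _).2 x₂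
    rw [Ext.mk₀_comp_mk₀, (Ext.mk₀_bijective _ _).1.eq_iff] at hx₂
    refine ⟨f.hom, ?_⟩
    have h3 := congrArg ModuleCat.Hom.hom hx₂
    rw [← hχ]
    ext x
    exact LinearMap.congr_fun h3 (d' x)
  | succ q ih =>
    intro N _ _ F _ _ _ d aug hs h0 hex hE φ hφ
    have hS := LinearMap.shortExact_shortComplexKer hs
    let d' : F 1 →ₗ[R] LinearMap.ker aug := (d 0).codRestrict _ (fun x => (h0 _).mpr ⟨x, rfl⟩)
    have hd' : Function.Surjective d' := by
      rintro ⟨y, hy⟩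
      obtain ⟨x, hx⟩ := (h0 y).mp hy
      exact ⟨x, Subtype.ext hx⟩
    refine ih (LinearMap.ker aug) (fun i => F (i + 1)) (fun i => d (i + 1)) d' hd' ?_
      (fun i => hex (i + 1)) ?_ φ hφ
    · intro x
      rw [← hex 0 x]
      exact Subtype.ext_iff
    · refine subsingleton_of_forall_eq 0 fun x => ?_
      obtain ⟨y, hy⟩ := Ext.contravariant_sequence_exact₁ hS (ModuleCat.of R Y) x
        (n₁ := q + 1 + 1) (add_comm _ _) (hE.elim _ _)
      have : Projective (ModuleCat.of R (F 0)) := inferInstance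
      have := Ext.subsingleton_of_projective (ModuleCat.of R (F 0)) (ModuleCat.of R Y) q
      rw [← hy, this.elim y 0]
      exact Ext.comp_zero _ _ _ _ _
theorem X_weaklyRegular (k : Type) [Field k] (n : ℕ) :
    RingTheory.Sequence.IsWeaklyRegular (MvPolynomial (Fin n) k)
      (List.ofFn (fun i : Fin n => (MvPolynomial.X i : MvPolynomial (Fin n) k))) := by
  refine ⟨fun i hi => ?_⟩
  have hin : i < n := by simpa using hi
  have hI : Ideal.ofList ((List.ofFn (fun i : Fin n => (MvPolynomial.X i : MvPolynomial (Fin n) k))).take i)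
      • (⊤ : Submodule (MvPolynomial (Fin n) k) (MvPolynomial (Fin n) k)) =
      Ideal.span (MvPolynomial.X '' {a : Fin n | (a : ℕ) < i}) := by
    rw [smul_eq_mul, Ideal.mul_top, Ideal.ofList]
    congr 1
    ext f
    simp only [Set.mem_ofPred_eq, Set.mem_image, List.mem_take_iff_getElem, List.getElem_ofFn,
      List.length_ofFn]
    constructor
    · rintro ⟨j, hj, rfl⟩
      exact ⟨⟨j, by omega⟩, by simp; omega, rfl⟩
    · rintro ⟨a, ha, rfl⟩
      exact ⟨a, by omega, rfl⟩
  rw [hI, List.getElem_ofFn]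
  intro a b hab
  obtain ⟨f, rfl⟩ := Submodule.Quotient.mk_surjective _ a
  obtain ⟨g, rfl⟩ := Submodule.Quotient.mk_surjective _ b
  simp only [← Submodule.Quotient.mk_smul] at hab
  rw [Submodule.Quotient.eq] at hab ⊢
  rw [← smul_sub, smul_eq_mul, MvPolynomial.mem_ideal_span_X_image] at hab
  rw [MvPolynomial.mem_ideal_span_X_image]
  intro s hs
  obtain ⟨c, hc, hne⟩ := hab (Finsupp.single ⟨i, hin⟩ 1 + s) (by
    rw [MvPolynomial.mem_support_iff, MvPolynomial.coeff_X_mul]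
    exact MvPolynomial.mem_support_iff.mp hs)
  refine ⟨c, hc, ?_⟩
  have : (⟨i, hin⟩ : Fin n) ≠ c := by
    rintro rfl; simp at hc
  simpa [Finsupp.single_apply, this] using hne

theorem ofList_X (k : Type) [Field k] (n : ℕ) :
    Ideal.ofList (List.ofFn (fun i : Fin n => (MvPolynomial.X i : MvPolynomial (Fin n) k))) =
      RingHom.ker (MvPolynomial.constantCoeff : MvPolynomial (Fin n) k →+* k) := by
  have : Ideal.ofList (List.ofFn (fun i : Fin n => (MvPolynomial.X i : MvPolynomial (Fin n) k)))
      = Ideal.span (MvPolynomial.X '' (Set.univ : Set (Fin n))) := by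
    rw [Ideal.ofList]; congr 1; ext f; simp [List.mem_ofFn]
  rw [this]
  ext f
  rw [MvPolynomial.mem_ideal_span_X_image, RingHom.mem_ker]
  constructor
  · intro h
    by_contra h0
    obtain ⟨i, -, hi⟩ := h 0 (by rw [MvPolynomial.mem_support_iff]; exact h0)
    simp at hi
  · intro h s hs
    by_contra! h1
    have : s = 0 := by ext i; simpa using h1 i trivial
    subst this
    rw [MvPolynomial.mem_support_iff] at hs
    exact hs h

theorem supportDim_localized_le {S : Type} [CommRing S] (T : Submonoid S)
    (M : Type) [AddCommGroup M] [Module S M] [Module.Finite S M] :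
    Module.supportDim (Localization T) (LocalizedModule T M) ≤ 
      ringKrullDim (S ⧸ Module.annihilator S M) := by
  rw [← Module.supportDim_eq_ringKrullDim_quotient_annihilator]
  have h : ∀ P : Module.support (Localization T) (LocalizedModule T M),
      PrimeSpectrum.comap (algebraMap S (Localization T)) P.1 ∈ Module.support S M := by
    rintro ⟨P, hP⟩
    rw [Module.support_eq_zeroLocus] at hP ⊢
    intro x hx
    apply hP
    rw [SetLike.mem_coe, Module.mem_annihilator] at hx ⊢
    intro z
    induction z with
    | _ m t =>
    rw [algebraMap_smul, LocalizedModule.smul'_mk, hx m, LocalizedModule.zero_mk]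
  refine Order.krullDim_le_of_strictMono (fun P => ⟨_, h P⟩) ?_
  intro P Q hPQ
  have hinj := PrimeSpectrum.localization_comap_injective (Localization T) T
  refine lt_of_le_of_ne (Ideal.comap_mono hPQ.le) ?_
  intro he
  exact hPQ.ne (Subtype.ext (hinj (congrArg Subtype.val he)))


theorem MinGradedFreeRes.entry_mem {k : Type} [Field k] {n : ℕ}
    {M : Type} [AddCommGroup M] [Module (MvPolynomial (Fin n) k) M]
    (res : MinGradedFreeRes (MvPolynomial (Fin n) k)
      (fun m => {f | MvPolynomial.IsHomogeneous f m}) M) (i : ℕ)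
    (x : (j : ℤ) × Fin (res.β (i + 1) j)) (y : (j : ℤ) × Fin (res.β i j)) :
    res.d i (Finsupp.single x 1) y ∈
      RingHom.ker (MvPolynomial.constantCoeff : MvPolynomial (Fin n) k →+* k) := by
  obtain ⟨j, a⟩ := x
  obtain ⟨j', a'⟩ := y
  by_cases h0 : res.d i (Finsupp.single ⟨j, a⟩ 1) ⟨j', a'⟩ = 0
  · rw [h0]; exact Ideal.zero_mem _
  · obtain h | ⟨m, hm, h⟩ := res.graded i j a j' a'
    · exact absurd h h0
    · have hlt := res.minimal i j a j' a' h0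
      rw [RingHom.mem_ker]
      by_contra hne
      have := h (d := 0) hne
      simp at this
      omega

theorem MinGradedFreeRes.beta_ne_zero {k : Type} [Field k] {n : ℕ}
    {M : Type} [AddCommGroup M] [Module (MvPolynomial (Fin n) k) M]
    (res : MinGradedFreeRes (MvPolynomial (Fin n) k)
      (fun m => {f | MvPolynomial.IsHomogeneous f m}) M) (i : ℕ)
    (h : res.β (i + 1) ≠ 0) : res.β i ≠ 0 := by
  intro h0
  obtain ⟨j, hj⟩ := Function.ne_iff.mp h
  have : Nonempty (Fin (res.β (i + 1) j)) := ⟨⟨0, Nat.pos_of_ne_zero hj⟩⟩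
  obtain ⟨a⟩ := this
  have hz : ∀ x, res.d i x = 0 := by
    intro x
    ext ⟨j', a'⟩
    rw [h0] at a'
    exact a'.elim0
  have hmem : Finsupp.single ⟨j, a⟩ 1 ∈ LinearMap.range (res.d (i + 1)) := by
    rw [res.exact i]; exact hz _
  obtain ⟨x, hx⟩ := hmem
  have key : ∀ x, res.d (i + 1) x ⟨j, a⟩ ∈
      RingHom.ker (MvPolynomial.constantCoeff : MvPolynomial (Fin n) k →+* k) := by
    intro x
    induction x using Finsupp.induction_linear with
    | zero => simp
    | add f g hf hg => rw [map_add]; exact Ideal.add_mem _ hf hg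
    | single y c =>
      have : Finsupp.single y c = c • Finsupp.single y (1 : MvPolynomial (Fin n) k) := by simp
      rw [this, map_smul]
      exact Ideal.mul_mem_left _ _ (res.entry_mem (i + 1) y ⟨j, a⟩)
  have h1 := key x
  rw [hx] at h1
  simp [RingHom.mem_ker] at h1

/-- Over a standard graded polynomial ring `S = k[x₁,…,xₙ]`, the upper degree
sequence `d̄ᵢ = max { j : β_{i,j}(M) ≠ 0 }` of the minimal graded free resolution of a finitely
generated graded Cohen–Macaulay `S`-module `M` of projective dimension `p` is strictly
increasing: `d̄_{i-1} < d̄_i` for `1 ≤ i ≤ p`. -/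
theorem upper_degree_sequence_strictly_increasing_of_cohenMacaulay
    (k : Type) [Field k] (n : ℕ)
    (M : Type) [AddCommGroup M] [Module (MvPolynomial (Fin n) k) M]
    [Module.Finite (MvPolynomial (Fin n) k) M]
    (hCM : moduleDim k n M = ((gradedDepth k n M : ℕ∞) : WithBot ℕ∞))
    (res : MinGradedFreeRes (MvPolynomial (Fin n) k)
      (fun m => {f | MvPolynomial.IsHomogeneous f m}) M)
    (p : ℕ) (hlen : ∀ i, p < i → res.β i = 0) (hp : res.β p ≠ 0) :
    ∀ i : ℕ, 1 ≤ i → i ≤ p →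
      ∃ j : ℤ, res.β i j ≠ 0 ∧ ∀ j' : ℤ, res.β (i - 1) j' ≠ 0 → j' < j := by
  classical
  intro i hi hip
  obtain ⟨q, rfl⟩ : ∃ q, i = q + 1 := ⟨i - 1, by omega⟩
  obtain ⟨p', rfl⟩ : ∃ p', p = p' + 1 := ⟨p - 1, by omega⟩
  simp only [Nat.add_sub_cancel]
  -- localization
  let m : Ideal (MvPolynomial (Fin n) k) := RingHom.ker MvPolynomial.constantCoeff
  have hmp : m.IsPrime := RingHom.ker_isPrime _
  let T := m.primeCompl
  let R := Localization.AtPrime m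
  let F : ℕ → Type := fun i => LocalizedModule T (FreeMod (MvPolynomial (Fin n) k) (res.β i))
  let N := LocalizedModule T M
  let D : ∀ i, F (i + 1) →ₗ[R] F i := fun i => LocalizedModule.map T (res.d i)
  let aug : F 0 →ₗ[R] N := LocalizedModule.map T res.aug
  have hfree : ∀ i, Module.Free R (F i) := fun i =>
    Module.free_of_isLocalizedModule (Rₛ := R) (Mₛ := F i) T
      (LocalizedModule.mkLinearMap T (FreeMod (MvPolynomial (Fin n) k) (res.β i)))
  have hfin : Module.Finite R N := inferInstance
  have hs : Function.Surjective aug := LocalizedModule.map_surjective T res.aug res.augSurj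
  have hex0 : Function.Exact (D 0) aug :=
    LocalizedModule.map_exact T _ _ (LinearMap.exact_iff.mpr res.exact₀.symm)
  have hex : ∀ i, Function.Exact (D (i + 1)) (D i) := fun i =>
    LocalizedModule.map_exact T _ _ (LinearMap.exact_iff.mpr (res.exact i).symm)
  let mk : ∀ i, FreeMod (MvPolynomial (Fin n) k) (res.β i) →ₗ[MvPolynomial (Fin n) k] F i :=
    fun i => LocalizedModule.mkLinearMap T _
  have hDmk : ∀ i x, D i (mk (i + 1) x) = mk i (res.d i x) := by
    intro i x
    exact IsLocalizedModule.map_apply T (LocalizedModule.mkLinearMap T _)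
      (LocalizedModule.mkLinearMap T _) (res.d i) x
  let es : ∀ i, ((j : ℤ) × Fin (res.β i j)) → (F i →ₗ[R] R) := fun i y =>
    IsLocalizedModule.mapExtendScalars T (mk i) (Algebra.linearMap _ R) R (Finsupp.lapply y)
  have hes : ∀ i y x, es i y (mk i x) = algebraMap _ R (x y) := by
    intro i y x
    exact IsLocalizedModule.map_apply T (mk i) (Algebra.linearMap _ R) (Finsupp.lapply y) x
  have hmem : ∀ x ∈ m, algebraMap _ R x ∈ IsLocalRing.maximalIdeal R := by
    intro x hx
    exact (IsLocalization.AtPrime.to_map_mem_maximal_iff R m x).mpr hx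
  have hnot : ∀ i y (ψ : F i →ₗ[R] R), ψ ∘ₗ D i ≠ es (i + 1) y := by
    intro i y ψ h
    have h1 := LinearMap.congr_fun h (mk (i + 1) (Finsupp.single y 1))
    rw [LinearMap.comp_apply, hDmk, hes, Finsupp.single_eq_same, map_one] at h1
    have key : ∀ x : FreeMod (MvPolynomial (Fin n) k) (res.β i), (∀ z, x z ∈ m) →
        ψ (mk i x) ∈ IsLocalRing.maximalIdeal R := by
      intro x hx
      rw [← Finsupp.sum_single x, Finsupp.sum, map_sum, map_sum]
      refine Ideal.sum_mem _ fun z _ => ?_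
      have : Finsupp.single z (x z) = x z • Finsupp.single z (1 : MvPolynomial (Fin n) k) := by simp
      rw [this, map_smul, ← algebraMap_smul R, map_smul]
      exact Ideal.mul_mem_right _ _ (hmem _ (hx z))
    have h2 := key _ (fun z => res.entry_mem i y z)
    rw [h1] at h2
    exact (IsLocalRing.maximalIdeal.isMaximal R).ne_top ((Ideal.eq_top_iff_one _).mpr h2)
  have hcoc : ∀ i y, (∀ x, res.d i (Finsupp.single x 1) y = 0) → es i y ∘ₗ D i = 0 := by
    intro i y hy
    have h0 : ∀ x, res.d i x y = 0 := by
      intro x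
      induction x using Finsupp.induction_linear with
      | zero => simp
      | add f g hf hg => rw [map_add, Finsupp.add_apply, hf, hg, add_zero]
      | single z c =>
        have : Finsupp.single z c = c • Finsupp.single z (1 : MvPolynomial (Fin n) k) := by simp
        rw [this, map_smul, Finsupp.smul_apply, hy, smul_zero]
    have h1 : (es i y ∘ₗ D i).restrictScalars (MvPolynomial (Fin n) k) = 0 := by
      refine IsLocalizedModule.linearMap_ext T (mk (i + 1)) (Algebra.linearMap _ R) ?_
      refine LinearMap.ext fun x => ?_
      change es i y (D i (mk (i + 1) x)) = 0
      rw [hDmk, hes, h0, map_zero]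
    refine LinearMap.ext fun x => ?_
    exact LinearMap.congr_fun h1 x
  -- the regular sequence of variables
  let xs₀ := List.ofFn (fun i : Fin n => (MvPolynomial.X i : MvPolynomial (Fin n) k))
  let xs : List R := xs₀.map (algebraMap _ R)
  have hxslen : xs.length = n := by simp [xs, xs₀]
  have hxs : RingTheory.Sequence.IsRegular R xs := by
    refine (X_weaklyRegular k n).isRegular_of_isLocalization_of_mem R m ?_
    intro r hr
    change r ∈ RingHom.ker _
    rw [← ofList_X]
    exact Ideal.subset_span hr
  have hmax : Ideal.ofList xs = IsLocalRing.maximalIdeal R := by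
    rw [← Ideal.map_ofList, ofList_X]
    exact Localization.AtPrime.map_eq_maximalIdeal
  -- projective dimension at least p
  have hpd : ¬ CategoryTheory.HasProjectiveDimensionLT (ModuleCat.of R N) (p' + 1) := by
    intro h
    obtain ⟨j, hj⟩ := Function.ne_iff.mp hp
    have hE := CategoryTheory.HasProjectiveDimensionLT.subsingleton (ModuleCat.of R N) (p' + 1)
      (p' + 1) le_rfl (ModuleCat.of R R)
    obtain ⟨ψ, hψ⟩ := cocycle_succ R p' N F D aug hs hex0 hex hE
      (es (p' + 1) ⟨j, ⟨0, Nat.pos_of_ne_zero hj⟩⟩) (by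
        refine hcoc _ _ fun x => ?_
        have h0 := hlen (p' + 1 + 1) (by omega)
        obtain ⟨j', a'⟩ := x
        rw [h0] at a'
        exact a'.elim0)
    exact hnot _ _ _ hψ
  -- depth and dimension
  obtain ⟨d, hd⟩ : ∃ d : ℕ, gradedDepth k n M = d := by
    have h1 : moduleDim k n M ≤ (n : WithBot ℕ∞) := by
      refine (ringKrullDim_quotient_le _).trans ?_
      rw [MvPolynomial.ringKrullDim_of_isNoetherianRing]
      simp
    rw [hCM] at h1
    have h2 : gradedDepth k n M ≤ (n : ℕ∞) := by exact_mod_cast h1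
    obtain ⟨d, hd⟩ := ENat.ne_top_iff_exists.mp (ne_top_of_le_ne_top (ENat.natCast_ne_top n) h2)
    exact ⟨d, hd.symm⟩
  obtain ⟨rs, hrlen, hrm, hrs⟩ : ∃ rs : List (MvPolynomial (Fin n) k), d ≤ rs.length ∧
      (∀ x ∈ rs, MvPolynomial.constantCoeff x = 0) ∧
      RingTheory.Sequence.IsWeaklyRegular M rs := by
    obtain rfl | ⟨d', rfl⟩ : d = 0 ∨ ∃ d', d = d' + 1 := by
      cases d with
      | zero => exact Or.inl rfl
      | succ d' => exact Or.inr ⟨d', rfl⟩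
    · exact ⟨[], by simp, by simp, by simp⟩
    · have hlt : (d' : ℕ∞) < gradedDepth k n M := by
        rw [hd]; exact_mod_cast Nat.lt_succ_self d'
      obtain ⟨r, ⟨rs, rfl, h1, h2⟩, h3⟩ := lt_sSup_iff.mp hlt
      exact ⟨rs, by exact_mod_cast h3, h1, h2.1⟩
  have hsum : p' + 1 + d ≤ n := by
    have h := local_pd_le xs hxs hmax N (p' + 1) hpd (rs.map (algebraMap _ R))
      (hrs.of_isLocalizedModule R T (LocalizedModule.mkLinearMap T M)) (by
        intro r hr
        obtain ⟨r', hr', rfl⟩ := List.mem_map.mp hr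
        exact hmem _ (hrm r' hr'))
    rw [hxslen, List.length_map] at h
    omega
  have hdimN : Module.supportDim R N ≤ d := by
    refine (supportDim_localized_le T M).trans ?_
    change moduleDim k n M ≤ _
    rw [hCM, hd]
    rfl
  have hE := local_ext xs hxs hmax N d q hdimN (by omega)
  -- rows are nonzero
  have hrow : ∀ y, ∃ x, res.d q (Finsupp.single x 1) y ≠ 0 := by
    intro y
    by_contra! hy
    have hc := hcoc q y hy
    cases q with
    | zero =>
      have h0 := cocycle_zero R N (F 0) (F 1) (D 0) aug hs hex0 hE (es 0 y) hc
      have h1 := LinearMap.congr_fun h0 (mk 0 (Finsupp.single y 1))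
      rw [hes, Finsupp.single_eq_same, map_one] at h1
      exact one_ne_zero h1
    | succ q' =>
      obtain ⟨ψ, hψ⟩ := cocycle_succ R q' N F D aug hs hex0 hex hE (es (q' + 1) y) hc
      exact hnot _ _ _ hψ
  -- conclusion
  have hβ : ∀ t, t ≤ p' + 1 → res.β (p' + 1 - t) ≠ 0 := by
    intro t
    induction t with
    | zero => intro _; exact hp
    | succ t ih =>
      intro ht
      have h := ih (by omega)
      rw [show p' + 1 - t = (p' + 1 - (t + 1)) + 1 by omega] at h
      exact res.beta_ne_zero _ h
  have hq0 : res.β q ≠ 0 := by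
    have := hβ (p' + 1 - q) (by omega)
    rwa [show p' + 1 - (p' + 1 - q) = q by omega] at this
  obtain ⟨j0, hj0⟩ := Function.ne_iff.mp hq0
  obtain ⟨jm, hjm, hmaxj⟩ := Finset.exists_max_image (res.finβ q).toFinset id
    ⟨j0, by simpa using hj0⟩
  have hjm' : res.β q jm ≠ 0 := by simpa using hjm
  obtain ⟨⟨j, a⟩, hja⟩ := hrow ⟨jm, ⟨0, Nat.pos_of_ne_zero hjm'⟩⟩
  refine ⟨j, ?_, ?_⟩
  · intro h
    rw [h] at a
    exact a.elim0
  · intro j' hj'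
    have h1 := hmaxj j' (by simpa using hj')
    have h2 := res.minimal q j a jm _ hja
    simp only [id] at h1
    omega
end

section
/- Let S be a standard graded Koszul algebra over a field k and R = S/I a graded quotient, where I contains no linear forms. Then for every i ≥ 0, t_i^S(R) ≤ max{ t_{i−j}^S(R) + t_{j+1}^R(k) : j = 1, …, i }, where t_i^A(N) = sup{ j : Tor_i^A(k,N)_j ≠ 0 }. -/
namespace KoszulAux

def cyc (C : ℕ → Type) [∀ a, AddCommGroup (C a)] (d : ∀ a, C (a + 1) →+ C a) :
    ∀ a, C a → Prop
  | 0, _ => True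
  | a + 1, x => d a x = 0

section zig
variable (C : ℕ → ℕ → Type) [∀ a p, AddCommGroup (C a p)]
  (d : ∀ a p, C (a + 1) p →+ C a p) (e : ∀ a p, C a (p + 1) →+ C a p)
  (comm : ∀ a p x, d a p (e (a + 1) p x) = e a p (d a (p + 1) x))
  (dd : ∀ a p x, d a p (d (a + 1) p x) = 0)
  (ee : ∀ a p x, e a p (e a (p + 1) x) = 0)
  (σ : ∀ a p, C a p →+ C a p)
  (σd : ∀ a p x, σ a p (d a p x) = d a p (σ (a + 1) p x))
  (σe : ∀ a p x, σ a p (e a p x) = e a p (σ a (p + 1) x))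

include dd in
lemma cyc_d (a p : ℕ) (x : C (a + 1) p) : cyc (fun a => C a p) (fun a => d a p) a (d a p x) := by
  cases a with
  | zero => trivial
  | succ a => exact dd a p x

include comm dd ee σd σe in
lemma claimM (σσ : ∀ a p x, σ a p (σ a p x) = σ a p x) : ∀ (a p : ℕ)
    (_ : ∀ a' p', a' < a → a' + p' + 1 = a + p → ∀ x : C a' (p' + 1), e a' p' x = 0 →
      ∃ y, e a' (p' + 1) y = σ _ _ x)
    (_ : ∀ a' p', a' < a → a' + p' = a + p + 1 → ∀ x : C a' p', cyc (fun a => C a p') (fun a => d a p') a' x →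
      ∃ w, d a' p' w = σ _ _ x)
    (z : C a (p + 1)), cyc (fun a => C a p) (fun a => d a p) a (e a p z) →
    ∃ z', cyc (fun a => C a (p + 1)) (fun a => d a (p + 1)) a z' ∧ e a p z' = σ _ _ (e a p z) := by
  intro a
  induction a with
  | zero =>
    intro p _ _ z _
    exact ⟨σ _ _ z, trivial, (σe _ _ _).symm⟩
  | succ a ih =>
    intro p HE HD z hz
    have hz' : d a p (e (a + 1) p z) = 0 := hz
    rw [comm] at hz'
    obtain ⟨u, hu⟩ := HE a p (by omega) (by omega) _ hz'
    obtain ⟨u', hu', hu''⟩ := ih (p + 1) (fun a' p' h1 h2 => HE a' p' (by omega) (by omega))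
      (fun a' p' h1 h2 => HD a' p' (by omega) (by omega)) u
      (by rw [hu, σd]; exact cyc_d C d dd a _ _)
    obtain ⟨w, hw⟩ := HD a (p + 2) (by omega) (by omega) u' hu'
    refine ⟨σ _ _ z - e _ _ w, ?_, ?_⟩
    · change d a (p + 1) _ = 0
      rw [map_sub, comm, hw, ← σe, hu'', hu, σσ, σσ, σd, sub_self]
    · rw [map_sub, ee, sub_zero, σe]

include comm dd ee σd σe in
lemma claimA (HE : ∀ a p (x : C a (p + 1)), e a p x = 0 → ∃ y, e a (p + 1) y = x)
    (HD : ∀ a p (x : C (a + 1) (p + 1)), d a (p + 1) x = 0 → ∃ w, d (a + 1) (p + 1) w = x) :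
    ∀ (a p : ℕ) (_ : ∀ u : C 0 (a + p + 1), ∃ w, d 0 _ w = σ _ _ u) (z : C a (p + 1)),
      cyc (fun a => C a p) (fun a => d a p) a (e a p z) → ∃ w, e a p (d a (p + 1) w) = σ _ _ (e a p z) := by
  intro a
  induction a with
  | zero =>
    intro p H0 z _
    rw [show 0 + p + 1 = p + 1 by omega] at H0
    obtain ⟨w, hw⟩ := H0 z
    exact ⟨w, by rw [hw, σe]⟩
  | succ a ih =>
    intro p H0 z hz
    have hz' : d a p (e (a + 1) p z) = 0 := hz
    rw [comm] at hz'
    obtain ⟨u, hu⟩ := HE a p _ hz'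
    rw [show a + 1 + p + 1 = a + (p + 1) + 1 by omega] at H0
    obtain ⟨w, hw⟩ := ih (p + 1) H0 u (by rw [hu]; exact cyc_d C d dd a _ _)
    obtain ⟨w', hw'⟩ := HD a p (σ _ _ z - e _ _ w) (by
      rw [map_sub, comm, hw, hu, σd, sub_self])
    exact ⟨w', by rw [hw', map_sub, ee, sub_zero, σe]⟩
end zig

section mat
variable {A : Type} [CommRing A] {ι κ τ : Type}

noncomputable def matD (d : (ι →₀ A) →ₗ[A] (κ →₀ A)) (N : Type) [AddCommGroup N] [Module A N] :
    (ι →₀ N) →ₗ[A] (κ →₀ N) :=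
  by classical exact (TensorProduct.finsuppScalarLeft A N κ).toLinearMap ∘ₗ (d.rTensor N) ∘ₗ
    (TensorProduct.finsuppScalarLeft A N ι).symm.toLinearMap

variable {N N' : Type} [AddCommGroup N] [Module A N] [AddCommGroup N'] [Module A N']

lemma matD_single (d : (ι →₀ A) →ₗ[A] (κ →₀ A)) (x : ι) (n : N) (y : κ) :
    matD d N (Finsupp.single x n) y = d (Finsupp.single x 1) y • n := by
  classical
  simp [matD]

lemma matD_self (d : (ι →₀ A) →ₗ[A] (κ →₀ A)) : matD d A = d := by
  classical
  refine Finsupp.lhom_ext' fun x => LinearMap.ext_ring ?_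
  ext y
  simp [matD_single]

lemma matD_comp_zero (d : (ι →₀ A) →ₗ[A] (κ →₀ A)) (d' : (κ →₀ A) →ₗ[A] (τ →₀ A))
    (h : d' ∘ₗ d = 0) (x : ι →₀ N) : matD d' N (matD d N x) = 0 := by
  classical
  simp only [matD, LinearMap.comp_apply, LinearEquiv.coe_coe, LinearEquiv.symm_apply_apply]
  rw [← LinearMap.comp_apply (d'.rTensor N), ← LinearMap.rTensor_comp, h]
  simp

lemma matD_exact [Module.Flat A N] (d : (ι →₀ A) →ₗ[A] (κ →₀ A)) (d' : (κ →₀ A) →ₗ[A] (τ →₀ A))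
    (h : LinearMap.range d = LinearMap.ker d') (x : κ →₀ N) (hx : matD d' N x = 0) :
    ∃ y, matD d N y = x := by
  classical
  have hex := Module.Flat.rTensor_exact N (LinearMap.exact_iff.2 h.symm)
  simp only [matD, LinearMap.comp_apply, LinearEquiv.coe_coe, LinearEquiv.map_eq_zero_iff] at hx
  obtain ⟨w, hw⟩ := (hex _).1 hx
  refine ⟨TensorProduct.finsuppScalarLeft A N ι w, ?_⟩
  simp [matD, hw]

lemma matD_nat (d : (ι →₀ A) →ₗ[A] (κ →₀ A)) (φ : N →ₗ[A] N') (x : ι →₀ N) :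
    matD d N' (Finsupp.mapRange.linearMap φ x) = Finsupp.mapRange.linearMap φ (matD d N x) := by
  induction x using Finsupp.induction_linear with
  | zero => simp
  | add f g hf hg => simp only [map_add, hf, hg]
  | single a b => ext y; simp [matD_single]

/-- graded projection -/
noncomputable def gp (deg : ι → ℤ) (π : ℤ → N →+ N) (c : ℤ) : (ι →₀ N) →+ (ι →₀ N) where
  toFun v := Finsupp.onFinset v.support (fun x => π (c - deg x) (v x)) (by
    intro x hx
    rw [Finsupp.mem_support_iff]
    rintro h
    exact hx (by rw [h, map_zero]))
  map_zero' := by ext; simp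
  map_add' := by intro f g; ext; simp

@[simp] lemma gp_apply (deg : ι → ℤ) (π : ℤ → N →+ N) (c : ℤ) (v : ι →₀ N) (x : ι) :
    gp deg π c v x = π (c - deg x) (v x) := rfl

lemma gp_single (deg : ι → ℤ) (π : ℤ → N →+ N) (c : ℤ) (x : ι) (n : N) :
    gp deg π c (Finsupp.single x n) = Finsupp.single x (π (c - deg x) n) := by
  classical
  ext y
  by_cases h : x = y
  · subst h; simp
  · simp [h]

lemma gp_idem (deg : ι → ℤ) (π : ℤ → N →+ N) (hπ : ∀ c n, π c (π c n) = π c n) (c : ℤ)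
    (v : ι →₀ N) : gp deg π c (gp deg π c v) = gp deg π c v := by
  ext; simp [hπ]

lemma gp_nat (deg : ι → ℤ) (π : ℤ → N →+ N) (π' : ℤ → N' →+ N') (φ : N →ₗ[A] N')
    (h : ∀ c n, φ (π c n) = π' c (φ n)) (c : ℤ) (v : ι →₀ N) :
    Finsupp.mapRange.linearMap φ (gp deg π c v) = gp deg π' c (Finsupp.mapRange.linearMap φ v) := by
  ext; simp [h]

lemma gp_matD (degι : ι → ℤ) (degκ : κ → ℤ) (π : ℤ → N →+ N) (hom : ℕ → Set A)
    (hπ : ∀ m, ∀ s ∈ hom m, ∀ c n, π c (s • n) = s • π (c - m) n)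
    (d : (ι →₀ A) →ₗ[A] (κ →₀ A))
    (hd : ∀ x y, d (Finsupp.single x 1) y = 0 ∨
      ∃ m : ℕ, (m : ℤ) = degι x - degκ y ∧ d (Finsupp.single x 1) y ∈ hom m)
    (c : ℤ) (v : ι →₀ N) :
    matD d N (gp degι π c v) = gp degκ π c (matD d N v) := by
  induction v using Finsupp.induction_linear with
  | zero => simp
  | add f g hf hg => simp only [map_add, hf, hg]
  | single a b =>
    ext y
    rw [gp_single, matD_single, gp_apply, matD_single]
    rcases hd a y with h | ⟨m, hm, h⟩
    · simp [h]
    · rw [hπ m _ h, hm]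
      congr 2
      ring_nf

lemma mapRange_exact (φ : N →ₗ[A] N') {N'' : Type} [AddCommGroup N''] [Module A N'']
    (ψ : N' →ₗ[A] N'') (h : ∀ x, ψ x = 0 → ∃ y, φ y = x) (v : ι →₀ N')
    (hv : Finsupp.mapRange.linearMap ψ v = 0) : ∃ w : ι →₀ N, Finsupp.mapRange.linearMap φ w = v := by
  have h' : ∀ x, ∃ y, φ y = x ∨ ψ x ≠ 0 := fun x => by
    by_cases hx : ψ x = 0
    · obtain ⟨y, hy⟩ := h x hx; exact ⟨y, Or.inl hy⟩
    · exact ⟨0, Or.inr hx⟩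
  choose f hf using h'
  classical
  refine ⟨Finsupp.onFinset v.support (fun x => if v x = 0 then 0 else f (v x)) (by
    intro x hx; rw [Finsupp.mem_support_iff]; intro h; simp [h] at hx), ?_⟩
  ext x
  have hx : ψ (v x) = 0 := by simpa using DFunLike.congr_fun hv x
  by_cases h0 : v x = 0
  · simp [h0]
  · simpa [h0, hx] using hf (v x)

end mat

section cplx
variable {S : Type} [CommRing S] {B : ℕ → Type} (D : ∀ a, (B (a + 1) →₀ S) →ₗ[S] (B a →₀ S))
  (hD : ∀ a, LinearMap.range (D (a + 1)) = LinearMap.ker (D a))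

/-- the differential of `K ⊗ N` -/
noncomputable def dK (N : Type) [AddCommGroup N] [Module S N] (a : ℕ) :
    (B (a + 1) →₀ N) →+ (B a →₀ N) := (matD (D a) N).toAddMonoidHom

variable {N : ℕ → Type} [∀ p, AddCommGroup (N p)] [∀ p, Module S (N p)]
  (e : ∀ p, N (p + 1) →ₗ[S] N p)

noncomputable def mE (a p : ℕ) : (B a →₀ N (p + 1)) →+ (B a →₀ N p) :=
  (Finsupp.mapRange.linearMap (e p)).toAddMonoidHom

include hD in
lemma dK_dK (N : Type) [AddCommGroup N] [Module S N] (a : ℕ) (x : B (a + 2) →₀ N) :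
    dK D N a (dK D N (a + 1) x) = 0 :=
  matD_comp_zero (D (a + 1)) (D a)
    (LinearMap.ext fun v => LinearMap.mem_ker.1 ((hD a).le ⟨v, rfl⟩)) x

lemma dK_mE (a p : ℕ) (x : B (a + 1) →₀ N (p + 1)) :
    dK D (N p) a (mE e (a + 1) p x) = mE e a p (dK D (N (p + 1)) a x) := matD_nat _ _ _

lemma mE_mE (ee : ∀ p x, e p (e (p + 1) x) = 0) (a p : ℕ) (x : B a →₀ N (p + 2)) :
    mE e a p (mE e a (p + 1) x) = 0 := by
  ext y; simp [mE, ee]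

lemma mE_exact (ex : ∀ p x, e p x = 0 → ∃ y, e (p + 1) y = x) (a p : ℕ) (x : B a →₀ N (p + 1))
    (hx : mE e a p x = 0) : ∃ y, mE e a (p + 1) y = x :=
  mapRange_exact (e (p + 1)) (e p) (ex p) x hx

lemma mE_surj (sj : ∀ x, ∃ y, e 0 y = x) (a : ℕ) (x : B a →₀ N 0) : ∃ y, mE e a 0 y = x :=
  mapRange_exact (e 0) (0 : N 0 →ₗ[S] N 0) (fun x _ => sj x) x (by ext; simp)

include hD in
lemma dK_exact (N : Type) [AddCommGroup N] [Module S N] [Module.Flat S N] (a : ℕ)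
    (x : B (a + 1) →₀ N) (hx : dK D N a x = 0) : ∃ y, dK D N (a + 1) y = x :=
  matD_exact _ _ (hD a) x hx

include hD in
lemma lemAC (ee : ∀ p x, e p (e (p + 1) x) = 0)
    (ex : ∀ p x, e p x = 0 → ∃ y, e (p + 1) y = x) (sj : ∀ x, ∃ y, e 0 y = x)
    (hfl : ∀ p, Module.Flat S (N (p + 1)))
    (σ : ∀ a p, (B a →₀ N p) →+ (B a →₀ N p))
    (σd : ∀ a p x, σ a p (dK D (N p) a x) = dK D (N p) a (σ (a + 1) p x))
    (σe : ∀ a p x, σ a p (mE e a p x) = mE e a p (σ a (p + 1) x))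
    (a : ℕ) (H0 : ∀ u : B 0 →₀ N (a + 1), ∃ w, dK D _ 0 w = σ _ _ u)
    (x : B a →₀ N 0) (hx : cyc (fun a => B a →₀ N 0) (dK D (N 0)) a x) :
    ∃ w, dK D _ a w = σ _ _ x := by
  obtain ⟨z, rfl⟩ := mE_surj e sj a x
  obtain ⟨w, hw⟩ := claimA (fun a p => B a →₀ N p) (fun a p => dK D (N p) a) (mE e)
    (dK_mE D e) (fun a p => dK_dK D hD (N p) a) (mE_mE e ee) σ σd σe (mE_exact e ex)
    (fun a p x hx => dK_exact D hD (N (p + 1)) a x hx) a 0 H0 z hx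
  exact ⟨mE e _ _ w, by rw [dK_mE, hw]⟩

include hD in
lemma lemB (ee : ∀ p x, e p (e (p + 1) x) = 0)
    (ex : ∀ p x, e p x = 0 → ∃ y, e (p + 1) y = x) (sj : ∀ x, ∃ y, e 0 y = x)
    (hfl : ∀ p, Module.Flat S (N (p + 1)))
    (σ : ∀ a p, (B a →₀ N p) →+ (B a →₀ N p))
    (σd : ∀ a p x, σ a p (dK D (N p) a x) = dK D (N p) a (σ (a + 1) p x))
    (σe : ∀ a p x, σ a p (mE e a p x) = mE e a p (σ a (p + 1) x))
    (σσ : ∀ a p x, σ a p (σ a p x) = σ a p x)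
    (i : ℕ) (HR : ∀ x : B (i + 1) →₀ N 0, dK D _ i x = 0 → ∃ w, dK D _ (i + 1) w = σ _ _ x)
    (x : B 0 →₀ N (i + 2)) (hx : σ _ _ x = x)
    (hu : ∃ u, dK D _ 0 u = mE e _ _ x) :
    ∃ w v, x - dK D _ 0 w = mE e _ _ v := by
  obtain ⟨u, hu⟩ := hu
  obtain ⟨z', hz', hz''⟩ := claimM (fun q a => B a →₀ N q) (fun q a => mE e a q)
    (fun q a => dK D (N q) a) (fun q a x => (dK_mE D e a q x).symm)
    (fun q a => mE_mE e ee a q) (fun q a => dK_dK D hD (N q) a) (fun q a => σ a q)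
    (fun q a => σe a q) (fun q a => σd a q) (fun q a => σσ a q) (i + 1) 0
    (by
      intro a' p' h1 h2 x1 hx1
      cases a' with
      | zero =>
        obtain rfl : p' = i := by omega
        exact HR x1 hx1
      | succ q => exact dK_exact D hD _ _ _ (by rw [← σd, hx1, map_zero]))
    (by
      intro a' p' h1 h2 x hx
      cases a' with
      | zero => exact mE_surj e sj _ _
      | succ q => exact mE_exact e ex _ _ _ (by rw [← σe, show mE e p' q x = 0 from hx, map_zero]))
    u (by
      change mE e _ _ _ = 0
      rw [hu, mE_mE e ee])
  obtain ⟨w, hw⟩ := mE_exact e ex _ _ z' hz'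
  obtain ⟨v, hv⟩ := mE_exact e ex _ _ (x - dK D _ 0 w) (by
    rw [map_sub, ← dK_mE, hw, hz'', hu, σe, hx, sub_self])
  exact ⟨w, v, hv.symm⟩
end cplx
set_option linter.unusedSectionVars false

section proj
variable {k : Type} [Field k] {S : Type} [CommRing S] [Algebra k S]
    (𝒜 : ℕ → Submodule k S) [GradedAlgebra 𝒜]

noncomputable def πS (c : ℤ) : S →+ S := if 0 ≤ c then GradedRing.proj 𝒜 c.toNat else 0

lemma πS_idem (c : ℤ) (s : S) : πS 𝒜 c (πS 𝒜 c s) = πS 𝒜 c s := by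
  unfold πS
  split_ifs
  · simp [GradedRing.proj_apply]
  · simp

lemma πS_smul (m : ℕ) (s : S) (hs : s ∈ 𝒜 m) (c : ℤ) (t : S) :
    πS 𝒜 c (s • t) = s • πS 𝒜 (c - m) t := by
  unfold πS
  by_cases h0 : 0 ≤ c
  · rw [if_pos h0]
    by_cases h1 : 0 ≤ c - m
    · rw [if_pos h1]
      simp only [GradedRing.proj_apply, smul_eq_mul]
      rw [DirectSum.coe_decompose_mul_of_left_mem_of_le 𝒜 hs (by omega),
        show c.toNat - m = (c - m).toNat by omega]
    · rw [if_neg h1]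
      simp only [GradedRing.proj_apply, smul_eq_mul]
      rw [DirectSum.coe_decompose_mul_of_left_mem_of_not_le 𝒜 hs (by omega)]
      simp
  · rw [if_neg h0, if_neg (by omega)]
    simp

lemma πS_one : πS 𝒜 0 (1 : S) = 1 := by
  have := DirectSum.decompose_of_mem_same 𝒜 (SetLike.GradedOne.one_mem (A := 𝒜))
  simpa only [πS, le_refl, if_true, GradedRing.proj_apply, Int.toNat_zero] using this

lemma πS_ε (ε : S →ₐ[k] k) (hε : ∀ m, 1 ≤ m → ∀ x ∈ 𝒜 m, ε x = 0) (c : ℤ) (hc : c ≠ 0) (s : S) :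
    ε (πS 𝒜 c s) = 0 := by
  unfold πS
  split_ifs with h
  · exact hε c.toNat (by omega) _ (by simp [GradedRing.proj_apply])
  · simp

variable (I : Ideal S) (hI : Ideal.IsHomogeneous 𝒜 I)

include hI in
lemma πS_mem (c : ℤ) (s : S) (hs : s ∈ I) : πS 𝒜 c s ∈ I := by
  unfold πS
  split_ifs
  · exact hI _ hs
  · simp

noncomputable def πR (c : ℤ) : (S ⧸ I) →+ (S ⧸ I) :=
  AddMonoidHom.liftOfSurjective (Ideal.Quotient.mk I).toAddMonoidHom Ideal.Quotient.mk_surjective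
    ⟨(Ideal.Quotient.mk I).toAddMonoidHom.comp (πS 𝒜 c), fun s hs => by
      have hs' : s ∈ I := Ideal.Quotient.eq_zero_iff_mem.1 hs
      exact Ideal.Quotient.eq_zero_iff_mem.2 (πS_mem 𝒜 I hI c s hs')⟩

lemma πR_mk (c : ℤ) (s : S) :
    πR 𝒜 I hI c (Ideal.Quotient.mk I s) = Ideal.Quotient.mk I (πS 𝒜 c s) :=
  AddMonoidHom.liftOfRightInverse_comp_apply (Ideal.Quotient.mk I).toAddMonoidHom _
    (Function.rightInverse_surjInv Ideal.Quotient.mk_surjective) _ s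

lemma πR_idem (c : ℤ) (r : S ⧸ I) : πR 𝒜 I hI c (πR 𝒜 I hI c r) = πR 𝒜 I hI c r := by
  obtain ⟨s, rfl⟩ := Ideal.Quotient.mk_surjective r
  simp only [πR_mk, πS_idem]

lemma πR_smul (m : ℕ) (s : S) (hs : s ∈ 𝒜 m) (c : ℤ) (r : S ⧸ I) :
    πR 𝒜 I hI c (s • r) = s • πR 𝒜 I hI (c - m) r := by
  obtain ⟨t, rfl⟩ := Ideal.Quotient.mk_surjective r
  rw [πR_mk]
  change πR 𝒜 I hI c (Ideal.Quotient.mk I (s • t)) = Ideal.Quotient.mk I (s • _)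
  rw [πR_mk, πS_smul 𝒜 m s hs]

lemma πR_smul' (m : ℕ) (s : S ⧸ I) (hs : s ∈ (Ideal.Quotient.mk I) '' (𝒜 m : Set S)) (c : ℤ)
    (r : S ⧸ I) : πR 𝒜 I hI c (s • r) = s • πR 𝒜 I hI (c - m) r := by
  obtain ⟨s, hs, rfl⟩ := hs
  exact πR_smul 𝒜 I hI m s hs c r

lemma gp_smul {N ι : Type} [AddCommGroup N] [Module S N] (deg : ι → ℤ) (π : ℤ → N →+ N)
    (hπ : ∀ m, ∀ s ∈ 𝒜 m, ∀ c n, π c (s • n) = s • π (c - m) n) (m : ℕ) (s : S) (hs : s ∈ 𝒜 m)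
    (c : ℤ) (v : ι →₀ N) : gp deg π c (s • v) = s • gp deg π (c - m) v := by
  ext y
  simp only [gp_apply, Finsupp.smul_apply]
  rw [hπ m s hs, sub_right_comm]

end proj

section res
variable {k : Type} [Field k] {S : Type} [CommRing S] [Algebra k S]
    (𝒜 : ℕ → Submodule k S) [GradedAlgebra 𝒜]
    (ε : S →ₐ[k] k) (hε : ∀ m, 1 ≤ m → ∀ x ∈ 𝒜 m, ε x = 0)

include hε in
lemma entry_ε {M : Type} [AddCommGroup M] [Module S M]
    (F : MinGradedFreeRes S (fun m => (𝒜 m : Set S)) M) (i : ℕ) (x y) :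
    ε (F.d i (Finsupp.single x 1) y) = 0 := by
  by_cases h : F.d i (Finsupp.single x 1) y = 0
  · rw [h, map_zero]
  · rcases F.graded i x.1 x.2 y.1 y.2 with h' | ⟨m, hm, h'⟩
    · exact absurd h' h
    · have := F.minimal i x.1 x.2 y.1 y.2 h
      exact hε m (by omega) _ h'

lemma ent {ι κ τ : Type} (d : (ι →₀ S) →ₗ[S] (κ →₀ S))
    (hd : ∀ x y, ε (d (Finsupp.single x 1) y) = 0) (w : ι →₀ (τ →₀ S)) (y : κ) (f : τ) :
    ε (matD d (τ →₀ S) w y f) = 0 := by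
  induction w using Finsupp.induction_linear with
  | zero => simp
  | add f g hf hg => simp [hf, hg]
  | single a b => simp [matD_single, hd]

lemma ent' {ι κ : Type} (d : (ι →₀ S) →ₗ[S] (κ →₀ S))
    (hd : ∀ x y, ε (d (Finsupp.single x 1) y) = 0) (w : ι →₀ S) (y : κ) :
    ε (d w y) = 0 := by
  rw [← matD_self d]
  induction w using Finsupp.induction_linear with
  | zero => simp
  | add f g hf hg => simp [hf, hg]
  | single a b => simp [matD_single, hd]

lemma K0 {ι κ τ : Type} (d : (ι →₀ S) →ₗ[S] (κ →₀ S))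
    (hd : ∀ s, ε s = 0 → ∀ v, s • v ∈ LinearMap.range d) (v : κ →₀ (τ →₀ S))
    (hv : ∀ y f, ε (v y f) = 0) : ∃ u, matD d (τ →₀ S) u = v := by
  change v ∈ LinearMap.range (matD d (τ →₀ S))
  rw [← Finsupp.sum_single v]
  refine Submodule.sum_mem _ fun y _ => ?_
  rw [← Finsupp.sum_single (v y), Finsupp.sum, Finsupp.single_finsetSum]
  refine Submodule.sum_mem _ fun f _ => ?_
  obtain ⟨t, ht⟩ := hd _ (hv y f) (Finsupp.single y 1)
  refine ⟨Finsupp.mapRange.linearMap (Finsupp.lsingle f : S →ₗ[S] (τ →₀ S)) t, ?_⟩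
  rw [matD_nat, matD_self, ht]
  ext1 y'
  classical
  by_cases h : y = y'
  · subst h; simp
  · simp [h]

variable (I : Ideal S) (hI : Ideal.IsHomogeneous 𝒜 I)

/-- augmented resolution -/
def NA (F : MinGradedFreeRes S (fun m => (𝒜 m : Set S)) (S ⧸ I)) : ℕ → Type
  | 0 => S ⧸ I
  | p + 1 => FreeMod S (F.β p)

noncomputable instance (F : MinGradedFreeRes S (fun m => (𝒜 m : Set S)) (S ⧸ I)) :
    ∀ p, AddCommGroup (NA 𝒜 I F p)
  | 0 => inferInstanceAs (AddCommGroup (S ⧸ I))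
  | p + 1 => inferInstanceAs (AddCommGroup (FreeMod S (F.β p)))

noncomputable instance (F : MinGradedFreeRes S (fun m => (𝒜 m : Set S)) (S ⧸ I)) :
    ∀ p, Module S (NA 𝒜 I F p)
  | 0 => inferInstanceAs (Module S (S ⧸ I))
  | p + 1 => inferInstanceAs (Module S (FreeMod S (F.β p)))

variable (F : MinGradedFreeRes S (fun m => (𝒜 m : Set S)) (S ⧸ I))

lemma NA_flat (p : ℕ) : Module.Flat S (NA 𝒜 I F (p + 1)) :=
  inferInstanceAs (Module.Flat S (FreeMod S (F.β p)))

/-- standard augmentation -/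
noncomputable def aug' (f0 : (j : ℤ) × Fin (F.β 0 j)) : FreeMod S (F.β 0) →ₗ[S] S ⧸ I :=
  (Submodule.mkQ I) ∘ₗ (Finsupp.lapply f0)

lemma aug'_apply (f0 : (j : ℤ) × Fin (F.β 0 j)) (v) :
    aug' 𝒜 I F f0 v = Ideal.Quotient.mk I (v f0) := rfl

noncomputable def eA (f0 : (j : ℤ) × Fin (F.β 0 j)) :
    ∀ p, NA 𝒜 I F (p + 1) →ₗ[S] NA 𝒜 I F p
  | 0 => aug' 𝒜 I F f0
  | p + 1 => F.d p

noncomputable def πA : ∀ p, ℤ → NA 𝒜 I F p →+ NA 𝒜 I F p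
  | 0 => πR 𝒜 I hI
  | _ + 1 => gp Sigma.fst (πS 𝒜)

lemma πA_idem (p : ℕ) (c : ℤ) (x) : πA 𝒜 I hI F p c (πA 𝒜 I hI F p c x) = πA 𝒜 I hI F p c x := by
  cases p with
  | zero => exact πR_idem 𝒜 I hI c x
  | succ p => exact gp_idem _ _ (πS_idem 𝒜) c x

lemma πA_smul (p m : ℕ) (s : S) (hs : s ∈ 𝒜 m) (c : ℤ) (x : NA 𝒜 I F p) :
    πA 𝒜 I hI F p c (s • x) = s • πA 𝒜 I hI F p (c - m) x := by
  cases p with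
  | zero => exact πR_smul 𝒜 I hI m s hs c x
  | succ p => exact gp_smul 𝒜 _ _ (πS_smul 𝒜) m s hs c x

lemma ker_aug' (f0 : (j : ℤ) × Fin (F.β 0 j)) (hf0 : ∀ f, f = f0) :
    LinearMap.ker (aug' 𝒜 I F f0) = LinearMap.range (F.d 0) := by
  have hv : ∀ v : FreeMod S (F.β 0), F.aug v = v f0 • F.aug (Finsupp.single f0 1) := by
    intro v
    rw [← map_smul]
    congr 1
    ext f
    rw [hf0 f]
    simp
  obtain ⟨w, hw⟩ := F.augSurj 1
  rw [F.exact₀]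
  ext v
  rw [LinearMap.mem_ker, LinearMap.mem_ker, hv v, aug'_apply]
  rw [hv w] at hw
  set u := F.aug (Finsupp.single f0 1)
  change _ ↔ Ideal.Quotient.mk I (v f0) * u = 0
  change Ideal.Quotient.mk I (w f0) * u = 1 at hw
  constructor
  · intro h; rw [h, zero_mul]
  · intro h
    calc _ = Ideal.Quotient.mk I (v f0) * (Ideal.Quotient.mk I (w f0) * u) := by rw [hw, mul_one]
      _ = Ideal.Quotient.mk I (w f0) * (Ideal.Quotient.mk I (v f0) * u) := by ring
      _ = 0 := by rw [h, mul_zero]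

lemma eA_exact (f0 : (j : ℤ) × Fin (F.β 0 j)) (hf0 : ∀ f, f = f0) (p : ℕ) (x)
    (hx : eA 𝒜 I F f0 p x = 0) : ∃ y, eA 𝒜 I F f0 (p + 1) y = x := by
  cases p with
  | zero => exact (ker_aug' 𝒜 I F f0 hf0).le hx
  | succ p => exact (F.exact p).ge hx

lemma eA_eA (f0 : (j : ℤ) × Fin (F.β 0 j)) (hf0 : ∀ f, f = f0) (p : ℕ) (x) :
    eA 𝒜 I F f0 p (eA 𝒜 I F f0 (p + 1) x) = 0 := by
  cases p with
  | zero => exact (ker_aug' 𝒜 I F f0 hf0).ge ⟨x, rfl⟩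
  | succ p => exact (F.exact p).le ⟨x, rfl⟩

lemma eA_surj (f0 : (j : ℤ) × Fin (F.β 0 j)) (x) : ∃ y, eA 𝒜 I F f0 0 y = x := by
  obtain ⟨s, rfl⟩ := Ideal.Quotient.mk_surjective x
  exact ⟨Finsupp.single f0 s, by
    change aug' 𝒜 I F f0 _ = _
    rw [aug'_apply]; simp⟩

lemma eA_π (f0 : (j : ℤ) × Fin (F.β 0 j)) (h0 : f0.1 = 0) (p : ℕ) (c : ℤ) (x) :
    eA 𝒜 I F f0 p (πA 𝒜 I hI F (p + 1) c x) = πA 𝒜 I hI F p c (eA 𝒜 I F f0 p x) := by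
  cases p with
  | zero =>
    have key : ∀ x : FreeMod S (F.β 0), aug' 𝒜 I F f0 (gp Sigma.fst (πS 𝒜) c x) =
        πR 𝒜 I hI c (aug' 𝒜 I F f0 x) := by
      intro x
      rw [aug'_apply, aug'_apply, πR_mk, gp_apply, h0, sub_zero]
    exact key x
  | succ p =>
    have := gp_matD (N := S) Sigma.fst Sigma.fst (πS 𝒜) (fun m => (𝒜 m : Set S)) (πS_smul 𝒜) (F.d p)
      (fun x y => F.graded p x.1 x.2 y.1 y.2) c x
    rw [matD_self] at this
    exact this

end res

/-- index set of the basis -/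
abbrev KB {A : Type} [CommRing A] {hom : ℕ → Set A} {M : Type} [AddCommGroup M] [Module A M]
    (K : MinGradedFreeRes A hom M) (a : ℕ) : Type := (j : ℤ) × Fin (K.β a j)

section main
variable {k : Type} [Field k] {S : Type} [CommRing S] [Algebra k S]
    (𝒜 : ℕ → Submodule k S) [GradedAlgebra 𝒜]
    (ε : S →ₐ[k] k) (hε : ∀ m, 1 ≤ m → ∀ x ∈ 𝒜 m, ε x = 0)
    (I : Ideal S) (hI : Ideal.IsHomogeneous 𝒜 I)
    {M : Type} [AddCommGroup M] [Module S M]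
    (K : MinGradedFreeRes S (fun m => (𝒜 m : Set S)) M)
    (hK : ∀ (i : ℕ) (j : ℤ), K.β i j ≠ 0 → j = (i : ℤ))
    (hKm : ∀ s, ε s = 0 → ∀ v, s • v ∈ LinearMap.range (K.d 0))
    (F : MinGradedFreeRes S (fun m => (𝒜 m : Set S)) (S ⧸ I))
    (f0 : (j : ℤ) × Fin (F.β 0 j)) (hf0 : ∀ f, f = f0) (h0 : f0.1 = 0)

/-- vanishing of `H_a(K ⊗ R)_c` -/
def HR (a : ℕ) (c : ℤ) : Prop :=
  ∀ x, cyc (fun a => KB K a →₀ (S ⧸ I)) (dK (B := KB K) K.d (S ⧸ I)) a x →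
    ∃ w, dK (B := KB K) K.d (S ⧸ I) a w = gp Sigma.fst (πR 𝒜 I hI) c x

lemma β_ne {A : Type} [CommRing A] {hom : ℕ → Set A} {M : Type} [AddCommGroup M] [Module A M]
    (K : MinGradedFreeRes A hom M) {a : ℕ} (y : (j : ℤ) × Fin (K.β a j)) : K.β a y.1 ≠ 0 := by
  intro h
  exact Fin.elim0 (h ▸ y.2)

lemma dK_gp {N : Type} [AddCommGroup N] [Module S N] (π : ℤ → N →+ N)
    (hπ : ∀ m, ∀ s ∈ 𝒜 m, ∀ c n, π c (s • n) = s • π (c - m) n) (c : ℤ) (a : ℕ) (x) :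
    gp Sigma.fst π c (dK (B := KB K) K.d N a x) = dK (B := KB K) K.d N a (gp Sigma.fst π c x) :=
  (gp_matD Sigma.fst Sigma.fst π (fun m => (𝒜 m : Set S)) hπ (K.d a)
    (fun x y => K.graded a x.1 x.2 y.1 y.2) c x).symm

include hε hK hKm hf0 h0 in
lemma HR_of_β (a : ℕ) (c : ℤ) (hβ : F.β a c = 0) : HR 𝒜 I hI K a c := by
  intro x hx
  refine lemAC (B := KB K) K.d K.exact (eA 𝒜 I F f0) (eA_eA 𝒜 I F f0 hf0) (eA_exact 𝒜 I F f0 hf0)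
    (eA_surj 𝒜 I F f0) (NA_flat 𝒜 I F) (fun a p => gp Sigma.fst (πA 𝒜 I hI F p) c)
    (fun a p x => dK_gp 𝒜 K _ (πA_smul 𝒜 I hI F p) c a x)
    (fun a p x => (gp_nat Sigma.fst _ _ (eA 𝒜 I F f0 p) (eA_π 𝒜 I hI F f0 h0 p) c x).symm)
    a ?_ x hx
  intro u
  refine K0 ε (K.d 0) hKm (τ := (j : ℤ) × Fin (F.β a j)) _ ?_
  intro y f
  refine πS_ε 𝒜 ε hε _ ?_ _
  have h1 := hK 0 y.1 (β_ne K y)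
  have h2 : f.1 ≠ c := fun h => β_ne F f (h ▸ hβ)
  intro h3
  apply h2
  simp only [h1] at h3
  simp at h3
  omega

include hKm hf0 h0 in
lemma smul_bd (s : S) (hs : ε s = 0) (a : ℕ) (x)
    (hx : cyc (fun a => KB K a →₀ (S ⧸ I)) (dK (B := KB K) K.d (S ⧸ I)) a x) :
    ∃ w, dK (B := KB K) K.d (S ⧸ I) a w = s • x := by
  refine lemAC (B := KB K) K.d K.exact (eA 𝒜 I F f0) (eA_eA 𝒜 I F f0 hf0) (eA_exact 𝒜 I F f0 hf0)
    (eA_surj 𝒜 I F f0) (NA_flat 𝒜 I F) (fun a p => DistribSMul.toAddMonoidHom _ s)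
    (fun a p x => ((matD (K.d a) _).map_smul s x).symm)
    (fun a p x => ((Finsupp.mapRange.linearMap (eA 𝒜 I F f0 p)).map_smul s x).symm)
    a ?_ x hx
  intro u
  refine K0 ε (K.d 0) hKm (τ := (j : ℤ) × Fin (F.β a j)) _ ?_
  intro y f
  have key : ∀ t : FreeMod S (F.β a), ε ((s • t) f) = 0 := by
    intro t; simp [hs]
  exact key (u y)

include hε hK hKm hf0 h0 in
lemma not_HR (y0 : (j : ℤ) × Fin (K.β 0 j)) (i : ℕ) (f : (j : ℤ) × Fin (F.β (i + 1) j)) :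
    ¬ HR 𝒜 I hI K (i + 1) f.1 := by
  intro H
  have hy0 : y0.1 = 0 := hK 0 y0.1 (β_ne K y0)
  have hx0 : gp Sigma.fst (gp Sigma.fst (πS 𝒜)) f.1
      (Finsupp.single y0 (Finsupp.single f (1 : S) : FreeMod S (F.β (i + 1)))) =
      Finsupp.single y0 (Finsupp.single f (1 : S) : FreeMod S (F.β (i + 1))) := by
    rw [gp_single, gp_single, hy0, sub_zero, sub_self, πS_one]
  obtain ⟨w, v, hwv⟩ := lemB (B := KB K) K.d K.exact (eA 𝒜 I F f0) (eA_eA 𝒜 I F f0 hf0)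
    (eA_exact 𝒜 I F f0 hf0)
    (eA_surj 𝒜 I F f0) (NA_flat 𝒜 I F) (fun a p => gp Sigma.fst (πA 𝒜 I hI F p) f.1)
    (fun a p x => dK_gp 𝒜 K _ (πA_smul 𝒜 I hI F p) f.1 a x)
    (fun a p x => (gp_nat Sigma.fst _ _ (eA 𝒜 I F f0 p) (eA_π 𝒜 I hI F f0 h0 p) f.1 x).symm)
    (fun a p => gp_idem _ _ (πA_idem 𝒜 I hI F p) f.1) i H
    (Finsupp.single y0 (Finsupp.single f (1 : S) : FreeMod S (F.β (i + 1))))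
    hx0
    (by
      refine K0 ε (K.d 0) hKm (τ := (j : ℤ) × Fin (F.β i j)) _ ?_
      intro y g
      have key : ∀ t : FreeMod S (F.β (i + 1)), ε (F.d i t g) = 0 :=
        fun t => ent' ε (F.d i) (entry_ε 𝒜 ε hε F i) t g
      exact key _)
  have e1 : ε (matD (K.d 0) (FreeMod S (F.β (i + 1))) w y0 f) = 0 :=
    ent ε _ (entry_ε 𝒜 ε hε K 0) w y0 f
  have e2 : ε (F.d (i + 1) (v y0) f) = 0 := ent' ε _ (entry_ε 𝒜 ε hε F (i + 1)) _ f
  have e3 : (Finsupp.single y0 (Finsupp.single f (1 : S) : FreeMod S (F.β (i + 1)))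
      - matD (K.d 0) (FreeMod S (F.β (i + 1))) w) y0 f = F.d (i + 1) (v y0) f :=
    congrArg (fun t : FreeMod S (F.β (i + 1)) => t f) (DFunLike.congr_fun hwv y0)
  rw [← e3] at e2
  simp only [Finsupp.sub_apply, Finsupp.single_eq_same, map_sub, map_one, e1] at e2
  simp at e2

variable {M' : Type} [AddCommGroup M'] [Module (S ⧸ I) M']
  (G : MinGradedFreeRes (S ⧸ I) (fun m => (Ideal.Quotient.mk I) '' (𝒜 m : Set S)) M')

lemma finB {A : Type} [CommRing A] {hom : ℕ → Set A} {M : Type} [AddCommGroup M] [Module A M]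
    (K : MinGradedFreeRes A hom M) (a : ℕ) : Finite ((j : ℤ) × Fin (K.β a j)) := by
  have : Finite (Function.support (K.β a)) := K.finβ a
  refine Finite.of_surjective
    (fun x : (j : Function.support (K.β a)) × Fin (K.β a j) => (⟨x.1.1, x.2⟩ : (j : ℤ) × Fin (K.β a j))) ?_
  intro y
  exact ⟨⟨⟨y.1, β_ne K y⟩, y.2⟩, rfl⟩

lemma cyc_nat {N N' : Type} [AddCommGroup N] [Module S N] [AddCommGroup N'] [Module S N']
    (φ : N →ₗ[S] N') (a : ℕ) (x)
    (hx : cyc (fun a => KB K a →₀ N) (dK (B := KB K) K.d N) a x) :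
    cyc (fun a => KB K a →₀ N') (dK (B := KB K) K.d N') a
      (Finsupp.mapRange.linearMap φ x) := by
  cases a with
  | zero => trivial
  | succ a =>
    have hx' : matD (K.d a) N x = 0 := hx
    change matD (K.d a) N' _ = 0
    rw [matD_nat, hx', map_zero]

lemma HG (a p : ℕ) (c : ℤ) (H : ∀ b, G.β p b ≠ 0 → HR 𝒜 I hI K a (c - b))
    (x) (hx : cyc (fun a => KB K a →₀ FreeMod (S ⧸ I) (G.β p))
      (dK (B := KB K) K.d (FreeMod (S ⧸ I) (G.β p))) a x) :
    ∃ w, dK (B := KB K) K.d (FreeMod (S ⧸ I) (G.β p)) a w =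
      gp Sigma.fst (gp Sigma.fst (πR 𝒜 I hI)) c x := by
  have := finB G p
  have := Fintype.ofFinite ((j : ℤ) × Fin (G.β p j))
  have h1 : ∀ g : (j : ℤ) × Fin (G.β p j), ∃ w, matD (K.d a) (S ⧸ I) w =
      gp Sigma.fst (πR 𝒜 I hI) (c - g.1)
        (Finsupp.mapRange.linearMap (Finsupp.lapply g : FreeMod (S ⧸ I) (G.β p) →ₗ[S] S ⧸ I) x) :=
    fun g => H g.1 (β_ne G g) _ (cyc_nat 𝒜 K _ a x hx)
  choose w hw using h1
  refine ⟨∑ g, Finsupp.mapRange.linearMap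
    (Finsupp.lsingle g : (S ⧸ I) →ₗ[S] FreeMod (S ⧸ I) (G.β p)) (w g), ?_⟩
  change matD (K.d a) _ _ = _
  rw [map_sum]
  simp only [matD_nat, hw]
  ext y g'
  classical
  rw [Finsupp.finsetSum_apply, Finsupp.finsetSum_apply, Finset.sum_eq_single g']
  · simp [sub_right_comm]
  · intro g _ hg
    simp [hg.symm]
  · simp


noncomputable abbrev eG (p : ℕ) : FreeMod (S ⧸ I) (G.β (p + 1)) →ₗ[S] FreeMod (S ⧸ I) (G.β p) :=
  (G.d p).restrictScalars S

lemma eG_eG (p : ℕ) (x) : eG 𝒜 I G p (eG 𝒜 I G (p + 1) x) = 0 := (G.exact p).le ⟨x, rfl⟩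

lemma eG_π (p : ℕ) (c : ℤ) (x) : eG 𝒜 I G p (gp Sigma.fst (πR 𝒜 I hI) c x) =
    gp Sigma.fst (πR 𝒜 I hI) c (eG 𝒜 I G p x) := by
  have := gp_matD (N := S ⧸ I) Sigma.fst Sigma.fst (πR 𝒜 I hI) _ (πR_smul' 𝒜 I hI) (G.d p)
    (fun x y => G.graded p x.1 x.2 y.1 y.2) c x
  rw [matD_self] at this
  exact this

include hε hK in
lemma main1 (hGm : ∀ s, ε s = 0 → ∀ v, Ideal.Quotient.mk I s • v ∈ LinearMap.range (G.d 0))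
    (g0 : (j : ℤ) × Fin (G.β 0 j)) (i : ℕ) (j : ℤ) (hij : (i : ℤ) < j)
    (x x1 : KB K i →₀ (S ⧸ I)) (hx1 : x1 = gp Sigma.fst (πR 𝒜 I hI) j x) :
    ∃ z, mE (B := KB K) (N := fun p => FreeMod (S ⧸ I) (G.β p)) (eG 𝒜 I G) i 0 z = Finsupp.mapRange.linearMap (Finsupp.lsingle g0 : (S ⧸ I) →ₗ[S] FreeMod (S ⧸ I) (G.β 0)) x1 := by
  have h1 : Finsupp.mapRange.linearMap (Finsupp.lsingle g0 : (S ⧸ I) →ₗ[S] FreeMod (S ⧸ I) (G.β 0)) x1 =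
    ∑ y ∈ x.support, Finsupp.single y ((Finsupp.lsingle g0 : (S ⧸ I) →ₗ[S] FreeMod (S ⧸ I) (G.β 0)) (x1 y)) := by
    classical
    ext1 y
    rw [Finsupp.finsetSum_apply]
    by_cases hy : y ∈ x.support
    · rw [Finset.sum_eq_single_of_mem y hy]
      · simp
      · intro b _ hb
        simp [hb]
    · rw [Finset.sum_eq_zero]
      · have : x y = 0 := by simpa using hy
        simp [hx1, this]
      · intro b hb
        have : b ≠ y := fun h => hy (h ▸ hb)
        simp [this]
  rw [h1]
  change _ ∈ LinearMap.range (Finsupp.mapRange.linearMap (eG 𝒜 I G 0))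
  refine Submodule.sum_mem _ fun y _ => ?_
  have hy : y.1 = i := hK i y.1 (β_ne K y)
  obtain ⟨s, hs⟩ := Ideal.Quotient.mk_surjective (x y)
  have h2 : x1 y = Ideal.Quotient.mk I (πS 𝒜 (j - y.1) s) := by
    rw [hx1, gp_apply, ← hs, πR_mk]
  obtain ⟨t, ht⟩ := hGm _ (πS_ε 𝒜 ε hε (j - y.1) (by omega) s) (Finsupp.single g0 1)
  refine ⟨Finsupp.single y t, ?_⟩
  rw [Finsupp.mapRange.linearMap_apply, Finsupp.mapRange_single]
  congr 1
  change G.d 0 t = _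
  rw [ht, h2]
  simp

lemma main2g {N : ℕ → Type} [∀ p, AddCommGroup (N p)] [∀ p, Module S (N p)]
    (e : ∀ p, N (p + 1) →ₗ[S] N p) (ee : ∀ p x, e p (e (p + 1) x) = 0)
    (ex : ∀ p x, e p x = 0 → ∃ y, e (p + 1) y = x) (π : ∀ p, ℤ → N p →+ N p)
    (hπ : ∀ p m, ∀ s ∈ 𝒜 m, ∀ c n, π p c (s • n) = s • π p (c - m) n)
    (eπ : ∀ p c x, e p (π (p + 1) c x) = π p c (e p x))
    (ππ : ∀ p c x, π p c (π p c x) = π p c x) (i : ℕ) (j : ℤ)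
    (HD : ∀ a' p', a' < i → a' + p' = i + 1 → ∀ x : KB K a' →₀ N p',
      cyc (fun a => KB K a →₀ N p') (dK (B := KB K) K.d (N p')) a' x →
      ∃ w, dK (B := KB K) K.d (N p') a' w = gp Sigma.fst (π p') j x)
    (z : KB K i →₀ N 1)
    (hz : cyc (fun a => KB K a →₀ N 0) (dK (B := KB K) K.d (N 0)) i (mE (B := KB K) e i 0 z)) :
    ∃ z' : KB K i →₀ N 1, cyc (fun a => KB K a →₀ N 1) (dK (B := KB K) K.d (N 1)) i z' ∧
      mE (B := KB K) e i 0 z' = gp Sigma.fst (π 0) j (mE (B := KB K) e i 0 z) := by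
  have σe : ∀ a p (x : KB K a →₀ N (p + 1)), gp Sigma.fst (π p) j (mE (B := KB K) e a p x) =
      mE (B := KB K) e a p (gp Sigma.fst (π (p + 1)) j x) :=
    fun a p x => (gp_nat Sigma.fst _ _ (e p) (eπ p) j x).symm
  exact claimM (fun a p => KB K a →₀ N p) (fun a p => dK (B := KB K) K.d (N p) a)
    (mE (B := KB K) e) (dK_mE (B := KB K) K.d e)
    (fun a p => dK_dK (B := KB K) K.d K.exact (N p) a) (mE_mE (B := KB K) e ee)
    (fun a p => gp Sigma.fst (π p) j)
    (fun a p x => dK_gp 𝒜 K (π p) (hπ p) j a x)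
    σe
    (fun a p => gp_idem _ _ (ππ p) j)
    i 0
    (by
      intro a' p' _ _ u hu
      exact mE_exact (B := KB K) e ex _ _ _ (by rw [← σe, hu, map_zero]))
    (fun a' p' h1 h2 u hu => HD a' p' h1 (by omega) u hu)
    z hz

include hε hK hKm hf0 h0 in
lemma main2 (i : ℕ) (j : ℤ)
    (H : ∀ l, 1 ≤ l → l ≤ i → ∀ b, G.β (l + 1) b ≠ 0 → F.β (i - l) (j - b) = 0)
    (z : KB K i →₀ FreeMod (S ⧸ I) (G.β 1))
    (hz : cyc (fun a => KB K a →₀ FreeMod (S ⧸ I) (G.β 0)) (dK (B := KB K) K.d _) i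
      (mE (B := KB K) (N := fun p => FreeMod (S ⧸ I) (G.β p)) (eG 𝒜 I G) i 0 z)) :
    ∃ z' : KB K i →₀ FreeMod (S ⧸ I) (G.β 1),
      cyc (fun a => KB K a →₀ FreeMod (S ⧸ I) (G.β 1)) (dK (B := KB K) K.d _) i z' ∧
      mE (B := KB K) (N := fun p => FreeMod (S ⧸ I) (G.β p)) (eG 𝒜 I G) i 0 z' =
      gp (ι := (j : ℤ) × Fin (K.β i j)) Sigma.fst
        (gp (ι := (j : ℤ) × Fin (G.β 0 j)) Sigma.fst (πR 𝒜 I hI)) j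
        (mE (B := KB K) (N := fun p => FreeMod (S ⧸ I) (G.β p)) (eG 𝒜 I G) i 0 z) := by
  refine main2g 𝒜 K (N := fun p => FreeMod (S ⧸ I) (G.β p)) (eG 𝒜 I G) (eG_eG 𝒜 I G)
    (fun p x hx => (G.exact p).ge hx) (fun p => gp Sigma.fst (πR 𝒜 I hI))
    (fun p => gp_smul 𝒜 Sigma.fst _ (πR_smul 𝒜 I hI)) (eG_π 𝒜 I hI G)
    (fun p => gp_idem _ _ (πR_idem 𝒜 I hI)) i j ?_ z hz
  intro a' p' h1 h2 u hu
  refine HG 𝒜 I hI K G a' p' j ?_ u hu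
  intro b hb
  refine HR_of_β 𝒜 ε hε I hI K hK hKm F f0 hf0 h0 _ _ ?_
  have := H (i - a') (by omega) (by omega) b (by
    rwa [show i - a' + 1 = p' by omega])
  rwa [show i - (i - a') = a' by omega] at this

include hε hKm hf0 h0 in
lemma main3 (g0 : (j : ℤ) × Fin (G.β 0 j)) (hg0 : g0.1 = 0) (i : ℕ) 
    (x1 : KB K i →₀ (S ⧸ I)) (z' : KB K i →₀ FreeMod (S ⧸ I) (G.β 1))
    (hz' : cyc (fun a => KB K a →₀ FreeMod (S ⧸ I) (G.β 1)) (dK (B := KB K) K.d _) i z')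
    (hx1e : ∀ y, x1 y = G.d 0 (z' y) g0) : ∃ w, dK (B := KB K) K.d (S ⧸ I) i w = x1 := by
  have := finB G 1
  have := Fintype.ofFinite ((j : ℤ) × Fin (G.β 1 j))
  have hs : ∀ g : (j : ℤ) × Fin (G.β 1 j), ∃ s, ε s = 0 ∧
      G.d 0 (Finsupp.single g 1) g0 = Ideal.Quotient.mk I s := by
    intro g
    by_cases h : G.d 0 (Finsupp.single g 1) g0 = 0
    · exact ⟨0, map_zero _, by rw [h, map_zero]⟩
    · rcases G.graded 0 g.1 g.2 g0.1 g0.2 with h' | ⟨m, hm, s, hs, h'⟩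
      · exact absurd h' h
      · have := G.minimal 0 g.1 g.2 g0.1 g0.2 h
        exact ⟨s, hε m (by omega) _ hs, h'.symm⟩
  choose s hs hs' using hs
  have hw := fun g => smul_bd 𝒜 ε I K hKm F f0 hf0 h0 (s g) (hs g) i _
    (cyc_nat 𝒜 K (Finsupp.lapply g : FreeMod (S ⧸ I) (G.β 1) →ₗ[S] S ⧸ I) i z' hz')
  choose w hw using hw
  refine ⟨∑ g, w g, ?_⟩
  rw [map_sum]
  simp only [hw]
  ext y
  rw [hx1e, Finsupp.finsetSum_apply]
  have h4 : ∀ v : FreeMod (S ⧸ I) (G.β 1), G.d 0 v g0 =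
      ∑ g, s g • v g := by
    intro v
    conv_lhs => rw [← Finsupp.univ_sum_single v]
    rw [map_sum, Finsupp.finsetSum_apply]
    refine Finset.sum_congr rfl fun g _ => ?_
    rw [← mul_one (v g), ← smul_eq_mul, ← Finsupp.smul_single, map_smul, Finsupp.smul_apply, hs',
      smul_eq_mul, smul_eq_mul, mul_one, mul_comm]
    rfl
  rw [h4]
  rfl

include hε hK hKm hf0 h0 in
lemma main_aux (hGm : ∀ s, ε s = 0 → ∀ v, Ideal.Quotient.mk I s • v ∈ LinearMap.range (G.d 0))
    (g0 : (j : ℤ) × Fin (G.β 0 j)) (hg0 : g0.1 = 0) (i : ℕ) (j : ℤ) (hij : (i : ℤ) < j)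
    (H : ∀ l, 1 ≤ l → l ≤ i → ∀ b, G.β (l + 1) b ≠ 0 → F.β (i - l) (j - b) = 0) :
    HR 𝒜 I hI K i j := by
  intro x hx
  set x1 := gp Sigma.fst (πR 𝒜 I hI) j x with hx1
  have hcx1 : cyc (fun a => KB K a →₀ (S ⧸ I)) (dK (B := KB K) K.d (S ⧸ I)) i x1 := by
    cases i with
    | zero => trivial
    | succ i =>
      change dK (B := KB K) K.d _ i x1 = 0
      rw [hx1, ← dK_gp 𝒜 K _ (πR_smul 𝒜 I hI), show dK (B := KB K) K.d _ i x = 0 from hx, map_zero]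
  obtain ⟨z, hz⟩ := main1 𝒜 ε hε I hI K hK G hGm g0 i j hij x x1 hx1
  obtain ⟨z', hz', hz''⟩ := main2 𝒜 ε hε I hI K hK hKm F f0 hf0 h0 G i j H z
    (by rw [hz]; exact cyc_nat 𝒜 K _ i x1 hcx1)
  refine main3 𝒜 ε hε I K hKm F f0 hf0 h0 G g0 hg0 i x1 z' hz' ?_
  intro y
  have h1 : mE (B := KB K) (N := fun p => FreeMod (S ⧸ I) (G.β p)) (eG 𝒜 I G) i 0 z' = Finsupp.mapRange.linearMap (Finsupp.lsingle g0 : (S ⧸ I) →ₗ[S] FreeMod (S ⧸ I) (G.β 0)) x1 := by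
    rw [hz'', hz]
    refine (gp_nat Sigma.fst (πR 𝒜 I hI) _ (Finsupp.lsingle g0 : (S ⧸ I) →ₗ[S] FreeMod (S ⧸ I) (G.β 0)) ?_ j x1).symm.trans ?_
    · intro c n
      change Finsupp.single g0 _ = gp _ _ _ (Finsupp.single g0 _)
      rw [gp_single, hg0, sub_zero]
    · rw [hx1, gp_idem _ _ (πR_idem 𝒜 I hI)]
  have h2 := DFunLike.congr_fun (DFunLike.congr_fun h1 y) g0
  have h3 : G.d 0 (z' y) g0 = Finsupp.single g0 (x1 y) g0 := h2
  rw [h3, Finsupp.single_eq_same]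

include hε hf0 h0 in
lemma deg_lt (hIlin : ∀ x ∈ I, x ∈ 𝒜 1 → x = 0) (i : ℕ) (f : (j : ℤ) × Fin (F.β (i + 1) j)) :
    ((i : ℤ) + 1) < f.1 := by
  have hne : ∀ i (f : (j : ℤ) × Fin (F.β (i + 1) j)), F.d i (Finsupp.single f 1) ≠ 0 := by
    intro i f h
    obtain ⟨v, hv⟩ := (F.exact i).ge h
    have := ent' ε _ (entry_ε 𝒜 ε hε F (i + 1)) v f
    rw [hv] at this
    simp at this
  induction i with
  | zero =>
    have h1 : F.d 0 (Finsupp.single f 1) f0 ≠ 0 := by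
      intro h
      apply hne 0 f
      ext g
      rw [hf0 g, h]; rfl
    have h2 := F.minimal 0 f.1 f.2 f0.1 f0.2 h1
    rcases F.graded 0 f.1 f.2 f0.1 f0.2 with h' | ⟨m, hm, h'⟩
    · exact absurd h' h1
    · by_contra hlt
      have hm1 : m = 1 := by simp at hlt; omega
      subst hm1
      refine h1 (hIlin _ ?_ h')
      have := (ker_aug' 𝒜 I F f0 hf0).ge ⟨Finsupp.single f 1, rfl⟩
      rw [LinearMap.mem_ker, aug'_apply] at this
      exact Ideal.Quotient.eq_zero_iff_mem.1 this
  | succ i ih =>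
    obtain ⟨g, hg⟩ := Finsupp.ne_iff.1 (hne (i + 1) f)
    have h2 := F.minimal (i + 1) f.1 f.2 g.1 g.2 hg
    have := ih g
    push_cast
    omega

end main
end KoszulAux


/-- Let `S` be a standard graded Koszul algebra over a field `k` (Koszulness is
expressed by the existence of a minimal graded free resolution `Kres` of `k` over `S` which is
concentrated on the diagonal, i.e. `Tor_i^S(k,k)` lives in degree `i`), and let `R = S/I` with
`I` a homogeneous ideal containing no linear forms.  Then for every `i ≥ 1`,
`t_i^S(R) ≤ max { t_{i-l}^S(R) + t_{l+1}^R(k) : l = 1, …, i }`, where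
`t_i^A(N) = sup { j : Tor_i^A(k,N)_j ≠ 0 }`.  This is formulated as: every degree `j` with
`β^S_{i,j}(R) ≠ 0` is bounded by `a + b` for some `1 ≤ l ≤ i` and degrees `a`, `b` with
`β^S_{i-l,a}(R) ≠ 0` and `β^R_{l+1,b}(k) ≠ 0`. -/
theorem t_le_max_t_add_t_of_koszul
    (k : Type) [Field k] (S : Type) [CommRing S] [Algebra k S]
    (𝒜 : ℕ → Submodule k S) [GradedAlgebra 𝒜]
    (hstd : ∀ m, 𝒜 (m + 1) = 𝒜 m * 𝒜 1)
    (ε : S →ₐ[k] k) (hε : ∀ m, 1 ≤ m → ∀ x ∈ 𝒜 m, ε x = 0)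
    (I : Ideal S) (hI : Ideal.IsHomogeneous 𝒜 I)
    (hIlin : ∀ x ∈ I, x ∈ 𝒜 1 → x = 0)
    (hIε : ∀ a ∈ I, ε a = 0) :
    letI : Module S k := Module.compHom k ε.toRingHom
    letI : Module (S ⧸ I) k :=
      Module.compHom k (Ideal.Quotient.lift I ε.toRingHom hIε)
    ∀ (Kres : MinGradedFreeRes S (fun m => (𝒜 m : Set S)) k),
      (∀ (i : ℕ) (j : ℤ), Kres.β i j ≠ 0 → j = (i : ℤ)) →
    ∀ (Rres : MinGradedFreeRes S (fun m => (𝒜 m : Set S)) (S ⧸ I)),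
      (∀ j : ℤ, Rres.β 0 j = if j = 0 then 1 else 0) →
    ∀ (kres : MinGradedFreeRes (S ⧸ I)
        (fun m => (Ideal.Quotient.mk I) '' (𝒜 m : Set S)) k),
      (∀ j : ℤ, kres.β 0 j = if j = 0 then 1 else 0) →
    ∀ i : ℕ, 1 ≤ i → ∀ j : ℤ, Rres.β i j ≠ 0 →
      ∃ l : ℕ, 1 ≤ l ∧ l ≤ i ∧ ∃ a b : ℤ,
        Rres.β (i - l) a ≠ 0 ∧ kres.β (l + 1) b ≠ 0 ∧ j ≤ a + b := by
  letI m1 : Module S k := Module.compHom k ε.toRingHom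
  letI m2 : Module (S ⧸ I) k := Module.compHom k (Ideal.Quotient.lift I ε.toRingHom hIε)
  intro Kres hK Rres hR kres hk i hi j hj
  have hKm : ∀ s, ε s = 0 → ∀ v, s • v ∈ LinearMap.range (Kres.d 0) := by
    intro s hs v
    rw [Kres.exact₀, LinearMap.mem_ker, map_smul]
    change ε s * _ = 0
    rw [hs, zero_mul]
  have hGm : ∀ s, ε s = 0 → ∀ v, Ideal.Quotient.mk I s • v ∈ LinearMap.range (kres.d 0) := by
    intro s hs v
    rw [kres.exact₀, LinearMap.mem_ker, map_smul]
    change ε s * _ = 0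
    rw [hs, zero_mul]
  have hy0 : Nonempty ((j : ℤ) × Fin (Kres.β 0 j)) := by
    by_contra h
    rw [not_nonempty_iff] at h
    obtain ⟨v, hv⟩ := Kres.augSurj 1
    rw [Subsingleton.elim v 0, map_zero] at hv
    exact zero_ne_one hv
  obtain ⟨y0⟩ := hy0
  have hR0 : Rres.β 0 0 = 1 := by rw [hR]; rfl
  have hk0 : kres.β 0 0 = 1 := by rw [hk]; rfl
  let f0 : (j : ℤ) × Fin (Rres.β 0 j) := ⟨0, ⟨0, by omega⟩⟩
  let g0 : (j : ℤ) × Fin (kres.β 0 j) := ⟨0, ⟨0, by omega⟩⟩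
  have hf0 : ∀ f, f = f0 := by
    rintro ⟨b, a⟩
    have hb : b = 0 := by
      by_contra hb
      have := hR b
      rw [if_neg hb] at this
      have := a.2
      omega
    subst hb
    have : a = ⟨0, by omega⟩ := by
      ext
      have := a.2
      simp only
      omega
    rw [this]
  obtain ⟨i, rfl⟩ : ∃ i', i = i' + 1 := ⟨i - 1, by omega⟩
  let f : (j : ℤ) × Fin (Rres.β (i + 1) j) := ⟨j, ⟨0, Nat.pos_of_ne_zero hj⟩⟩
  by_contra hcon
  push Not at hcon
  refine KoszulAux.not_HR 𝒜 ε hε I hI Kres hK hKm Rres f0 hf0 rfl y0 i f ?_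
  refine KoszulAux.main_aux 𝒜 ε hε I hI Kres hK hKm Rres f0 hf0 rfl kres hGm g0 rfl (i + 1) j ?_ ?_
  · have := KoszulAux.deg_lt 𝒜 ε hε I Rres f0 hf0 rfl hIlin i f
    push_cast
    exact this
  · intro l h1 h2 b hb
    by_contra h3
    have := hcon l h1 h2 (j - b) b h3 hb
    omega
end

section
/- Let S be a standard graded Koszul algebra over k and R = S/I a graded quotient. Then for every i ≥ 0, t_i^S(R) ≤ 2i + Σ_{j=2}^{i+1} reg_j^R(k), where reg_n^A(N) = max{ t_i^A(N) − i : i ≤ n }. -/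
section Helpers

/-- cycles -/
def cyc' {A : ℕ → Type} [∀ n, AddCommGroup (A n)] (d : ∀ n, A (n + 1) →+ A n) :
    ∀ n, A n → Prop
  | 0, _ => True
  | n + 1, x => d n x = 0

theorem balance' {X : ℕ → ℕ → Type} [∀ p q, AddCommGroup (X p q)]
    {A B : ℕ → Type} [∀ n, AddCommGroup (A n)] [∀ n, AddCommGroup (B n)]
    (h : ∀ p q, X (p + 1) q →+ X p q) (v : ∀ p q, X p (q + 1) →+ X p q)
    (a : ∀ q, X 0 q →+ A q) (b : ∀ p, X p 0 →+ B p)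
    (dA : ∀ n, A (n + 1) →+ A n) (dB : ∀ n, B (n + 1) →+ B n)
    (hv : ∀ p q x, h p q (v (p + 1) q x) = v p q (h p (q + 1) x))
    (av : ∀ q x, a q (v 0 q x) = dA q (a (q + 1) x))
    (bh : ∀ p x, b p (h p 0 x) = dB p (b (p + 1) x))
    (hex : ∀ p q x, h p q x = 0 ↔ ∃ y, h (p + 1) q y = x)
    (aex : ∀ q x, a q x = 0 ↔ ∃ y, h 0 q y = x)
    (asurj : ∀ q, Function.Surjective (a q))
    (vex : ∀ p q x, v p q x = 0 ↔ ∃ y, v p (q + 1) y = x)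
    (bex : ∀ p x, b p x = 0 ↔ ∃ y, v p 0 y = x)
    (bsurj : ∀ p, Function.Surjective (b p))
    (φ : ∀ p q, X p q →+ X p q) (φA : ∀ n, A n →+ A n) (φB : ∀ n, B n →+ B n)
    (φh : ∀ p q x, φ p q (h p q x) = h p q (φ (p + 1) q x))
    (φv : ∀ p q x, φ p q (v p q x) = v p q (φ p (q + 1) x))
    (φa : ∀ q x, φA q (a q x) = a q (φ 0 q x))
    (φb : ∀ p x, φB p (b p x) = b p (φ p 0 x))
    (n : ℕ) (HB : ∀ y : B n, cyc' dB n y → ∃ z, dB n z = φB n y)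
    (α : A n) (hα : cyc' dA n α) : ∃ z, dA n z = φA n α := by
  have key : ∀ q p : ℕ, p + q = n → ∀ x : X p q,
      (match q, x with
        | 0, x => cyc' dB p (b p x)
        | q + 1, x => ∃ y, v p q x = h p q y) →
      ∃ w u, φ p q x = h p q w + v p q u := by
    intro q
    induction q with
    | zero =>
      intro p hp x hx
      obtain rfl : p = n := by omega
      obtain ⟨γ, hγ⟩ := HB _ hx
      obtain ⟨w, rfl⟩ := bsurj _ γ
      have : b p (φ p 0 x - h p 0 w) = 0 := by
        rw [map_sub, ← φb, ← hγ, bh, sub_self]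
      obtain ⟨u, hu⟩ := (bex _ _).1 this
      exact ⟨w, u, by rw [hu]; abel⟩
    | succ q ih =>
      intro p hp x hx
      obtain ⟨y, hy⟩ := hx
      obtain ⟨w, u, hwu⟩ := ih (p + 1) (by omega) y (by
        cases q with
        | zero =>
          show dB p (b (p + 1) y) = 0
          rw [← bh, ← hy]
          exact (bex _ _).2 ⟨_, rfl⟩
        | succ q =>
          have : h p q (v (p + 1) q y) = 0 := by
            rw [hv, ← hy]
            exact (vex _ _ _).2 ⟨_, rfl⟩
          obtain ⟨y', hy'⟩ := (hex _ _ _).1 this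
          exact ⟨y', hy'.symm⟩)
      have : v p q (φ p (q + 1) x - h p (q + 1) u) = 0 := by
        rw [map_sub, ← φv, hy, φh, hwu, map_add, hv, add_sub_cancel_right]
        exact (hex _ _ _).2 ⟨_, rfl⟩
      obtain ⟨u', hu'⟩ := (vex _ _ _).1 this
      exact ⟨u, u', by rw [hu']; abel⟩
  obtain ⟨x₀, rfl⟩ := asurj _ α
  obtain ⟨w, u, hwu⟩ := key n 0 (by omega) x₀ (by
    cases n with
    | zero => trivial
    | succ n =>
      have : a n (v 0 n x₀) = 0 := by rw [av]; exact hα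
      obtain ⟨y, hy⟩ := (aex _ _).1 this
      exact ⟨y, hy.symm⟩)
  refine ⟨a _ u, ?_⟩
  rw [φa, hwu, map_add, av, (aex n (h 0 n w)).2 ⟨_, rfl⟩, zero_add]

/-- matrix acting on tuples of module elements -/
def act' {ι κ A M : Type} [Fintype ι] [CommRing A] [AddCommGroup M] [Module A M]
    (D : κ → ι → A) : (ι → M) →+ (κ → M) where
  toFun f c := ∑ a, D c a • f a
  map_zero' := by ext; simp
  map_add' f g := by ext; simp [Finset.sum_add_distrib]

theorem act'_apply {ι κ A M : Type} [Fintype ι] [CommRing A] [AddCommGroup M] [Module A M]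
    (D : κ → ι → A) (f : ι → M) (c : κ) : act' D f c = ∑ a, D c a • f a := rfl

theorem act'_nat {ι κ A M N : Type} [Fintype ι] [CommRing A] [AddCommGroup M] [Module A M]
    [AddCommGroup N] [Module A N] (g : M →+ N) (hg : ∀ (s : A) x, g (s • x) = s • g x)
    (D : κ → ι → A) (f : ι → M) (c : κ) :
    g (act' D f c) = act' D (fun i => g (f i)) c := by
  simp only [act'_apply, map_sum, hg]

theorem act'_smul {ι κ A B M : Type} [Fintype ι] [CommRing A] [AddCommGroup M] [Module A M]
    [CommRing B] [Module B M] [SMulCommClass B A M]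
    (D : κ → ι → A) (s : B) (f : ι → M) :
    act' D (s • f) = s • act' D f := by
  ext c
  simp only [act'_apply, Pi.smul_apply, Finset.smul_sum]
  refine Finset.sum_congr rfl fun i _ => (smul_comm _ _ _).symm

theorem act'_act' {ι κ l A M : Type} [Fintype ι] [Fintype κ] [CommRing A] [AddCommGroup M]
    [Module A M] (D : l → κ → A) (E : κ → ι → A)
    (h : ∀ f : ι → A, act' D (act' E f) = 0) (f : ι → M) : act' D (act' E f) = 0 := by
  classical
  have h' : ∀ c a, ∑ b, D c b * E b a = 0 := by
    intro c a
    have := congrFun (h (Pi.single a 1)) c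
    simpa [act'_apply, Pi.single_apply] using this
  ext c
  simp only [act'_apply, Finset.smul_sum, smul_smul, Pi.zero_apply]
  rw [Finset.sum_comm]
  simp only [← Finset.sum_smul, h', zero_smul, Finset.sum_const_zero]

/-- degree projections on tuples -/
def piP' {ι M : Type} [AddCommGroup M] (deg : ι → ℤ) (π : ℤ → M →+ M) (j : ℤ) :
    (ι → M) →+ (ι → M) where
  toFun f i := π (j - deg i) (f i)
  map_zero' := by ext; simp
  map_add' f g := by ext; simp

theorem piP'_apply {ι M : Type} [AddCommGroup M] (deg : ι → ℤ) (π : ℤ → M →+ M) (j : ℤ)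
    (f : ι → M) (i : ι) : piP' deg π j f i = π (j - deg i) (f i) := rfl

/-- compatible -/
def Compat' {A M : Type} [CommRing A] [AddCommGroup M] [Module A M] (hom : ℕ → Set A)
    (π : ℤ → M →+ M) : Prop :=
  ∀ (m : ℕ) (s : A), s ∈ hom m → ∀ (j : ℤ) (x : M), π j (s • x) = s • π (j - m) x

theorem compat_piP' {ι A M : Type} [CommRing A] [AddCommGroup M] [Module A M] {hom : ℕ → Set A}
    {π : ℤ → M →+ M} (h : Compat' hom π) (deg : ι → ℤ) : Compat' hom (piP' deg π) := by
  intro m s hs j x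
  ext i
  simp only [piP'_apply, Pi.smul_apply]
  rw [h m s hs, sub_right_comm]

theorem act'_piP' {ι κ A M : Type} [Fintype ι] [CommRing A] [AddCommGroup M] [Module A M]
    {hom : ℕ → Set A} {π : ℤ → M →+ M} (h : Compat' hom π) (degι : ι → ℤ) (degκ : κ → ℤ)
    (D : κ → ι → A) (hD : ∀ c a, D c a = 0 ∨
      ∃ m : ℕ, 0 < m ∧ (m : ℤ) = degι a - degκ c ∧ D c a ∈ hom m) (j : ℤ) (f : ι → M) :
    piP' degκ π j (act' D f) = act' D (piP' degι π j f) := by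
  ext c
  simp only [piP'_apply, act'_apply, map_sum]
  refine Finset.sum_congr rfl fun a _ => ?_
  rcases hD c a with h0 | ⟨m, -, hm, hs⟩
  · simp [h0]
  · rw [h m _ hs, hm, show j - degκ c - (degι a - degκ c) = j - degι a by ring]

/-- based resolution -/
structure BRes' (A : Type) [CommRing A] (hom : ℕ → Set A)
    (N : Type) [AddCommGroup N] [Module A N] where
  ι : ℕ → Type
  fin : ∀ i, Fintype (ι i)
  deg : ∀ i, ι i → ℤ
  D : ∀ i, ι i → ι (i + 1) → A
  aug : (ι 0 → A) →ₗ[A] N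
  graded : ∀ i c a, D i c a = 0 ∨
    ∃ m : ℕ, 0 < m ∧ (m : ℤ) = deg (i + 1) a - deg i c ∧ D i c a ∈ hom m
  augSurj : Function.Surjective aug
  exact₀ : ∀ f, aug f = 0 ↔ ∃ g : ι 1 → A, act' (D 0) g = f
  exact : ∀ i (f : ι (i + 1) → A), act' (D i) f = 0 ↔ ∃ g : ι (i + 2) → A, act' (D (i + 1)) g = f

attribute [instance] BRes'.fin

theorem BRes'.dd {A : Type} [CommRing A] {hom : ℕ → Set A}
    {N : Type} [AddCommGroup N] [Module A N] (F : BRes' A hom N) {M : Type} [AddCommGroup M]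
    [Module A M] (i : ℕ) (f : F.ι (i + 2) → M) : act' (F.D i) (act' (F.D (i + 1)) f) = 0 :=
  act'_act' _ _ (fun f => (F.exact i _).2 ⟨f, rfl⟩) f

/-- exactness with coefficients in tuples -/
theorem BRes'.exactT {A : Type} [CommRing A] {hom : ℕ → Set A}
    {N : Type} [AddCommGroup N] [Module A N] (F : BRes' A hom N) {κ : Type}
    (i : ℕ) (f : F.ι (i + 1) → κ → A) :
    act' (F.D i) f = 0 ↔ ∃ g : F.ι (i + 2) → κ → A, act' (F.D (i + 1)) g = f := by
  constructor
  · intro h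
    have : ∀ c, ∃ g : F.ι (i + 2) → A, act' (F.D (i + 1)) g = fun a => f a c := by
      intro c
      refine (F.exact i _).1 ?_
      ext a
      have := congrFun (congrFun h a) c
      simpa [act'_apply] using this
    choose g hg using this
    refine ⟨fun a c => g c a, ?_⟩
    ext a c
    have := congrFun (hg c) a
    simpa [act'_apply] using this
  · rintro ⟨g, rfl⟩
    exact F.dd i g

/-- conversion -/
noncomputable def MinGradedFreeRes.toB' {A : Type} [CommRing A] {hom : ℕ → Set A}
    {M : Type} [AddCommGroup M] [Module A M] (res : MinGradedFreeRes A hom M) :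
    BRes' A hom M :=
  haveI fin : ∀ i, Finite ((j : ℤ) × Fin (res.β i j)) := fun i => by
    have := (res.finβ i).to_subtype
    refine Finite.of_injective
      (β := (j : Function.support (res.β i)) × Fin (res.β i j.1))
      (fun x => ⟨⟨x.1, fun h => by have := x.2.2; omega⟩, x.2⟩) ?_
    rintro ⟨j, a⟩ ⟨j', a'⟩ h
    have h1 : j = j' := congrArg (fun x => x.1.1) h
    subst h1
    simpa using h
  letI fin' : ∀ i, Fintype ((j : ℤ) × Fin (res.β i j)) := fun i => Fintype.ofFinite _
  have key : ∀ i (x : FreeMod A (res.β (i + 1))),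
      act' (fun c a => res.d i (Finsupp.single a 1) c) (⇑x) = ⇑(res.d i x) := by
    intro i x
    classical
    ext c
    conv_rhs => rw [← Finsupp.univ_sum_single x]
    rw [map_sum, Finsupp.finsetSum_apply, act'_apply]
    refine Finset.sum_congr rfl fun a _ => ?_
    rw [← mul_one (x a), ← smul_eq_mul (x a), ← Finsupp.smul_single, map_smul, Finsupp.smul_apply]
    simp [mul_comm]
  { ι := fun i => (j : ℤ) × Fin (res.β i j)
    fin := fin'
    deg := fun i x => x.1
    D := fun i c a => res.d i (Finsupp.single a 1) c
    aug := res.aug ∘ₗ (Finsupp.linearEquivFunOnFinite A A _).symm.toLinearMap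
    graded := by
      rintro i ⟨j', a'⟩ ⟨j, a⟩
      by_cases h0 : res.d i (Finsupp.single ⟨j, a⟩ 1) ⟨j', a'⟩ = 0
      · exact Or.inl h0
      · right
        obtain ⟨m, hm, hs⟩ := (res.graded i j a j' a').resolve_left h0
        have := res.minimal i j a j' a' h0
        exact ⟨m, by omega, hm, hs⟩
    augSurj := by
      intro y
      obtain ⟨x, rfl⟩ := res.augSurj y
      exact ⟨⇑x, by simp⟩
    exact₀ := by
      intro f
      have h1 : ∀ x, res.aug x = 0 ↔ ∃ g, res.d 0 g = x := fun x => by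
        rw [← LinearMap.mem_ker, ← res.exact₀, LinearMap.mem_range]
      obtain ⟨x, rfl⟩ := (Finsupp.linearEquivFunOnFinite A A _).surjective f
      simp only [LinearMap.comp_apply, LinearEquiv.coe_coe, LinearEquiv.symm_apply_apply]
      rw [h1]
      constructor
      · rintro ⟨g, rfl⟩
        exact ⟨⇑g, key 0 g⟩
      · rintro ⟨g, hg⟩
        obtain ⟨y, rfl⟩ := (Finsupp.linearEquivFunOnFinite A A _).surjective g
        exact ⟨y, DFunLike.coe_injective ((key 0 y).symm.trans hg)⟩
    exact := by
      intro i f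
      have h1 : ∀ x, res.d i x = 0 ↔ ∃ g, res.d (i + 1) g = x := fun x => by
        rw [← LinearMap.mem_ker, ← res.exact, LinearMap.mem_range]
      obtain ⟨x, rfl⟩ := (Finsupp.linearEquivFunOnFinite A A _).surjective f
      have h2 : act' (fun c a => res.d i (Finsupp.single a 1) c)
          ((Finsupp.linearEquivFunOnFinite A A _) x) = ⇑(res.d i x) := key i x
      rw [h2, ← Finsupp.coe_zero, DFunLike.coe_fn_eq, h1]
      constructor
      · rintro ⟨g, rfl⟩
        exact ⟨⇑g, key (i + 1) g⟩
      · rintro ⟨g, hg⟩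
        obtain ⟨y, rfl⟩ := (Finsupp.linearEquivFunOnFinite A A _).surjective g
        exact ⟨y, DFunLike.coe_injective ((key (i + 1) y).symm.trans hg)⟩ }

/-- Both balancing directions for `F` resolving `R` and `K` resolving `k`. -/
theorem bal_both {S k : Type} [CommRing S] [AddCommGroup k] [Module S k]
    {hom : ℕ → Set S} {I : Ideal S} (K : BRes' S hom k) (F : BRes' S hom (S ⧸ I))
    (i₀ : F.ι 0)
    (hF0 : ∀ f : F.ι 0 → S, Ideal.Quotient.mk I (f i₀) = 0 ↔ ∃ g : F.ι 1 → S, act' (F.D 0) g = f)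
    (φ : ∀ p q, (F.ι p → K.ι q → S) →+ (F.ι p → K.ι q → S))
    (φA : ∀ n, (K.ι n → S ⧸ I) →+ (K.ι n → S ⧸ I)) (φB : ∀ n, (F.ι n → k) →+ (F.ι n → k))
    (φh : ∀ p q x, φ p q (act' (F.D p) x) = act' (F.D p) (φ (p + 1) q x))
    (φv : ∀ p q (x : F.ι p → K.ι (q + 1) → S), φ p q (fun i => act' (K.D q) (x i)) =
      fun i => act' (K.D q) (φ p (q + 1) x i))
    (φa : ∀ q (x : F.ι 0 → K.ι q → S), φA q (fun c => Ideal.Quotient.mk I (x i₀ c)) =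
      fun c => Ideal.Quotient.mk I (φ 0 q x i₀ c))
    (φb : ∀ p (x : F.ι p → K.ι 0 → S), φB p (fun i => K.aug (x i)) =
      fun i => K.aug (φ p 0 x i))
    (n : ℕ) :
    ((∀ y : F.ι n → k, cyc' (A := fun n => F.ι n → k) (fun n => act' (F.D n)) n y →
        ∃ z : F.ι (n + 1) → k, act' (F.D n) z = φB n y) →
      (∀ y : K.ι n → S ⧸ I, cyc' (A := fun n => K.ι n → S ⧸ I) (fun n => act' (K.D n)) n y →
        ∃ z : K.ι (n + 1) → S ⧸ I, act' (K.D n) z = φA n y)) ∧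
    ((∀ y : K.ι n → S ⧸ I, cyc' (A := fun n => K.ι n → S ⧸ I) (fun n => act' (K.D n)) n y →
        ∃ z : K.ι (n + 1) → S ⧸ I, act' (K.D n) z = φA n y) →
      (∀ y : F.ι n → k, cyc' (A := fun n => F.ι n → k) (fun n => act' (F.D n)) n y →
        ∃ z : F.ι (n + 1) → k, act' (F.D n) z = φB n y)) := by
  let h : ∀ p q, (F.ι (p + 1) → K.ι q → S) →+ (F.ι p → K.ι q → S) := fun p q => act' (F.D p)
  let v : ∀ p q, (F.ι p → K.ι (q + 1) → S) →+ (F.ι p → K.ι q → S) := fun p q =>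
    (act' (K.D q)).compLeft _
  let mkA : S →+ S ⧸ I := (Ideal.Quotient.mk I).toAddMonoidHom
  let a : ∀ q, (F.ι 0 → K.ι q → S) →+ (K.ι q → S ⧸ I) := fun q =>
    (mkA.compLeft _).comp (Pi.evalAddMonoidHom _ i₀)
  let b : ∀ p, (F.ι p → K.ι 0 → S) →+ (F.ι p → k) := fun p =>
    (K.aug.toAddMonoidHom).compLeft _
  let dA : ∀ n, (K.ι (n + 1) → S ⧸ I) →+ (K.ι n → S ⧸ I) := fun n => act' (K.D n)
  let dB : ∀ n, (F.ι (n + 1) → k) →+ (F.ι n → k) := fun n => act' (F.D n)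
  have hv : ∀ p q x, h p q (v (p + 1) q x) = v p q (h p (q + 1) x) := by
    intro p q x
    funext i
    exact (act'_nat (act' (K.D q)) (fun s y => act'_smul _ s y) (F.D p) x i).symm
  have av : ∀ q x, a q (v 0 q x) = dA q (a (q + 1) x) := by
    intro q x
    funext c
    exact act'_nat mkA (fun s y => rfl) (K.D q) (x i₀) c
  have bh : ∀ p x, b p (h p 0 x) = dB p (b (p + 1) x) := by
    intro p x
    funext i
    exact act'_nat (K.aug.toAddMonoidHom) (fun s y => K.aug.map_smul s y) (F.D p) x i
  have hex : ∀ p q x, h p q x = 0 ↔ ∃ y, h (p + 1) q y = x := fun p q x => F.exactT p x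
  have aex : ∀ q x, a q x = 0 ↔ ∃ y, h 0 q y = x := by
    intro q x
    constructor
    · intro hx
      have : ∀ c, ∃ g : F.ι 1 → S, act' (F.D 0) g = fun i => x i c := fun c =>
        (hF0 _).1 (congrFun hx c)
      choose g hg using this
      refine ⟨fun i c => g c i, ?_⟩
      ext i c
      have := congrFun (hg c) i
      simpa [h, act'_apply] using this
    · rintro ⟨y, rfl⟩
      funext c
      refine (hF0 (fun i => h 0 q y i c)).2 ⟨fun i => y i c, ?_⟩
      ext i
      simp [h, act'_apply]
  have asurj : ∀ q, Function.Surjective (a q) := by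
    intro q y
    choose g hg using fun c => Ideal.Quotient.mk_surjective (y c)
    exact ⟨fun _ => g, funext hg⟩
  have vex : ∀ p q x, v p q x = 0 ↔ ∃ y, v p (q + 1) y = x := by
    intro p q x
    constructor
    · intro hx
      choose g hg using fun i => (K.exact q (x i)).1 (congrFun hx i)
      exact ⟨g, funext hg⟩
    · rintro ⟨y, rfl⟩
      exact funext fun i => K.dd q (y i)
  have bex : ∀ p x, b p x = 0 ↔ ∃ y, v p 0 y = x := by
    intro p x
    constructor
    · intro hx
      choose g hg using fun i => (K.exact₀ (x i)).1 (congrFun hx i)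
      exact ⟨g, funext hg⟩
    · rintro ⟨y, rfl⟩
      exact funext fun i => (K.exact₀ _).2 ⟨y i, rfl⟩
  have bsurj : ∀ p, Function.Surjective (b p) := by
    intro p y
    choose g hg using fun c => K.augSurj (y c)
    exact ⟨g, funext hg⟩
  constructor
  · intro HB y hy
    exact balance' h v a b dA dB hv av bh hex aex asurj vex bex bsurj φ φA φB φh φv φa φb n HB y hy
  · intro HA y hy
    exact balance' (X := fun p q => F.ι q → K.ι p → S) (A := fun n => F.ι n → k)
      (B := fun n => K.ι n → S ⧸ I) (fun p q => v q p) (fun p q => h q p) b a dB dA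
      (fun p q x => (hv q p x).symm) bh av (fun p q x => vex q p x) bex bsurj
      (fun p q x => hex q p x) aex asurj (fun p q => φ q p) φB φA
      (fun p q x => φv q p x) (fun p q x => φh q p x) φb φa n HA y hy

/-- The main chase. -/
theorem main_chase {S k : Type} [CommRing S] [AddCommGroup k] {I : Ideal S} [Module S k]
    [Module (S ⧸ I) k]
    {hom : ℕ → Set S} {homR : ℕ → Set (S ⧸ I)} (K : BRes' S hom k) (G : BRes' (S ⧸ I) homR k)
    (πR : ℤ → (S ⧸ I) →+ (S ⧸ I))
    (hπ : ∀ j x, πR j (πR j x) = πR j x)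
    (cS : Compat' hom πR) (cR : Compat' homR πR)
    (g₀ : G.ι 0) (hg₀ : ∀ g, g = g₀) (hdg : G.deg 0 g₀ = 0)
    (i : ℕ) (j : ℤ)
    (hG0 : ∀ (c : K.ι i) (x : S ⧸ I), ∃ g : G.ι 1 → S ⧸ I,
      act' (G.D 0) g g₀ = πR (j - K.deg i c) x)
    (hm : ∀ g, ∀ y : K.ι i → S ⧸ I, cyc' (A := fun n => K.ι n → S ⧸ I) (fun n => act' (K.D n)) i y →
      ∃ z : K.ι (i + 1) → S ⧸ I, act' (K.D i) z = G.D 0 g₀ g • y)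
    (hH : ∀ p q, p < i → p + q = i + 1 → ∀ g : G.ι q, ∀ y : K.ι p → S ⧸ I,
      cyc' (A := fun n => K.ι n → S ⧸ I) (fun n => act' (K.D n)) p y →
      ∃ z : K.ι (p + 1) → S ⧸ I, act' (K.D p) z = piP' (K.deg p) πR (j - G.deg q g) y)
    (y : K.ι i → S ⧸ I)
    (hy : cyc' (A := fun n => K.ι n → S ⧸ I) (fun n => act' (K.D n)) i y) :
    ∃ z : K.ι (i + 1) → S ⧸ I, act' (K.D i) z = piP' (K.deg i) πR j y := by
  -- notation
  let Y : ℕ → ℕ → Type := fun p q => G.ι q → K.ι p → S ⧸ I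
  let d : ∀ p q, (G.ι q → K.ι (p + 1) → S ⧸ I) →+ (G.ι q → K.ι p → S ⧸ I) := fun p q =>
    (act' (K.D p)).compLeft _
  let e : ∀ p q, (G.ι (q + 1) → K.ι p → S ⧸ I) →+ (G.ι q → K.ι p → S ⧸ I) := fun p q =>
    act' (G.D q)
  let P : ∀ p q, (G.ι q → K.ι p → S ⧸ I) →+ (G.ι q → K.ι p → S ⧸ I) := fun p q =>
    piP' (G.deg q) (piP' (K.deg p) πR) j
  have de : ∀ p q x, d p q (e (p + 1) q x) = e p q (d p (q + 1) x) := by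
    intro p q x
    funext g
    exact act'_nat (act' (K.D p)) (fun s y => act'_smul _ s y) (G.D q) x g
  have Pe : ∀ p q x, P p q (e p q x) = e p q (P p (q + 1) x) := fun p q x =>
    act'_piP' (compat_piP' cR _) (G.deg (q + 1)) (G.deg q) (G.D q) (G.graded q) j x
  have Pd : ∀ p q x, P p q (d p q x) = d p q (P (p + 1) q x) := by
    intro p q x
    funext g
    exact act'_piP' cS (K.deg (p + 1)) (K.deg p) (K.D p) (K.graded p) (j - G.deg q g) (x g)
  have PP : ∀ p q x, P p q (P p q x) = P p q x := by
    intro p q x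
    funext g c
    exact hπ _ _
  have dd : ∀ p q x, d p q (d (p + 1) q x) = 0 := fun p q x => funext fun g => K.dd p (x g)
  have ee : ∀ p q x, e p q (e p (q + 1) x) = 0 := fun p q x => G.dd q x
  have cd : ∀ p q (x : G.ι q → K.ι p → S ⧸ I),
      cyc' (A := fun p => G.ι q → K.ι p → S ⧸ I) (fun p => d p q) p x → ∀ g,
      cyc' (A := fun n => K.ι n → S ⧸ I) (fun n => act' (K.D n)) p (x g) := by
    intro p q x hx g
    cases p with
    | zero => trivial
    | succ p => exact congrFun hx g
  have key : ∀ p q, p ≤ i → p + q = i → ∀ y : G.ι (q + 1) → K.ι p → S ⧸ I,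
      cyc' (A := fun p => G.ι q → K.ι p → S ⧸ I) (fun p => d p q) p (e p q y) →
      ∃ y', e p q y' = P p q (e p q y) ∧
        cyc' (A := fun p => G.ι (q + 1) → K.ι p → S ⧸ I) (fun p => d p (q + 1)) p y' := by
    intro p
    induction p with
    | zero => intro q _ _ y _; exact ⟨P 0 (q + 1) y, (Pe _ _ _).symm, trivial⟩
    | succ p ih =>
      intro q hp hpq y hy
      have hy0 : d p q (e (p + 1) q y) = 0 := hy
      rw [de] at hy0
      obtain ⟨y2, hy2⟩ := (G.exactT q _).1 hy0
      have hy2' : e p (q + 1) y2 = d p (q + 1) y := hy2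
      obtain ⟨y3, h3, h3c⟩ := ih (q + 1) (by omega) (by omega) y2 (by
        rw [hy2']
        cases p with
        | zero => trivial
        | succ p => exact dd _ _ _)
      have : ∀ g, ∃ z : K.ι (p + 1) → S ⧸ I, act' (K.D p) z = P p (q + 2) y3 g := fun g =>
        hH p (q + 2) (by omega) (by omega) g (y3 g) (cd _ _ _ h3c g)
      choose w hw using this
      have hw' : d p (q + 2) w = P p (q + 2) y3 := funext hw
      refine ⟨P (p + 1) (q + 1) y - e (p + 1) (q + 1) w, ?_, ?_⟩
      · rw [map_sub, ee, sub_zero, Pe]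
      · show d p (q + 1) _ = 0
        rw [map_sub, de, hw', ← Pe, h3, PP, ← Pd, hy2', sub_self]
  choose g hg using fun c => hG0 c (y c)
  let y1 : G.ι 1 → K.ι i → S ⧸ I := fun a c => g c a
  have hy1 : e i 0 y1 = fun _ => piP' (K.deg i) πR j y := by
    funext a c
    rw [hg₀ a]
    have := hg c
    simpa [e, y1, act'_apply, piP'_apply] using this
  have hcyc : cyc' (A := fun n => K.ι n → S ⧸ I) (fun n => act' (K.D n)) i
      (piP' (K.deg i) πR j y) := by
    cases i with
    | zero => trivial
    | succ i =>
      show act' (K.D i) (piP' (K.deg (i + 1)) πR j y) = 0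
      rw [← act'_piP' cS (K.deg (i + 1)) (K.deg i) (K.D i) (K.graded i)]
      have : act' (K.D i) y = 0 := hy
      rw [this, map_zero]
  obtain ⟨y', h1, h2⟩ := key i 0 le_rfl (by omega) y1 (by
    rw [hy1]
    cases i with
    | zero => trivial
    | succ i => exact funext fun _ => hcyc)
  have h3 : e i 0 y' g₀ = piP' (K.deg i) πR j y := by
    rw [h1, hy1]
    funext c
    show πR (j - G.deg 0 g₀ - K.deg i c) (πR (j - K.deg i c) (y c)) = πR (j - K.deg i c) (y c)
    rw [hdg, sub_zero, hπ]
  choose z hz using fun g => hm g (y' g) (cd _ _ _ h2 g)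
  refine ⟨∑ g, z g, ?_⟩
  rw [map_sum, ← h3]
  show _ = ∑ g, G.D 0 g₀ g • y' g
  exact Finset.sum_congr rfl fun g _ => hz g
/-- projections of a graded ring, indexed by integers -/
noncomputable def prS {k S : Type} [Field k] [CommRing S] [Algebra k S]
    (𝒜 : ℕ → Submodule k S) [GradedAlgebra 𝒜] (j : ℤ) : S →+ S :=
  if 0 ≤ j then GradedRing.proj 𝒜 j.toNat else 0

section
variable {k S : Type} [Field k] [CommRing S] [Algebra k S]
    (𝒜 : ℕ → Submodule k S) [GradedAlgebra 𝒜]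

theorem prS_neg {j : ℤ} (hj : j < 0) (x : S) : prS 𝒜 j x = 0 := by
  simp [prS, not_le.2 hj]

theorem prS_nat (n : ℕ) (x : S) : prS 𝒜 n x = (DirectSum.decompose 𝒜 x n : S) := by
  simp [prS, GradedRing.proj_apply]

theorem prS_idem (j : ℤ) (x : S) : prS 𝒜 j (prS 𝒜 j x) = prS 𝒜 j x := by
  rcases lt_or_ge j 0 with h | h
  · rw [prS_neg 𝒜 h, prS_neg 𝒜 h]
  · lift j to ℕ using h
    rw [prS_nat, prS_nat]
    exact DirectSum.decompose_of_mem_same 𝒜 (SetLike.coe_mem _)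

theorem prS_compat : Compat' (fun m => (𝒜 m : Set S)) (prS 𝒜) := by
  intro m s hs j x
  rcases lt_or_ge j 0 with h | h
  · rw [prS_neg 𝒜 h, prS_neg 𝒜 (by omega), smul_zero]
  · lift j to ℕ using h
    rcases le_or_gt m j with h | h
    · rw [← Nat.cast_sub h, prS_nat, prS_nat, smul_eq_mul, smul_eq_mul]
      exact DirectSum.coe_decompose_mul_of_left_mem_of_le 𝒜 hs h
    · rw [prS_nat, prS_neg 𝒜 (by omega), smul_zero, smul_eq_mul]
      exact DirectSum.coe_decompose_mul_of_left_mem_of_not_le 𝒜 hs (by omega)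

theorem eps_prS (ε : S →ₐ[k] k) (hε : ∀ m, 1 ≤ m → ∀ x ∈ 𝒜 m, ε x = 0) (j : ℤ) (x : S) :
    ε (prS 𝒜 j x) = if j = 0 then ε x else 0 := by
  rcases lt_or_ge j 0 with h | h
  · rw [prS_neg 𝒜 h, map_zero, if_neg h.ne]
  · lift j to ℕ using h
    rw [prS_nat]
    rcases Nat.eq_zero_or_pos j with rfl | hj
    · rw [Nat.cast_zero, if_pos rfl]
      classical
      conv_rhs => rw [← DirectSum.sum_support_decompose 𝒜 x]
      rw [map_sum, Finset.sum_eq_single 0]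
      · intro b _ hb
        exact hε b (by omega) _ (SetLike.coe_mem _)
      · intro h
        rw [DFinsupp.notMem_support_iff.1 h]; simp
    · rw [if_neg (by omega)]
      exact hε j hj _ (SetLike.coe_mem _)

theorem exists_prR (I : Ideal S) (hI : Ideal.IsHomogeneous 𝒜 I) :
    ∃ π : ℤ → (S ⧸ I) →+ (S ⧸ I), ∀ j s,
      π j (Ideal.Quotient.mk I s) = Ideal.Quotient.mk I (prS 𝒜 j s) := by
  have h : ∀ j s, s ∈ I → prS 𝒜 j s ∈ I := by
    intro j s hs
    rcases lt_or_ge j 0 with h | h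
    · rw [prS_neg 𝒜 h]; exact I.zero_mem
    · lift j to ℕ using h
      rw [prS_nat]
      exact hI j hs
  exact ⟨fun j => QuotientAddGroup.map I.toAddSubgroup I.toAddSubgroup (prS 𝒜 j)
    (fun s hs => h j s hs), fun j s => rfl⟩

theorem core' (ε : S →ₐ[k] k) (hε : ∀ m, 1 ≤ m → ∀ x ∈ 𝒜 m, ε x = 0)
    (I : Ideal S) (hI : Ideal.IsHomogeneous 𝒜 I) [Module S k] [Module (S ⧸ I) k]
    (hk : ∀ (s : S) (x : k), s • x = ε s * x)
    (hkR : ∀ (s : S) (x : k), Ideal.Quotient.mk I s • x = ε s * x)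
    (K : BRes' S (fun m => (𝒜 m : Set S)) k) (hK : ∀ i c, K.deg i c = i)
    (F : BRes' S (fun m => (𝒜 m : Set S)) (S ⧸ I))
    (i₀ : F.ι 0) (hi₀ : ∀ i, i = i₀) (hdi : F.deg 0 i₀ = 0)
    (G : BRes' (S ⧸ I) (fun m => (Ideal.Quotient.mk I) '' (𝒜 m : Set S)) k)
    (g₀ : G.ι 0) (hg₀ : ∀ i, i = g₀) (hdg : G.deg 0 g₀ = 0)
    (i : ℕ) (j : ℤ) (hij : j ≠ i)
    (hno : ∀ p q, p < i → p + q = i + 1 → ∀ (g : G.ι q) (a : F.ι p),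
      F.deg p a + G.deg q g ≠ j) (a : F.ι i) : F.deg i a ≠ j := by
  classical
  obtain ⟨πR, hπR⟩ := exists_prR 𝒜 I hI
  have cS : Compat' (fun m => (𝒜 m : Set S)) πR := by
    intro m s hs j x
    obtain ⟨x, rfl⟩ := Ideal.Quotient.mk_surjective x
    have := prS_compat 𝒜 m s hs j x
    rw [hπR]
    exact (hπR j (s • x)).trans (congrArg (Ideal.Quotient.mk I) this)
  have cR : Compat' (fun m => (Ideal.Quotient.mk I) '' (𝒜 m : Set S)) πR := by
    rintro m _ ⟨s, hs, rfl⟩ j x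
    exact cS m s hs j x
  have hπ : ∀ j x, πR j (πR j x) = πR j x := by
    intro j x
    obtain ⟨x, rfl⟩ := Ideal.Quotient.mk_surjective x
    rw [hπR, hπR, prS_idem]
  let πk : ℤ → k →+ k := fun j => if j = 0 then AddMonoidHom.id k else 0
  have πk0 : ∀ x, πk 0 x = x := fun x => by simp [πk]
  have πkn : ∀ j x, j ≠ 0 → πk j x = 0 := fun j x h => by simp [πk, h]
  have εpos : ∀ m s, 0 < m → s ∈ 𝒜 m → ∀ x : k, s • x = 0 := by
    intro m s hm hs x
    rw [hk, hε m hm s hs, zero_mul]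
  have ck : Compat' (fun m => (𝒜 m : Set S)) πk := by
    intro m s hs j x
    rcases Nat.eq_zero_or_pos m with rfl | hm
    · by_cases hj : j = 0
      · subst hj; simp [πk]
      · simp [πk, hj]
    · rw [εpos m s hm hs, εpos m s hm hs, map_zero]
  -- the differential on `F ⊗ k` is zero
  have dB0 : ∀ n (f : F.ι (n + 1) → k), act' (F.D n) f = 0 := by
    intro n f
    ext c
    rw [act'_apply]
    refine Finset.sum_eq_zero fun a _ => ?_
    rcases F.graded n c a with h | ⟨m, hm, -, hs⟩
    · rw [h, zero_smul]
    · exact εpos m _ hm hs _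
  have hF0 : ∀ f : F.ι 0 → S, Ideal.Quotient.mk I (f i₀) = 0 ↔
      ∃ g : F.ι 1 → S, act' (F.D 0) g = f := by
    have h1 : ∀ f, F.aug f = Ideal.Quotient.mk I (f i₀) * F.aug (fun _ => 1) := by
      intro f
      have : f = f i₀ • (fun _ => (1 : S)) := by
        ext i; rw [hi₀ i]; simp
      conv_lhs => rw [this, map_smul]
      rfl
    obtain ⟨f1, hf1⟩ := F.augSurj 1
    rw [h1] at hf1
    intro f
    rw [← F.exact₀, h1]
    constructor
    · intro h; rw [h, zero_mul]
    · intro h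
      calc _ = (Ideal.Quotient.mk I (f i₀) * F.aug (fun _ => 1)) * Ideal.Quotient.mk I (f1 i₀) := by
            rw [mul_assoc, mul_comm (F.aug _), hf1, mul_one]
        _ = 0 := by rw [h, zero_mul]
  -- balancing for degree projections
  have balπ := fun j n => bal_both K F i₀ hF0
    (fun p q => piP' (F.deg p) (piP' (K.deg q) (prS 𝒜)) j)
    (fun q => piP' (K.deg q) πR j) (fun p => piP' (F.deg p) πk j)
    (fun p q x => act'_piP' (compat_piP' (prS_compat 𝒜) _) (F.deg (p + 1)) (F.deg p) (F.D p)
      (F.graded p) j x)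
    (fun p q x => funext fun i => act'_piP' (prS_compat 𝒜) (K.deg (q + 1)) (K.deg q) (K.D q)
      (K.graded q) (j - F.deg p i) (x i))
    (fun q x => funext fun c => by
      show πR (j - K.deg q c) (Ideal.Quotient.mk I (x i₀ c)) =
        Ideal.Quotient.mk I (prS 𝒜 (j - F.deg 0 i₀ - K.deg q c) (x i₀ c))
      rw [hπR, hdi, sub_zero])
    (fun p x => funext fun i => by
      show πk (j - F.deg p i) (K.aug (x i)) = K.aug (piP' (K.deg 0) (prS 𝒜) (j - F.deg p i) (x i))
      have haug : ∀ f, K.aug f = ∑ c, f c • K.aug (Pi.single c 1) := fun f =>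
        LinearMap.pi_apply_eq_sum_univ K.aug f |>.trans (by
          refine Finset.sum_congr rfl fun c _ => ?_
          congr 2
          ext d
          simp [Pi.single_apply, eq_comm])
      rw [haug, haug (piP' _ _ _ _), map_sum]
      refine Finset.sum_congr rfl fun c _ => ?_
      rw [piP'_apply, hK, hk, hk, eps_prS 𝒜 ε hε, Nat.cast_zero, sub_zero]
      by_cases h0 : j - F.deg p i = 0
      · rw [h0, πk0, if_pos rfl]
      · rw [πkn _ _ h0, if_neg h0, zero_mul])
    n
  have balx := fun (s : S) n => bal_both K F i₀ hF0
    (fun p q => DistribSMul.toAddMonoidHom _ s)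
    (fun q => DistribSMul.toAddMonoidHom _ s) (fun p => DistribSMul.toAddMonoidHom _ s)
    (fun p q x => (act'_smul _ s x).symm)
    (fun p q x => funext fun i => (act'_smul _ s (x i)).symm)
    (fun q x => rfl)
    (fun p x => funext fun i => (K.aug.map_smul s (x i)).symm) n
  intro haj
  have hA := main_chase K G πR hπ cS cR g₀ hg₀ hdg i j
    (by
      intro c x
      have : G.aug (fun _ => πR (j - K.deg i c) x) = 0 := by
        have h1 : (fun _ => πR (j - K.deg i c) x : G.ι 0 → S ⧸ I) =
          πR (j - K.deg i c) x • (fun _ => 1) := by ext; simp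
        obtain ⟨x, rfl⟩ := Ideal.Quotient.mk_surjective x
        rw [h1, map_smul, hπR, hkR, eps_prS 𝒜 ε hε, hK, if_neg (sub_ne_zero.2 hij), zero_mul]
      obtain ⟨g, hg⟩ := (G.exact₀ _).1 this
      exact ⟨g, congrFun hg g₀⟩)
    (by
      intro g y hy
      rcases G.graded 0 g₀ g with h | ⟨m, hm, -, s, hs, h⟩
      · exact ⟨0, by rw [h, zero_smul, map_zero]⟩
      · obtain ⟨z, hz⟩ := (balx s i).1 (fun y _ => ⟨0, by
          rw [map_zero]
          funext c
          exact (εpos m s hm hs (y c)).symm⟩) y hy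
        refine ⟨z, hz.trans ?_⟩
        rw [← h]
        rfl)
    (by
      intro p q hp hpq g y hy
      refine (balπ (j - G.deg q g) p).1 (fun y _ => ⟨0, ?_⟩) y hy
      rw [map_zero]
      funext c
      have := hno p q hp hpq g c
      exact (πkn _ _ (by omega)).symm)
  obtain ⟨z, hz⟩ := (balπ j i).2 hA (Pi.single a 1) (by
    cases i with
    | zero => trivial
    | succ i => exact dB0 _ _)
  rw [dB0] at hz
  have := congrFun hz a
  rw [piP'_apply, haj, sub_self, πk0, Pi.single_eq_same] at this
  exact zero_ne_one this

end

end Helpers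

/-- Let `S` be a standard graded Koszul algebra over `k` and `R = S/I`.
Then for every `i ≥ 0`, `t_i^S(R) ≤ 2i + Σ_{l=2}^{i+1} reg_l^R(k)`, where
`reg_l^R(k) = max { t_m^R(k) − m : m ≤ l }` is recorded by the function `r` via its
characterizing hypothesis. -/
theorem t_le_two_i_add_sum_reg
    (k : Type) [Field k] (S : Type) [CommRing S] [Algebra k S]
    (𝒜 : ℕ → Submodule k S) [GradedAlgebra 𝒜]
    (hstd : ∀ m, 𝒜 (m + 1) = 𝒜 m * 𝒜 1)
    (ε : S →ₐ[k] k) (hε : ∀ m, 1 ≤ m → ∀ x ∈ 𝒜 m, ε x = 0)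
    (I : Ideal S) (hI : Ideal.IsHomogeneous 𝒜 I)
    (hIε : ∀ a ∈ I, ε a = 0)
    (r : ℕ → ℤ) :
    letI : Module S k := Module.compHom k ε.toRingHom
    letI : Module (S ⧸ I) k :=
      Module.compHom k (Ideal.Quotient.lift I ε.toRingHom hIε)
    ∀ (Kres : MinGradedFreeRes S (fun m => (𝒜 m : Set S)) k),
      (∀ (i : ℕ) (j : ℤ), Kres.β i j ≠ 0 → j = (i : ℤ)) →
    ∀ (Rres : MinGradedFreeRes S (fun m => (𝒜 m : Set S)) (S ⧸ I)),
      (∀ j : ℤ, Rres.β 0 j = if j = 0 then 1 else 0) →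
    ∀ (kres : MinGradedFreeRes (S ⧸ I)
        (fun m => (Ideal.Quotient.mk I) '' (𝒜 m : Set S)) k),
      (∀ j : ℤ, kres.β 0 j = if j = 0 then 1 else 0) →
      (∀ m : ℕ, (∀ i ≤ m, ∀ j : ℤ, kres.β i j ≠ 0 → j - i ≤ r m) ∧
        ∃ i ≤ m, ∃ j : ℤ, kres.β i j ≠ 0 ∧ j - i = r m) →
    ∀ (i : ℕ) (j : ℤ), Rres.β i j ≠ 0 →
      j ≤ 2 * (i : ℤ) + ∑ l ∈ Finset.Icc 2 (i + 1), r l := by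
  letI mS : Module S k := Module.compHom k ε.toRingHom
  letI mR : Module (S ⧸ I) k :=
    Module.compHom k (Ideal.Quotient.lift I ε.toRingHom hIε)
  intro Kres hKres Rres hR0 kres hk0 hr
  have hr0 : ∀ m, 0 ≤ r m := by
    intro m
    have := (hr m).1 0 (Nat.zero_le _) 0 (by rw [hk0]; simp)
    simpa using this
  have hdegR : ∀ x : Rres.toB'.ι 0, x.1 = 0 := by
    rintro ⟨j, a⟩
    by_contra h
    have h1 : Rres.β 0 j = 0 := by rw [hR0, if_neg h]
    have := a.2
    omega
  have hdegk : ∀ x : kres.toB'.ι 0, x.1 = 0 := by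
    rintro ⟨j, a⟩
    by_contra h
    have h1 : kres.β 0 j = 0 := by rw [hk0, if_neg h]
    have := a.2
    omega
  have h1R : Rres.β 0 0 = 1 := by rw [hR0]; simp
  have h1k : kres.β 0 0 = 1 := by rw [hk0]; simp
  have core := core' 𝒜 ε hε I hI (fun s x => rfl) (fun s x => rfl) Kres.toB'
    (by
      rintro i ⟨j, a⟩
      exact hKres i j (by have := a.2; omega))
    Rres.toB' ⟨0, ⟨0, by omega⟩⟩ (by
      rintro ⟨j, a⟩
      obtain rfl : j = 0 := hdegR ⟨j, a⟩
      have : a = ⟨0, by omega⟩ := Fin.ext (by have := a.2; simp only; omega)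
      rw [this]) rfl
    kres.toB' ⟨0, ⟨0, by omega⟩⟩ (by
      rintro ⟨j, a⟩
      obtain rfl : j = 0 := hdegk ⟨j, a⟩
      have : a = ⟨0, by omega⟩ := Fin.ext (by have := a.2; simp only; omega)
      rw [this]) rfl
  intro i
  induction i using Nat.strong_induction_on with
  | _ i ih =>
    intro j hj
    have hsum : 0 ≤ ∑ l ∈ Finset.Icc 2 (i + 1), r l := Finset.sum_nonneg fun l _ => hr0 l
    by_cases hij : j = i
    · omega
    by_contra hcon
    refine core i j hij ?_ ⟨j, ⟨0, Nat.pos_of_ne_zero hj⟩⟩ rfl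
    rintro p q hp hpq ⟨jg, ag⟩ ⟨ja, aa⟩ hsumdeg
    have hsumdeg' : ja + jg = j := hsumdeg
    have h1 := ih p hp ja (by have := aa.2; omega)
    have h2 := (hr (i + 1)).1 q (by omega) jg (by have := ag.2; omega)
    have h3 : ∑ l ∈ Finset.Icc 2 (p + 1), r l + r (i + 1) ≤ ∑ l ∈ Finset.Icc 2 (i + 1), r l := by
      rw [Finset.sum_Icc_succ_top (by omega : 2 ≤ i + 1)]
      have : ∑ l ∈ Finset.Icc 2 (p + 1), r l ≤ ∑ l ∈ Finset.Icc 2 i, r l :=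
        Finset.sum_le_sum_of_subset_of_nonneg (Finset.Icc_subset_Icc le_rfl (by omega))
          fun l _ _ => hr0 l
      omega
    omega
end

section
/- Let S be a standard graded Koszul algebra over k and R = S/I. If reg_{n+1}^R(k) = 0 for some n ≥ 1, then t_i^S(R) ≤ 2i for all i ≤ n. -/
def KCyc {R : Type} [CommRing R] {B : ℕ → Type} [∀ q, Fintype (B q)]
    (E : ∀ q, Matrix (B (q + 1)) (B q) R) {X : Type} : (q : ℕ) → Matrix X (B q) R → Prop
  | 0, _ => True
  | q + 1, v => v * E q = 0

def KCycA {R : Type} [CommRing R] {B : ℕ → Type} [∀ q, Fintype (B q)]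
    (E : ∀ q, Matrix (B (q + 1)) (B q) R) (P : Ideal R) {X : Type} :
    (q : ℕ) → Matrix X (B q) R → Prop
  | 0, v => ∀ x b, v x b ∈ P
  | q + 1, v => v * E q = 0

theorem homB {R : Type} [CommRing R] {B : ℕ → Type} [∀ q, Fintype (B q)]
    (E : ∀ q, Matrix (B (q + 1)) (B q) R) (π : ℤ → R →+ R)
    (idem : ∀ t r, π t (π t r) = π t r)
    (hE : ∀ q b b' t r, π (t + 1) (r * E q b b') = π t r * E q b b')
    {X : Type} (q : ℕ) (t : X → ℤ) (v : Matrix X (B q) R)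
    (hv : ∀ x b, π (t x) (v x b) = v x b) (h : ∃ w : Matrix X (B (q + 1)) R, v = w * E q) :
    ∃ w : Matrix X (B (q + 1)) R, (∀ x b, π (t x - 1) (w x b) = w x b) ∧ v = w * E q := by
  obtain ⟨w, rfl⟩ := h
  refine ⟨Matrix.of fun x b => π (t x - 1) (w x b), fun x b => idem _ _, ?_⟩
  ext x b
  rw [← hv x b, Matrix.mul_apply, Matrix.mul_apply, map_sum]
  refine Finset.sum_congr rfl fun a _ => ?_
  rw [Matrix.of_apply, ← hE]
  congr 1
  congr 1
  ring

theorem homD {R : Type} [CommRing R] {C : ℕ → Type} [∀ q, Fintype (C q)]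
    (D : ∀ p, Matrix (C p) (C (p + 1)) R) (deg : ∀ p, C p → ℤ) (π : ℤ → R →+ R)
    (idem : ∀ t r, π t (π t r) = π t r)
    (hD : ∀ p c' c t r, π (t - deg p c') (D p c' c * r) = D p c' c * π (t - deg (p + 1) c) r)
    {Y : Type} (p : ℕ) (t : ℤ) (v : Matrix (C p) Y R)
    (hv : ∀ c y, π (t - deg p c) (v c y) = v c y) (h : ∃ w : Matrix (C (p + 1)) Y R, v = D p * w) :
    ∃ w : Matrix (C (p + 1)) Y R,
      (∀ c y, π (t - deg (p + 1) c) (w c y) = w c y) ∧ v = D p * w := by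
  obtain ⟨w, rfl⟩ := h
  refine ⟨Matrix.of fun c y => π (t - deg (p + 1) c) (w c y), fun x b => idem _ _, ?_⟩
  ext c y
  rw [← hv c y, Matrix.mul_apply, Matrix.mul_apply, map_sum]
  refine Finset.sum_congr rfl fun a _ => ?_
  rw [Matrix.of_apply, ← hD]

theorem homMulD {R : Type} [CommRing R] {C : ℕ → Type} [∀ q, Fintype (C q)]
    (D : ∀ p, Matrix (C p) (C (p + 1)) R) (deg : ∀ p, C p → ℤ) (π : ℤ → R →+ R)
    (hD : ∀ p c' c t r, π (t - deg p c') (D p c' c * r) = D p c' c * π (t - deg (p + 1) c) r)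
    {Y : Type} (p : ℕ) (t : ℤ) (w : Matrix (C (p + 1)) Y R)
    (hw : ∀ c y, π (t - deg (p + 1) c) (w c y) = w c y) :
    ∀ c y, π (t - deg p c) ((D p * w) c y) = (D p * w) c y := by
  intro c y
  rw [Matrix.mul_apply, map_sum]
  refine Finset.sum_congr rfl fun a _ => ?_
  rw [hD, hw]

theorem homMulE {R : Type} [CommRing R] {B : ℕ → Type} [∀ q, Fintype (B q)]
    (E : ∀ q, Matrix (B (q + 1)) (B q) R) (π : ℤ → R →+ R)
    (hE : ∀ q b b' t r, π (t + 1) (r * E q b b') = π t r * E q b b')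
    {X : Type} (q : ℕ) (t : X → ℤ) (w : Matrix X (B (q + 1)) R)
    (hw : ∀ x b, π (t x) (w x b) = w x b) :
    ∀ x b, π (t x + 1) ((w * E q) x b) = (w * E q) x b := by
  intro c y
  rw [Matrix.mul_apply, map_sum]
  refine Finset.sum_congr rfl fun a _ => ?_
  rw [hE, hw]

theorem KCyc_mulE {R : Type} [CommRing R] {B : ℕ → Type} [∀ q, Fintype (B q)]
    (E : ∀ q, Matrix (B (q + 1)) (B q) R) (hEE : ∀ q, E (q + 1) * E q = 0) {X : Type}
    (q : ℕ) (w : Matrix X (B (q + 1)) R) : KCyc E q (w * E q) := by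
  cases q with
  | zero => trivial
  | succ q => simp [KCyc, Matrix.mul_assoc, hEE]

theorem phase1 {R : Type} [CommRing R] {B C : ℕ → Type} [∀ q, Fintype (B q)]
    [∀ q, Fintype (C q)]
    (E : ∀ q, Matrix (B (q + 1)) (B q) R)
    (D : ∀ p, Matrix (C p) (C (p + 1)) R) (deg : ∀ p, C p → ℤ) (π : ℤ → R →+ R)
    (idem : ∀ t r, π t (π t r) = π t r)
    (hE : ∀ q b b' t r, π (t + 1) (r * E q b b') = π t r * E q b b')
    (hEE : ∀ q, E (q + 1) * E q = 0)
    (hD : ∀ p c' c t r, π (t - deg p c') (D p c' c * r) = D p c' c * π (t - deg (p + 1) c) r)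
    (hDD : ∀ p, D p * D (p + 1) = 0)
    (hDex : ∀ p (Y : Type) (v : Matrix (C (p + 1)) Y R), D p * v = 0 →
      ∃ w : Matrix (C (p + 2)) Y R, v = D (p + 1) * w)
    (m : Ideal R) (hpos : ∀ t : ℤ, 1 ≤ t → ∀ r, π t r ∈ m)
    (hD0 : ∀ (Y : Type) (v : Matrix (C 0) Y R), (∀ c y, v c y ∈ m) →
      ∃ w : Matrix (C 1) Y R, v = D 0 * w)
    (hE0 : ∀ (X : Type) (v : Matrix X (B 0) R), (∀ x b, v x b ∈ m) →
      ∃ w : Matrix X (B 1) R, v = w * E 0)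
    (hDm : ∀ c c', D 0 c c' ∈ m)
    (hkill : ∀ x ∈ m, ∀ (i : ℕ) (X : Type) (v : Matrix X (B (i + 1)) R), v * E i = 0 →
      ∃ w : Matrix X (B (i + 2)) R, x • v = w * E (i + 1))
    (c0 : C 0) (hdeg0 : ∀ c, deg 0 c = 0) (n : ℕ)
    (hdeg : ∀ p ≤ n + 1, ∀ c, deg p c ≤ (p : ℤ)) :
    ∀ i ≤ n, ∀ (X : Type) (t : X → ℤ) (v : Matrix X (B i) R), (∀ x, (i : ℤ) < t x) →
      (∀ x b, π (t x) (v x b) = v x b) → KCyc E i v →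
      ∃ w : Matrix X (B (i + 1)) R, v = w * E i := by
  intro i
  induction i using Nat.strong_induction_on with
  | _ i ih =>
  intro hin X t v ht hv hc
  cases i with
  | zero =>
    refine hE0 X v fun x b => ?_
    rw [← hv x b]
    exact hpos _ (by have := ht x; push_cast at this; omega) _
  | succ i =>
  -- the key lemma
  have key : ∀ (J : ℤ), 2 * ((i + 1 : ℕ) : ℤ) < J → ∀ (q p : ℕ), p + q = i + 1 →
      ∀ z : Matrix (C (p + 1)) (B q) R,
      (∀ c b, π (J - q - deg (p + 1) c) (z c b) = z c b) → KCyc E q (D p * z) →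
      ∃ w : Matrix (C (p + 2)) (B q) R,
        (∀ c b, π (J - q - deg (p + 2) c) (w c b) = w c b) ∧
        KCyc E q (z - D (p + 1) * w) := by
    intro J hJ q
    induction q with
    | zero =>
      intro p hp z hz _
      exact ⟨0, by simp, trivial⟩
    | succ q ihq =>
      intro p hp z hz hcz
      have hcz' : D p * (z * E q) = 0 := by rw [← Matrix.mul_assoc]; exact hcz
      have hu := homMulE E π hE q (fun c => J - (q + 1 : ℕ) - deg (p + 1) c) z hz
      obtain ⟨z', hz', hzz'⟩ := homD D deg π idem hD (p + 1) (J - q) (z * E q)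
        (by
          intro c b
          have := hu c b
          convert this using 3
          push_cast
          ring) (hDex p _ _ hcz')
      obtain ⟨w', hw', hcw'⟩ := ihq (p + 1) (by omega) z' hz'
        (by rw [← hzz']; exact KCyc_mulE E hEE q z)
      have hh : ∀ c b, π (J - q - deg (p + 2) c) ((z' - D (p + 2) * w') c b) =
          (z' - D (p + 2) * w') c b := by
        intro c b
        rw [Matrix.sub_apply, map_sub, hz',
          homMulD D deg π hD (p + 2) (J - q) w' hw']
      have hlt : ∀ c, (q : ℤ) < J - q - deg (p + 2) c := by
        intro c
        have := hdeg (p + 2) (by omega) c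
        push_cast at this hJ
        omega
      obtain ⟨w, hw, hww⟩ := homB E π idem hE q _ _ hh
        (ih q (by omega) (by omega) _ (fun c => J - q - deg (p + 2) c) _ hlt hh hcw')
      refine ⟨w, ?_, ?_⟩
      · intro c b
        have := hw c b
        convert this using 3
        push_cast
        ring
      · show (z - D (p + 1) * w) * E q = 0
        rw [Matrix.sub_mul, Matrix.mul_assoc, ← hww, hzz', Matrix.mul_sub, ← Matrix.mul_assoc,
          hDD]
        simp
  -- rows
  have row : ∀ x, ∃ w : B (i + 2) → R, ∀ b, v x b = ∑ a, w a * E (i + 1) a b := by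
    intro x
    let z0 : Matrix (C 0) (B (i + 1)) R := fun _ b => v x b
    have hz0 : ∀ c b, π ((t x + (i + 1 : ℕ) - (i + 1 : ℕ)) - deg 0 c) (z0 c b) = z0 c b := by
      intro c b
      rw [hdeg0]
      have := hv x b
      convert this using 3
      ring
    obtain ⟨z1, hz1, hzz⟩ := homD D deg π idem hD 0 _ z0 hz0 (hD0 _ z0 (by
      intro c b
      rw [← hz0 c b, hdeg0]
      apply hpos
      have := ht x
      push_cast at this ⊢
      omega))
    obtain ⟨w, hw, hcw⟩ := key (t x + (i + 1 : ℕ)) (by have := ht x; omega) (i + 1) 0 (by omega)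
      z1 hz1 (by
        rw [← hzz]
        show z0 * E i = 0
        ext c b
        exact congrFun (congrFun hc x) b)
    have hk := fun c => hkill (D 0 c0 c) (hDm c0 c) i _ _ hcw
    choose W hW using hk
    refine ⟨fun a => ∑ c, W c c a, fun b => ?_⟩
    have h1 : z0 = D 0 * (z1 - D 1 * w) := by
      rw [Matrix.mul_sub, ← Matrix.mul_assoc, hDD, hzz]; simp
    have h2 : v x b = (D 0 * (z1 - D 1 * w)) c0 b := by rw [← h1]
    rw [h2, Matrix.mul_apply]
    simp_rw [Finset.sum_mul]
    rw [Finset.sum_comm]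
    refine Finset.sum_congr rfl fun c _ => ?_
    have := congrFun (congrFun (hW c) c) b
    rw [Matrix.mul_apply] at this
    rw [← this]
    rfl
  choose w hw using row
  refine ⟨Matrix.of w, ?_⟩
  ext x b
  rw [hw x b, Matrix.mul_apply]
  rfl

theorem phase2 {S R : Type} [CommRing S] [CommRing R] (φ : S →+* R)
    (hφ : Function.Surjective φ) {B C : ℕ → Type} [∀ q, Fintype (B q)]
    [∀ q, Fintype (C q)]
    (E : ∀ q, Matrix (B (q + 1)) (B q) S)
    (D : ∀ p, Matrix (C p) (C (p + 1)) S) (deg : ∀ p, C p → ℤ)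
    (π : ℤ → S →+ S) (ρ : ℤ → R →+ R) (hρ : ∀ t s, ρ t (φ s) = φ (π t s))
    (idem : ∀ t r, π t (π t r) = π t r)
    (hE : ∀ q b b' t r, π (t + 1) (r * E q b b') = π t r * E q b b')
    (hEE : ∀ q, E (q + 1) * E q = 0)
    (hEex : ∀ q (X : Type) (v : Matrix X (B (q + 1)) S), v * E q = 0 →
      ∃ w : Matrix X (B (q + 2)) S, v = w * E (q + 1))
    (hD : ∀ p c' c t r, π (t - deg p c') (D p c' c * r) = D p c' c * π (t - deg (p + 1) c) r)
    (hDD : ∀ p, D p * D (p + 1) = 0)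
    (hDex : ∀ p (Y : Type) (v : Matrix (C (p + 1)) Y S), D p * v = 0 →
      ∃ w : Matrix (C (p + 2)) Y S, v = D (p + 1) * w)
    (m : Ideal S) (hm : (1 : S) ∉ m) (h1 : π 0 1 = 1)
    (hE0 : ∀ (X : Type) (v : Matrix X (B 0) S), (∀ x b, v x b ∈ m) →
      ∃ w : Matrix X (B 1) S, v = w * E 0)
    (hEm : ∀ b b', E 0 b b' ∈ m)
    (hDm : ∀ p c c', D p c c' ∈ m)
    (hD0 : ∀ (Y : Type) (v : Matrix (C 0) Y S), (∀ c y, φ (v c y) = 0) →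
      ∃ w : Matrix (C 1) Y S, v = D 0 * w)
    (hDφ : ∀ c c', φ (D 0 c c') = 0)
    (b0 : B 0) (hdeg0 : ∀ c, deg 0 c = 0) (n : ℕ)
    (hV : ∀ i ≤ n, ∀ (X : Type) (t : X → ℤ) (v : Matrix X (B i) R), (∀ x, (i : ℤ) < t x) →
      (∀ x b, ρ (t x) (v x b) = v x b) → KCyc (fun q => (E q).map φ) i v →
        ∃ w : Matrix X (B (i + 1)) R, v = w * (E i).map φ) :
    ∀ i ≤ n, ∀ c : C i, deg i c ≤ 2 * (i : ℤ) := by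
  intro i hin g
  by_contra hlt
  push Not at hlt
  cases i with
  | zero => rw [hdeg0] at hlt; simp at hlt
  | succ i =>
  generalize hJ : deg (i + 1) g = J at hlt
  have base : ∀ q, q = i + 1 → ∀ y : Matrix (C 0) (B q) S,
      (∀ c b, π (J - q - deg 0 c) (y c b) = y c b) →
      KCyc (fun q => (E q).map φ) q (y.map φ) →
      ∃ (w : Matrix (C 0) (B (q + 1)) S) (w' : Matrix (C 1) (B q) S),
        y = w * E q + D 0 * w' := by
    intro q hq y hy hc
    obtain ⟨w, hw⟩ := hV q (by omega) _ (fun c => J - q - deg 0 c) (y.map φ) (by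
      intro c
      rw [hdeg0]
      push_cast at hlt
      omega) (by
      intro c b
      rw [Matrix.map_apply, hρ, hy]) hc
    let w1 : Matrix (C 0) (B (q + 1)) S := fun c b => Function.surjInv hφ (w c b)
    have hw1 : w1.map φ = w := by
      ext c b
      exact Function.surjInv_eq hφ _
    obtain ⟨w', hw'⟩ := hD0 _ (y - w1 * E q) (by
      intro c b
      have h2 : (y - w1 * E q).map φ = 0 := by
        rw [Matrix.map_sub φ (fun a b => map_sub φ a b), Matrix.map_mul, hw1, hw, sub_self]
      exact congrFun (congrFun h2 c) b)
    exact ⟨w1, w', by rw [← hw']; abel⟩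
  have main : ∀ p q, p + 1 + q = i + 1 → ∀ y : Matrix (C (p + 1)) (B q) S,
      (∀ c b, π (J - q - deg (p + 1) c) (y c b) = y c b) →
      KCycA E m q (D p * y) →
      ∃ (w : Matrix (C (p + 1)) (B (q + 1)) S) (w' : Matrix (C (p + 2)) (B q) S),
        y = w * E q + D (p + 1) * w' := by
    intro p
    induction p with
    | zero =>
      intro q hq y hy hc
      have hb : ∃ w : Matrix (C 0) (B (q + 1)) S, D 0 * y = w * E q := by
        cases q with
        | zero => exact hE0 _ _ hc
        | succ q => exact hEex _ _ _ hc
      obtain ⟨y', hy', hyy⟩ := homB E π idem hE q _ _ (homMulD D deg π hD 0 (J - q) y hy) hb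
      obtain ⟨w, w', hww⟩ := base (q + 1) (by omega) y' (by
        intro c b
        have := hy' c b
        convert this using 3
        push_cast
        ring) (by
        show y'.map φ * (E q).map φ = 0
        rw [← Matrix.map_mul, ← hyy]
        ext c b
        simp [Matrix.mul_apply, map_sum, hDφ])
      obtain ⟨w2, hw2⟩ := hDex 0 _ (y - w' * E q) (by
        rw [Matrix.mul_sub, hyy, hww, Matrix.add_mul, Matrix.mul_assoc, hEE, Matrix.mul_assoc]
        simp)
      exact ⟨w', w2, by rw [← hw2]; abel⟩
    | succ p ihp =>
      intro q hq y hy hc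
      have hb : ∃ w : Matrix (C (p + 1)) (B (q + 1)) S, D (p + 1) * y = w * E q := by
        cases q with
        | zero => exact hE0 _ _ hc
        | succ q => exact hEex _ _ _ hc
      obtain ⟨y', hy', hyy⟩ := homB E π idem hE q _ _
        (homMulD D deg π hD (p + 1) (J - q) y hy) hb
      obtain ⟨w, w', hww⟩ := ihp (q + 1) (by omega) y' (by
        intro c b
        have := hy' c b
        convert this using 3
        push_cast
        ring) (by
        show D p * y' * E q = 0
        rw [Matrix.mul_assoc, ← hyy, ← Matrix.mul_assoc, hDD]
        simp)
      obtain ⟨w2, hw2⟩ := hDex (p + 1) _ (y - w' * E q) (by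
        rw [Matrix.mul_sub, hyy, hww, Matrix.add_mul, Matrix.mul_assoc, hEE, Matrix.mul_assoc]
        simp)
      exact ⟨w', w2, by rw [← hw2]; abel⟩
  classical
  obtain ⟨w, w', hw⟩ := main i 0 (by omega) (Matrix.of fun c _ => if c = g then 1 else 0) (by
    intro c b
    by_cases h : c = g
    · subst h
      simp [hJ, h1]
    · simp [h]) (by
    intro c b
    rw [Matrix.mul_apply]
    exact Ideal.sum_mem _ fun a _ => Ideal.mul_mem_right _ _ (hDm _ _ _))
  apply hm
  have h3 := congrFun (congrFun hw g) b0
  simp only [Matrix.of_apply, if_true] at h3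
  rw [h3, Matrix.add_apply, Matrix.mul_apply, Matrix.mul_apply]
  exact Ideal.add_mem _
    (Ideal.sum_mem _ fun a _ => Ideal.mul_mem_left _ _ (hEm _ _))
    (Ideal.sum_mem _ fun a _ => Ideal.mul_mem_right _ _ (hDm _ _ _))

theorem kill {S : Type} [CommRing S] {B : ℕ → Type} [∀ q, Fintype (B q)]
    (E : ∀ q, Matrix (B (q + 1)) (B q) S)
    (hEE : ∀ q, E (q + 1) * E q = 0)
    (hEex : ∀ q (X : Type) (v : Matrix X (B (q + 1)) S), v * E q = 0 →
      ∃ w : Matrix X (B (q + 2)) S, v = w * E (q + 1))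
    (m : Ideal S)
    (hE0 : ∀ (X : Type) (v : Matrix X (B 0) S), (∀ x b, v x b ∈ m) →
      ∃ w : Matrix X (B 1) S, v = w * E 0)
    (x : S) (hx : x ∈ m) (i : ℕ) [DecidableEq (B (i + 1))] :
    ∃ (s : Matrix (B i) (B (i + 1)) S) (s' : Matrix (B (i + 1)) (B (i + 2)) S),
      x • (1 : Matrix (B (i + 1)) (B (i + 1)) S) = s' * E (i + 1) + E i * s := by
  have step : ∀ i, ∃ s : Matrix (B i) (B (i + 1)) S, E i * s * E i = x • E i := by
    classical
    intro i
    induction i with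
    | zero =>
      obtain ⟨s, hs⟩ := hE0 _ (x • (1 : Matrix (B 0) (B 0) S)) (by
        intro a b
        exact Ideal.mul_mem_right _ _ hx)
      exact ⟨s, by rw [Matrix.mul_assoc, ← hs]; simp⟩
    | succ i ih =>
      obtain ⟨s, hs⟩ := ih
      obtain ⟨s', hs'⟩ := hEex i _ (x • (1 : Matrix (B (i + 1)) (B (i + 1)) S) - E i * s) (by
        rw [Matrix.sub_mul, hs]; simp)
      exact ⟨s', by
        rw [Matrix.mul_assoc, ← hs', Matrix.mul_sub, ← Matrix.mul_assoc, hEE]; simp⟩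
  obtain ⟨s, hs⟩ := step i
  obtain ⟨s', hs'⟩ := hEex i _ (x • (1 : Matrix (B (i + 1)) (B (i + 1)) S) - E i * s) (by
    rw [Matrix.sub_mul, hs]; simp)
  exact ⟨s, s', by rw [← hs']; abel⟩

section Conv

variable {A : Type} [CommRing A] {hom : ℕ → Set A} {M : Type} [AddCommGroup M] [Module A M]

abbrev RIdx (res : MinGradedFreeRes A hom M) (i : ℕ) : Type := (j : ℤ) × Fin (res.β i j)

theorem RIdx_finite (res : MinGradedFreeRes A hom M) (i : ℕ) : Finite (RIdx res i) := by
  have := (res.finβ i).to_subtype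
  let f : RIdx res i → (j : Function.support (res.β i)) × Fin (res.β i j) := fun c =>
    ⟨⟨c.1, by
      have := c.2.pos
      simp only [Function.mem_support]
      omega⟩, c.2⟩
  refine Finite.of_injective f ?_
  rintro ⟨j, a⟩ ⟨j', a'⟩ h
  have h1 : j = j' := congrArg (fun x => (x.1 : ℤ)) h
  subst h1
  simpa [f] using h

noncomputable instance (res : MinGradedFreeRes A hom M) (i : ℕ) : Fintype (RIdx res i) :=
  @Fintype.ofFinite _ (RIdx_finite res i)

noncomputable def rmat (res : MinGradedFreeRes A hom M) (p : ℕ) :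
    Matrix (RIdx res p) (RIdx res (p + 1)) A :=
  Matrix.of fun c' c => res.d p (Finsupp.single c 1) c'

theorem fm_expand {ι N : Type} [Fintype ι] [AddCommGroup N] [Module A N] (l : (ι →₀ A) →ₗ[A] N)
    (f : ι →₀ A) : l f = ∑ c, f c • l (Finsupp.single c 1) := by
  classical
  conv_lhs => rw [← Finsupp.univ_sum_single f]
  rw [map_sum]
  refine Finset.sum_congr rfl fun c _ => ?_
  rw [← map_smul, Finsupp.smul_single, smul_eq_mul, mul_one]

theorem rd_apply (res : MinGradedFreeRes A hom M) (p : ℕ) (f : FreeMod A (res.β (p + 1)))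
    (c' : RIdx res p) : res.d p f c' = ∑ c, rmat res p c' c * f c := by
  rw [fm_expand (ι := RIdx res (p + 1)) (res.d p) f, Finsupp.finsetSum_apply]
  refine Finset.sum_congr rfl fun c _ => ?_
  rw [Finsupp.smul_apply, smul_eq_mul, mul_comm]
  rfl

theorem rmat_lift (res : MinGradedFreeRes A hom M) (p : ℕ) {Y : Type}
    (v : Matrix (RIdx res p) Y A)
    (h : ∀ y, (Finsupp.equivFunOnFinite.symm (fun c => v c y) : FreeMod A (res.β p)) ∈
      LinearMap.range (res.d p)) :
    ∃ w : Matrix (RIdx res (p + 1)) Y A, v = rmat res p * w := by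
  choose w hw using h
  refine ⟨Matrix.of fun c y => w y c, ?_⟩
  ext c y
  rw [Matrix.mul_apply]
  have := DFunLike.congr_fun (hw y) c
  rw [rd_apply] at this
  simpa using this.symm

theorem rmat_exact (res : MinGradedFreeRes A hom M) (p : ℕ) (Y : Type)
    (v : Matrix (RIdx res (p + 1)) Y A) (h : rmat res p * v = 0) :
    ∃ w : Matrix (RIdx res (p + 2)) Y A, v = rmat res (p + 1) * w := by
  refine rmat_lift res (p + 1) v fun y => ?_
  rw [res.exact p, LinearMap.mem_ker]
  ext c
  rw [rd_apply]
  have := congrFun (congrFun h c) y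
  rw [Matrix.mul_apply] at this
  simpa using this

theorem rmat_mul (res : MinGradedFreeRes A hom M) (p : ℕ) :
    rmat res p * rmat res (p + 1) = 0 := by
  ext c c'
  rw [Matrix.mul_apply]
  have h : res.d (p + 1) (Finsupp.single c' 1) ∈ LinearMap.ker (res.d p) := by
    rw [← res.exact p]
    exact ⟨_, rfl⟩
  have := DFunLike.congr_fun (LinearMap.mem_ker.1 h) c
  rw [rd_apply] at this
  exact this

theorem rmat_aug (res : MinGradedFreeRes A hom M) (Y : Type)
    (v : Matrix (RIdx res 0) Y A) (h : ∀ c y (x : M), v c y • x = 0) :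
    ∃ w : Matrix (RIdx res 1) Y A, v = rmat res 0 * w := by
  refine rmat_lift res 0 v fun y => ?_
  rw [res.exact₀, LinearMap.mem_ker, fm_expand (ι := RIdx res 0)]
  refine Finset.sum_eq_zero fun c _ => ?_
  exact h c y _

theorem rmat_mem (res : MinGradedFreeRes A hom M) (P : Ideal A)
    (hP : ∀ m, 1 ≤ m → ∀ a ∈ hom m, a ∈ P) (p : ℕ) (c : RIdx res p) (c' : RIdx res (p + 1)) :
    rmat res p c c' ∈ P := by
  by_cases h0 : rmat res p c c' = 0
  · rw [h0]; exact P.zero_mem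
  · obtain ⟨j, a⟩ := c
    obtain ⟨j', a'⟩ := c'
    have h1 := res.minimal p j' a' j a h0
    rcases res.graded p j' a' j a with h | ⟨m, hm, h⟩
    · exact absurd h h0
    · exact hP m (by omega) _ h

theorem rmat_graded (res : MinGradedFreeRes A hom M) (π : ℤ → A →+ A)
    (hmul : ∀ (m : ℕ), ∀ a ∈ hom m, ∀ t r, π (t + m) (a * r) = a * π t r)
    (p : ℕ) (c' : RIdx res p) (c : RIdx res (p + 1)) (t : ℤ) (r : A) :
    π (t - c'.1) (rmat res p c' c * r) = rmat res p c' c * π (t - c.1) r := by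
  obtain ⟨j', a'⟩ := c'
  obtain ⟨j, a⟩ := c
  rcases res.graded p j a j' a' with h | ⟨m, hm, h⟩
  · have h0 : rmat res p ⟨j', a'⟩ ⟨j, a⟩ = 0 := h
    simp [h0]
  · have := hmul m _ h (t - j) r
    rw [show t - j + m = t - j' by omega] at this
    exact this

theorem exists_gpi {k S : Type} [Field k] [CommRing S] [Algebra k S]
    (𝒜 : ℕ → Submodule k S) [GradedAlgebra 𝒜] :
    ∃ π : ℤ → S →+ S, (∀ t r, π t (π t r) = π t r) ∧
      (∀ (m : ℕ), ∀ a ∈ 𝒜 m, ∀ t r, π (t + m) (a * r) = a * π t r) ∧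
      (∀ (m : ℕ) r, π m r ∈ 𝒜 m) ∧ π 0 1 = 1 ∧
      (∀ I : Ideal S, I.IsHomogeneous 𝒜 → ∀ t, ∀ a ∈ I, π t a ∈ I) := by
  refine ⟨fun t => if 0 ≤ t then GradedRing.proj 𝒜 t.toNat else 0, ?_, ?_, ?_, ?_, ?_⟩
  · intro t r
    dsimp only
    split_ifs
    · simp only [GradedRing.proj_apply]
      rw [DirectSum.decompose_coe, DirectSum.of_eq_same]
    · rfl
  · intro m a ha t r
    dsimp only
    by_cases ht : 0 ≤ t
    · obtain ⟨s, rfl⟩ := Int.eq_ofNat_of_zero_le ht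
      rw [if_pos (by omega), if_pos (by omega)]
      simp only [GradedRing.proj_apply]
      rw [show ((s : ℤ) + m).toNat = m + s by omega, show (s : ℤ).toNat = s by omega]
      exact DirectSum.coe_decompose_mul_add_of_left_mem 𝒜 ha
    · rw [if_neg ht]
      split_ifs with h
      · simp only [GradedRing.proj_apply, AddMonoidHom.zero_apply, mul_zero]
        exact DirectSum.coe_decompose_mul_of_left_mem_of_not_le 𝒜 ha (by omega)
      · simp
  · intro m r
    simp [GradedRing.proj_apply]
  · simp only [le_refl, if_true, GradedRing.proj_apply]
    exact DirectSum.decompose_of_mem_same (i := 0) 𝒜 SetLike.GradedOne.one_mem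
  · intro I hI t a ha
    dsimp only
    split_ifs
    · simp only [GradedRing.proj_apply]
      exact hI _ ha
    · exact I.zero_mem

end Conv

/-- Let `S` be a standard graded Koszul algebra over `k` and `R = S/I`.
If `reg_{n+1}^R(k) = 0` for some `n ≥ 1` (i.e. `β^R_{i,j}(k) ≠ 0` with `i ≤ n+1` implies
`j ≤ i`), then `t_i^S(R) ≤ 2i` for all `i ≤ n`. -/
theorem t_le_two_mul_of_reg_eq_zero
    (k : Type) [Field k] (S : Type) [CommRing S] [Algebra k S]
    (𝒜 : ℕ → Submodule k S) [GradedAlgebra 𝒜]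
    (hstd : ∀ m, 𝒜 (m + 1) = 𝒜 m * 𝒜 1)
    (ε : S →ₐ[k] k) (hε : ∀ m, 1 ≤ m → ∀ x ∈ 𝒜 m, ε x = 0)
    (I : Ideal S) (hI : Ideal.IsHomogeneous 𝒜 I)
    (hIε : ∀ a ∈ I, ε a = 0)
    (n : ℕ) (hn : 1 ≤ n) :
    letI : Module S k := Module.compHom k ε.toRingHom
    letI : Module (S ⧸ I) k :=
      Module.compHom k (Ideal.Quotient.lift I ε.toRingHom hIε)
    ∀ (Kres : MinGradedFreeRes S (fun m => (𝒜 m : Set S)) k),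
      (∀ (i : ℕ) (j : ℤ), Kres.β i j ≠ 0 → j = (i : ℤ)) →
    ∀ (Rres : MinGradedFreeRes S (fun m => (𝒜 m : Set S)) (S ⧸ I)),
      (∀ j : ℤ, Rres.β 0 j = if j = 0 then 1 else 0) →
    ∀ (kres : MinGradedFreeRes (S ⧸ I)
        (fun m => (Ideal.Quotient.mk I) '' (𝒜 m : Set S)) k),
      (∀ j : ℤ, kres.β 0 j = if j = 0 then 1 else 0) →
      (∀ i ≤ n + 1, ∀ j : ℤ, kres.β i j ≠ 0 → j ≤ (i : ℤ)) →
    ∀ i ≤ n, ∀ j : ℤ, Rres.β i j ≠ 0 → j ≤ 2 * (i : ℤ) := by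
  let instS : Module S k := Module.compHom k ε.toRingHom
  let instR : Module (S ⧸ I) k :=
    Module.compHom k (Ideal.Quotient.lift I ε.toRingHom hIε)
  intro Kres hK Rres hR0 kres hk0 hk i hi j hj
  obtain ⟨π, idem, hmul, hmem, hone, hhom⟩ := exists_gpi 𝒜
  have hsurj : Function.Surjective (Ideal.Quotient.mk I) := Ideal.Quotient.mk_surjective
  have hρex : ∀ t, ∃ ρ : (S ⧸ I) →+ (S ⧸ I),
      ∀ s, ρ (Ideal.Quotient.mk I s) = Ideal.Quotient.mk I (π t s) := by
    intro t
    refine ⟨QuotientAddGroup.lift I.toAddSubgroup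
      ((Ideal.Quotient.mk I).toAddMonoidHom.comp (π t)) ?_, fun s => rfl⟩
    intro a ha
    exact Ideal.Quotient.eq_zero_iff_mem.2 (hhom I hI t a ha)
  choose ρ hρ using hρex
  let m : Ideal S := RingHom.ker ε.toRingHom
  have hm𝒜 : ∀ q, 1 ≤ q → ∀ a ∈ (𝒜 q : Set S), a ∈ m := fun q hq a ha => hε q hq a ha
  have hsmul : ∀ a ∈ m, ∀ x : k, a • x = 0 := by
    intro a ha x
    show ε a * x = 0
    rw [show ε a = 0 from ha, zero_mul]
  let mR : Ideal (S ⧸ I) := RingHom.ker (Ideal.Quotient.lift I ε.toRingHom hIε)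
  have hmR : ∀ a, (Ideal.Quotient.mk I) a ∈ mR ↔ a ∈ m := fun a => Iff.rfl
  have hsmulR : ∀ a ∈ mR, ∀ x : k, a • x = 0 := by
    intro a ha x
    show Ideal.Quotient.lift I ε.toRingHom hIε a * x = 0
    rw [show Ideal.Quotient.lift I ε.toRingHom hIε a = 0 from ha, zero_mul]
  have hπpos : ∀ t : ℤ, 1 ≤ t → ∀ r, π t r ∈ m := by
    intro t ht r
    obtain ⟨s, rfl⟩ := Int.eq_ofNat_of_zero_le (by omega : 0 ≤ t)
    exact hm𝒜 s (by omega) _ (hmem s r)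
  -- the Koszul side
  let E : ∀ q, Matrix (RIdx Kres (q + 1)) (RIdx Kres q) S := fun q => (rmat Kres q).transpose
  have hEE : ∀ q, E (q + 1) * E q = 0 := by
    intro q
    rw [← Matrix.transpose_mul, rmat_mul, Matrix.transpose_zero]
  have hEex : ∀ q (X : Type) (v : Matrix X (RIdx Kres (q + 1)) S), v * E q = 0 →
      ∃ w : Matrix X (RIdx Kres (q + 2)) S, v = w * E (q + 1) := by
    intro q X v hv
    obtain ⟨w, hw⟩ := rmat_exact Kres q X v.transpose (by
      have := congrArg Matrix.transpose hv
      rwa [Matrix.transpose_mul, Matrix.transpose_transpose, Matrix.transpose_zero] at this)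
    refine ⟨w.transpose, ?_⟩
    rw [← Matrix.transpose_mul, ← hw, Matrix.transpose_transpose]
  have hE0 : ∀ (X : Type) (v : Matrix X (RIdx Kres 0) S), (∀ x b, v x b ∈ m) →
      ∃ w : Matrix X (RIdx Kres 1) S, v = w * E 0 := by
    intro X v hv
    obtain ⟨w, hw⟩ := rmat_aug Kres X v.transpose (fun c y x => hsmul _ (hv y c) x)
    refine ⟨w.transpose, ?_⟩
    rw [← Matrix.transpose_mul, ← hw, Matrix.transpose_transpose]
  have hKdeg : ∀ q (c : RIdx Kres q), c.1 = (q : ℤ) := fun q c =>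
    hK q c.1 (by have := c.2.pos; omega)
  have hE : ∀ q b b' t r, π (t + 1) (r * E q b b') = π t r * E q b b' := by
    intro q b b' t r
    have := rmat_graded Kres π hmul q b' b (t + 1 + q) r
    rw [hKdeg, hKdeg, show t + 1 + (q : ℤ) - q = t + 1 by ring,
      show t + 1 + (q : ℤ) - ((q + 1 : ℕ) : ℤ) = t by push_cast; ring] at this
    rw [mul_comm r, mul_comm (π t r)]
    exact this
  have hb0 : Nonempty (RIdx Kres 0) := by
    by_contra hne
    rw [not_nonempty_iff] at hne
    obtain ⟨f, hf⟩ := Kres.augSurj (1 : k)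
    rw [fm_expand (ι := RIdx Kres 0), Finset.univ_eq_empty, Finset.sum_empty] at hf
    exact zero_ne_one hf
  -- the quotient side
  have hdeg0 : ∀ b : ℤ → ℕ, (∀ j, b j = if j = 0 then 1 else 0) →
      ∀ c : (j : ℤ) × Fin (b j), c.1 = 0 := by
    intro b hb c
    by_contra h
    have := c.2.pos
    rw [hb, if_neg h] at this
    omega
  let ER : ∀ q, Matrix (RIdx Kres (q + 1)) (RIdx Kres q) (S ⧸ I) := fun q => (E q).map (Ideal.Quotient.mk I)
  have idemR : ∀ t r, ρ t (ρ t r) = ρ t r := by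
    intro t r
    obtain ⟨s, rfl⟩ := hsurj r
    rw [hρ, hρ, idem]
  have hmulR : ∀ (q : ℕ), ∀ a ∈ (Ideal.Quotient.mk I) '' (𝒜 q : Set S), ∀ t r,
      ρ (t + q) (a * r) = a * ρ t r := by
    rintro q _ ⟨a, ha, rfl⟩ t r
    obtain ⟨s, rfl⟩ := hsurj r
    rw [← map_mul, hρ, hρ, hmul q a ha, map_mul]
  have hV := phase1 ER (rmat kres) (fun p c => c.1) ρ idemR
    (by
      intro q b b' t r
      obtain ⟨s, rfl⟩ := hsurj r
      show ρ (t + 1) ((Ideal.Quotient.mk I) s * (Ideal.Quotient.mk I) (E q b b')) = ρ t ((Ideal.Quotient.mk I) s) * (Ideal.Quotient.mk I) (E q b b')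
      rw [← map_mul, hρ, hρ, hE, map_mul])
    (by
      intro q
      show (E (q + 1)).map (Ideal.Quotient.mk I) * (E q).map (Ideal.Quotient.mk I) = 0
      rw [← Matrix.map_mul, hEE]
      ext a b
      simp)
    (fun p c' c t r => rmat_graded kres ρ hmulR p c' c t r)
    (rmat_mul kres) (rmat_exact kres) mR
    (by
      intro t ht r
      obtain ⟨s, rfl⟩ := hsurj r
      rw [hρ, hmR]
      exact hπpos t ht s)
    (fun Y v hv => rmat_aug kres Y v fun c y x => hsmulR _ (hv c y) x)
    (by
      intro X v hv
      let v1 : Matrix X (RIdx Kres 0) S := Matrix.of fun x b => Function.surjInv hsurj (v x b)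
      have hv1 : v1.map (Ideal.Quotient.mk I) = v := by
        ext c b
        exact Function.surjInv_eq hsurj _
      obtain ⟨w, hw⟩ := hE0 X v1 (by
        intro x b
        rw [← hmR]
        have : (Ideal.Quotient.mk I) (v1 x b) = v x b := Function.surjInv_eq hsurj _
        rw [this]
        exact hv x b)
      refine ⟨w.map (Ideal.Quotient.mk I), ?_⟩
      rw [← hv1, hw, Matrix.map_mul])
    (fun c c' => rmat_mem kres mR (by
      rintro q hq _ ⟨a, ha, rfl⟩
      exact (hmR a).2 (hm𝒜 q hq a ha)) 0 c c')
    (by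
      intro x hx q X v hv
      classical
      obtain ⟨y, rfl⟩ := hsurj x
      obtain ⟨s, s', hs⟩ := kill E hEE hEex m hE0 y ((hmR y).1 hx) q
      refine ⟨v * s'.map (Ideal.Quotient.mk I), ?_⟩
      have h1 := congrArg (fun M => v * M.map (Ideal.Quotient.mk I)) hs
      rw [Matrix.map_add (Ideal.Quotient.mk I) (fun a b => map_add (Ideal.Quotient.mk I) a b), Matrix.map_mul, Matrix.map_mul,
        Matrix.mul_add, ← Matrix.mul_assoc v ((E q).map (Ideal.Quotient.mk I)), hv, Matrix.zero_mul, add_zero,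
        ← Matrix.mul_assoc] at h1
      rw [← h1]
      have h2 : (y • (1 : Matrix (RIdx Kres (q + 1)) (RIdx Kres (q + 1)) S)).map (Ideal.Quotient.mk I) =
          (Ideal.Quotient.mk I) y • (1 : Matrix (RIdx Kres (q + 1)) (RIdx Kres (q + 1)) (S ⧸ I)) := by
        ext a b
        simp [Matrix.one_apply, apply_ite (Ideal.Quotient.mk I)]
      rw [h2, Matrix.mul_smul, Matrix.mul_one])
    (⟨0, ⟨0, by rw [hk0]; simp⟩⟩ : RIdx kres 0)
    (hdeg0 _ hk0) n
    (fun p hp c => hk p hp c.1 (by have := c.2.pos; omega))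
  have hsub : ∀ c c' : RIdx Rres 0, c = c' := by
    rintro ⟨a, x⟩ ⟨b, y⟩
    have h1 := hdeg0 _ hR0 ⟨a, x⟩
    have h2 := hdeg0 _ hR0 ⟨b, y⟩
    simp only at h1 h2
    subst h1
    subst h2
    have : x = y := by
      apply Fin.ext
      have h3 := x.2
      have h4 := y.2
      have h5 := hR0 0
      simp only [if_true] at h5
      omega
    rw [this]
  have hfin := phase2 (Ideal.Quotient.mk I) hsurj E (rmat Rres) (fun p c => c.1) π ρ hρ idem hE hEE hEex
    (fun p c' c t r => rmat_graded Rres π hmul p c' c t r)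
    (rmat_mul Rres) (rmat_exact Rres) m
    (by
      intro h
      have : ε 1 = 0 := h
      simp at this)
    hone hE0
    (fun b b' => rmat_mem Kres m hm𝒜 0 b' b)
    (rmat_mem Rres m hm𝒜)
    (by
      intro Y v hv
      refine rmat_aug Rres Y v fun c y x => ?_
      obtain ⟨s, rfl⟩ := hsurj x
      show (Ideal.Quotient.mk I) (v c y * s) = 0
      rw [map_mul, hv, zero_mul])
    (by
      intro c c'
      obtain ⟨f, hf⟩ := Rres.augSurj 1
      have hcu : (Finset.univ : Finset (RIdx Rres 0)) = {c} := by
        ext x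
        simp [hsub x c]
      rw [fm_expand (ι := RIdx Rres 0), hcu, Finset.sum_singleton] at hf
      have h0 : Rres.d 0 (Finsupp.single c' 1) ∈ LinearMap.ker Rres.aug := by
        rw [← Rres.exact₀]
        exact ⟨_, rfl⟩
      rw [LinearMap.mem_ker, fm_expand (ι := RIdx Rres 0), hcu, Finset.sum_singleton] at h0
      have h1 : rmat Rres 0 c c' • Rres.aug (Finsupp.single c 1) = 0 := h0
      have h2 : rmat Rres 0 c c' • (1 : S ⧸ I) = 0 := by
        rw [← hf, smul_comm, h1, smul_zero]
      have h3 : (Ideal.Quotient.mk I) (rmat Rres 0 c c' * 1) = 0 := h2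
      rwa [mul_one] at h3)
    hb0.some (hdeg0 _ hR0) n hV i hi
  exact hfin ⟨j, ⟨0, Nat.pos_of_ne_zero hj⟩⟩
end
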